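/- Let K be a subfield of ℝ. The first-order theory of the ordered K-vector space ℝ (the structure (ℝ; <, +, (λ_c)_{c∈K}) with scalar multiplication by each element of K) expanded by a unary predicate for ℤ is decidable if and only if K has degree at most 2 over ℚ, i.e., K = ℚ or K is a real quadratic field ℚ(√d) for some positive non-square rational d. -/

import Mathlib

open FirstOrder

/-- A Gödel numbering for sentences of a language whose symbols are encodable, obtained
from Mathlib's list encoding of first-order formulas. -/
noncomputable def sentenceEncode {L : FirstOrder.Language}
    (eF : ∀ n, Encodable (L.Functions n)) (eR : ∀ n, Encodable (L.Relations n))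
    (φ : L.Sentence) : ℕ :=
  letI := eF
  letI := eR
  Encodable.encode (FirstOrder.Language.BoundedFormula.listEncode φ)

/-- The first-order theory of an `L`-structure `M` is decidable: the symbols of `L` admit
a Gödel numbering with respect to which the set of sentences true in `M` is computable. -/
def TheoryDecidable (L : FirstOrder.Language) (M : Type*) [L.Structure M] : Prop :=
  ∃ (eF : ∀ n, Encodable (L.Functions n)) (eR : ∀ n, Encodable (L.Relations n))
    (f : ℕ → Bool), Computable f ∧
      ∀ φ : L.Sentence, (f (sentenceEncode eF eR φ) = true ↔ M ⊨ φ)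

/-- The language of the ordered `K`-vector space `ℝ` with a predicate for `ℤ`:
a unary function symbol for each scalar `c ∈ K`, a binary function `+`,
a unary predicate for `ℤ` and a binary relation `<`. -/
def kLang (K : Subfield ℝ) : FirstOrder.Language where
  Functions := fun n => match n with
    | 1 => ↥K
    | 2 => Unit
    | _ => Empty
  Relations := fun n => match n with
    | 1 => Unit
    | 2 => Unit
    | _ => Empty

/-- The structure `(ℝ; <, +, ℤ, (λ_c)_{c ∈ K})`, where `λ_c x = c·x`. -/
def kStruc (K : Subfield ℝ) : (kLang K).Structure ℝ where
  funMap {n} f v :=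
    match n, f, v with
    | 1, c, v => ((show ↥K from c) : ℝ) * v 0
    | 2, _, v => v 0 + v 1
  RelMap {n} r v :=
    match n, r, v with
    | 1, _, v => ∃ z : ℤ, v 0 = (z : ℝ)
    | 2, _, v => v 0 < v 1

section Equidistribution

open Filter Topology

/-- The Cesàro means of `f` tend to `m`. -/
def HasMean (f : ℕ → ℂ) (m : ℂ) : Prop :=
  Tendsto (fun N : ℕ => (∑ n ∈ Finset.range N, f n) / N) atTop (𝓝 m)

theorem HasMean.sum {ι : Type*} (s : Finset ι) {f : ι → ℕ → ℂ} {m : ι → ℂ}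
    (h : ∀ i ∈ s, HasMean (f i) (m i)) : HasMean (fun n => ∑ i ∈ s, f i n) (∑ i ∈ s, m i) := by
  refine (tendsto_finsetSum s h).congr fun N => ?_
  rw [Finset.sum_comm, Finset.sum_div]

theorem HasMean.const_mul {f : ℕ → ℂ} {m : ℂ} (c : ℂ) (h : HasMean f m) :
    HasMean (fun n => c * f n) (c * m) := by
  refine (Tendsto.const_mul c h).congr fun N => ?_
  rw [← Finset.mul_sum, mul_div_assoc]

theorem hasMean_one : HasMean (fun _ => 1) 1 := by
  refine tendsto_const_nhds.congr' ?_
  filter_upwards [eventually_gt_atTop 0] with N hN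
  have : (N : ℂ) ≠ 0 := by exact_mod_cast hN.ne'
  simp [this]

theorem hasMean_pow {z : ℂ} (hz : ‖z‖ = 1) (h1 : z ≠ 1) : HasMean (fun n => z ^ n) 0 := by
  have hz1 : ‖z - 1‖ ≠ 0 := by simpa [sub_eq_zero] using h1
  have hb : ∀ N : ℕ, ‖(∑ n ∈ Finset.range N, z ^ n) / N‖ ≤ (2 / ‖z - 1‖) / N := by
    intro N
    rw [geom_sum_eq h1, norm_div, norm_div, Complex.norm_natCast]
    gcongr
    calc ‖z ^ N - 1‖ ≤ ‖z ^ N‖ + ‖(1 : ℂ)‖ := norm_sub_le _ _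
      _ = 2 := by rw [norm_pow, hz]; norm_num
  exact squeeze_zero_norm hb (tendsto_const_div_atTop_nhds_zero_nat _)

theorem HasMean.norm_le {f : ℕ → ℂ} {m : ℂ} {C : ℝ} (h : HasMean f m) (hC : ∀ n, ‖f n‖ ≤ C) :
    ‖m‖ ≤ C := by
  have hC0 : 0 ≤ C := (norm_nonneg _).trans (hC 0)
  refine le_of_tendsto' h.norm fun N => ?_
  rw [norm_div, Complex.norm_natCast]
  rcases Nat.eq_zero_or_pos N with rfl | hN
  · simpa using hC0
  · rw [div_le_iff₀ (by exact_mod_cast hN)]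
    calc ‖∑ n ∈ Finset.range N, f n‖ ≤ ∑ n ∈ Finset.range N, C := norm_sum_le_of_le _ fun n _ => hC n
      _ = C * N := by simp [mul_comm]

/-- The character `x ↦ exp (2πix)`. -/
noncomputable def expChar (x : ℝ) : ℂ := Complex.exp (2 * Real.pi * x * Complex.I)

theorem expChar_add (x y : ℝ) : expChar (x + y) = expChar x * expChar y := by
  rw [expChar, expChar, expChar, ← Complex.exp_add]; push_cast; ring_nf

theorem expChar_nat_mul (n : ℕ) (x : ℝ) : expChar (n * x) = expChar x ^ n := by
  rw [expChar, expChar, ← Complex.exp_nat_mul]; push_cast; ring_nf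

theorem norm_expChar (x : ℝ) : ‖expChar x‖ = 1 := by
  rw [expChar, show (2 * Real.pi * x * Complex.I : ℂ) = ((2 * Real.pi * x : ℝ) : ℂ) * Complex.I by
    push_cast; ring, Complex.norm_exp_ofReal_mul_I]

theorem expChar_int (z : ℤ) : expChar z = 1 := by
  rw [expChar, Complex.exp_eq_one_iff]; exact ⟨z, by push_cast; ring⟩

theorem expChar_ne_one {x : ℝ} (h : ∀ z : ℤ, x ≠ z) : expChar x ≠ 1 := by
  intro he
  rw [expChar, Complex.exp_eq_one_iff] at he
  obtain ⟨z, hz⟩ := he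
  apply h z
  have hp : (2 * Real.pi * Complex.I : ℂ) ≠ 0 := by
    simp [Real.pi_ne_zero]
  have : (x : ℂ) = z := mul_left_cancel₀ hp (by linear_combination hz)
  exact_mod_cast this

/-- A trigonometric polynomial concentrated around the integers. -/
noncomputable def peak (k : ℕ) (x : ℝ) : ℂ := (1 + expChar x) ^ (2 * k) / 4 ^ k

theorem norm_one_add_expChar (x : ℝ) : ‖1 + expChar x‖ = 2 * |Real.cos (Real.pi * x)| := by
  have : 1 + expChar x = expChar (x / 2) * ((2 * Real.cos (Real.pi * x) : ℝ) : ℂ) := by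
    have h2 : ((2 * Real.cos (Real.pi * x) : ℝ) : ℂ) = expChar (x / 2) + expChar (-x / 2) := by
      push_cast
      rw [Complex.cos, expChar, expChar]
      push_cast
      ring_nf
    rw [h2, mul_add, ← expChar_add, ← expChar_add, show x / 2 + x / 2 = x by ring,
      show x / 2 + -x / 2 = ((0 : ℤ) : ℝ) by push_cast; ring, expChar_int, add_comm]
  rw [this, norm_mul, norm_expChar, Complex.norm_real, Real.norm_eq_abs, abs_mul]
  simp

theorem norm_peak (k : ℕ) (x : ℝ) : ‖peak k x‖ = (|Real.cos (Real.pi * x)| ^ 2) ^ k := by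
  rw [peak, norm_div, norm_pow, norm_one_add_expChar, norm_pow, mul_pow, pow_mul, pow_mul]
  norm_num

theorem norm_peak_le_one (k : ℕ) (x : ℝ) : ‖peak k x‖ ≤ 1 := by
  rw [norm_peak]
  exact pow_le_one₀ (by positivity) (pow_le_one₀ (abs_nonneg _) (Real.abs_cos_le_one _))

theorem norm_peak_add_int (k : ℕ) (x : ℝ) (z : ℤ) : peak k (x + z) = peak k x := by
  rw [peak, peak, expChar_add, expChar_int, mul_one]

theorem abs_cos_le {δ u : ℝ} (hδ : 0 < δ) (h1 : δ ≤ |u|) (h2 : |u| ≤ 1 - δ) :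
    |Real.cos (Real.pi * u)| ≤ Real.cos (Real.pi * δ) := by
  have hp := Real.pi_pos
  have e : Real.cos (Real.pi * u) = Real.cos (Real.pi * |u|) := by
    rw [← Real.cos_abs, abs_mul, abs_of_pos hp]
  rw [e, abs_le]
  constructor
  · rw [← Real.cos_pi_sub]
    exact Real.cos_le_cos_of_nonneg_of_le_pi (by positivity) (by nlinarith) (by nlinarith)
  · exact Real.cos_le_cos_of_nonneg_of_le_pi (by positivity) (by nlinarith) (by nlinarith)

theorem peak_mul_eq (k : ℕ) (x y : ℝ) :
    expChar (-(k * x)) * peak k x * (expChar (-(k * y)) * peak k y) =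
      ∑ i ∈ Finset.range (2 * k + 1), ∑ j ∈ Finset.range (2 * k + 1),
        ((2 * k).choose i * (2 * k).choose j / 16 ^ k : ℂ) *
          expChar (((i : ℤ) - k : ℤ) * x + ((j : ℤ) - k : ℤ) * y) := by
  have h : ∀ x : ℝ, expChar (-(k * x)) * peak k x = ∑ i ∈ Finset.range (2 * k + 1),
      ((2 * k).choose i / 4 ^ k : ℂ) * expChar (((i : ℤ) - k : ℤ) * x) := by
    intro x
    rw [peak, add_comm, add_pow, Finset.sum_div, Finset.mul_sum]
    refine Finset.sum_congr rfl fun i _ => ?_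
    have : expChar (((i : ℤ) - k : ℤ) * x) = expChar (-(k * x)) * expChar x ^ i := by
      rw [← expChar_nat_mul, ← expChar_add]; push_cast; ring_nf
    rw [this]; ring
  rw [h x, h y, Finset.sum_mul_sum]
  refine Finset.sum_congr rfl fun i _ => Finset.sum_congr rfl fun j _ => ?_
  rw [expChar_add, show (16 : ℂ) = 4 * 4 by norm_num, mul_pow]
  field_simp

/-- Kronecker's theorem in dimension two. -/
theorem exists_fract_mem_Ioo {α β : ℝ}
    (hind : ∀ i j k : ℤ, (i : ℝ) * α + j * β = k → i = 0 ∧ j = 0)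
    {l r l' r' : ℝ} (hl : 0 ≤ l) (hlr : l < r) (hr : r ≤ 1) (hl' : 0 ≤ l') (hlr' : l' < r')
    (hr' : r' ≤ 1) :
    ∃ n : ℕ, Int.fract (α * n) ∈ Set.Ioo l r ∧ Int.fract (β * n) ∈ Set.Ioo l' r' := by
  by_contra! hcon
  set x₀ := (l + r) / 2 with hx₀
  set y₀ := (l' + r') / 2 with hy₀
  set δ := min ((r - l) / 2) ((r' - l') / 2) with hδ
  have hδ0 : 0 < δ := lt_min (by linarith) (by linarith)
  have hδ1 : δ ≤ (r - l) / 2 := min_le_left _ _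
  have hδ2 : δ ≤ (r' - l') / 2 := min_le_right _ _
  set ρ := Real.cos (Real.pi * δ) ^ 2 with hρ
  have far : ∀ (k : ℕ) (a b t : ℝ), 0 ≤ a → b ≤ 1 → δ ≤ (b - a) / 2 → Int.fract t ∉ Set.Ioo a b →
      ‖peak k (t - (a + b) / 2)‖ ≤ ρ ^ k := by
    intro k a b t ha hb hab ht
    have hf0 := Int.fract_nonneg t
    have hf1 := Int.fract_lt_one t
    have : t - (a + b) / 2 = (Int.fract t - (a + b) / 2) + (⌊t⌋ : ℤ) := by
      rw [Int.fract]; ring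
    rw [this, norm_peak_add_int, norm_peak]
    refine pow_le_pow_left₀ (by positivity) (pow_le_pow_left₀ (abs_nonneg _)
      (abs_cos_le hδ0 ?_ ?_) 2) k
    · rw [Set.mem_Ioo, not_and_or, not_lt, not_lt] at ht
      rw [le_abs]
      rcases ht with ht | ht
      · right; linarith
      · left; linarith
    · rw [abs_le]; constructor <;> linarith
  have key : ∀ k : ℕ, ‖((2 * k).choose k * (2 * k).choose k / 16 ^ k : ℂ)‖ ≤ ρ ^ k := by
    intro k
    have hmean : HasMean (fun n : ℕ =>
        expChar (-(k * (α * n - x₀))) * peak k (α * n - x₀) *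
          (expChar (-(k * (β * n - y₀))) * peak k (β * n - y₀)))
        ((2 * k).choose k * (2 * k).choose k / 16 ^ k : ℂ) := by
      simp only [peak_mul_eq]
      have hval : ((2 * k).choose k * (2 * k).choose k / 16 ^ k : ℂ) =
          ∑ i ∈ Finset.range (2 * k + 1), ∑ j ∈ Finset.range (2 * k + 1),
            if i = k ∧ j = k then ((2 * k).choose i * (2 * k).choose j / 16 ^ k : ℂ) else 0 := by
        rw [Finset.sum_eq_single k, Finset.sum_eq_single k]
        · simp
        · intro j _ hj; simp [hj]
        · intro hk; exact absurd (Finset.mem_range.2 (by omega)) hk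
        · intro i _ hi; simp [hi]
        · intro hk; exact absurd (Finset.mem_range.2 (by omega)) hk
      rw [hval]
      refine HasMean.sum _ fun i _ => HasMean.sum _ fun j _ => ?_
      set a : ℤ := (i : ℤ) - k
      set b : ℤ := (j : ℤ) - k
      have hsplit : ∀ n : ℕ, expChar (a * (α * n - x₀) + b * (β * n - y₀)) =
          expChar (-(a * x₀ + b * y₀)) * expChar (a * α + b * β) ^ n := by
        intro n
        rw [← expChar_nat_mul, ← expChar_add]; ring_nf
      simp only [hsplit, ← mul_assoc]
      by_cases hij : i = k ∧ j = k
      · have ha : a = 0 := by simp [a, hij.1]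
        have hb : b = 0 := by simp [b, hij.2]
        have e0 : expChar 0 = 1 := by simpa using expChar_int 0
        simpa [ha, hb, e0, hij] using hasMean_one.const_mul _
      · rw [if_neg hij]
        have := (hasMean_pow (norm_expChar (a * α + b * β)) (expChar_ne_one fun z hz => hij ?_))
        · simpa using this.const_mul (((2 * k).choose i * (2 * k).choose j / 16 ^ k : ℂ) *
            expChar (-(a * x₀ + b * y₀)))
        · obtain ⟨h1, h2⟩ := hind a b z hz
          omega
    refine hmean.norm_le fun n => ?_
    rw [norm_mul, norm_mul, norm_mul, norm_expChar, norm_expChar, one_mul, one_mul]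
    by_cases hn : Int.fract (α * n) ∈ Set.Ioo l r
    · calc _ ≤ 1 * ρ ^ k := mul_le_mul (norm_peak_le_one _ _)
            (far k l' r' _ hl' hr' hδ2 (hcon n hn)) (norm_nonneg _) zero_le_one
        _ = _ := one_mul _
    · calc _ ≤ ρ ^ k * 1 := mul_le_mul (far k l r _ hl hr hδ1 hn) (norm_peak_le_one _ _)
            (norm_nonneg _) (by positivity)
        _ = _ := mul_one _
  have hρ1 : ρ < 1 := by
    have h1 : Real.cos (Real.pi * δ) < 1 := by
      rw [← Real.cos_zero]
      exact Real.cos_lt_cos_of_nonneg_of_le_pi le_rfl (by nlinarith [Real.pi_pos])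
        (by positivity)
    have h0 : 0 ≤ Real.cos (Real.pi * δ) := by
      refine Real.cos_nonneg_of_neg_pi_div_two_le_of_le ?_ ?_ <;> nlinarith [Real.pi_pos]
    rw [hρ, sq]; nlinarith
  have hlim : Tendsto (fun k : ℕ => (k : ℝ) ^ 2 * ρ ^ k) atTop (𝓝 0) :=
    tendsto_pow_const_mul_const_pow_of_lt_one 2 (by positivity) hρ1
  obtain ⟨k, hk1, hk2⟩ := ((hlim.eventually (gt_mem_nhds (show (0 : ℝ) < 1 / 4 by norm_num))).and
    (eventually_gt_atTop 0)).exists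
  have h4 : (4 : ℝ) ^ k ≤ 2 * k * (2 * k).choose k := by
    have := Nat.four_pow_le_two_mul_self_mul_centralBinom k hk2
    rw [Nat.centralBinom] at this
    exact_mod_cast this
  have hkey := key k
  rw [norm_div, norm_mul, Complex.norm_natCast, norm_pow,
    show ‖(16 : ℂ)‖ = 4 * 4 by norm_num, mul_pow, div_le_iff₀ (by positivity)] at hkey
  set c : ℝ := (((2 * k).choose k : ℕ) : ℝ)
  set q : ℝ := 4 ^ k
  have hc : 0 ≤ c := by positivity
  have hq : 0 < q := by positivity
  have h5 : q * q ≤ (2 * k * c) * (2 * k * c) := mul_le_mul h4 h4 hq.le (by positivity)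
  have h6 : (2 * k * c) * (2 * k * c) ≤ 4 * ((k : ℝ) ^ 2 * ρ ^ k) * (q * q) := by
    nlinarith [mul_le_mul_of_nonneg_left hkey (show (0:ℝ) ≤ 4 * (k:ℝ)^2 by positivity)]
  nlinarith [mul_pos hq hq]

end Equidistribution

section SequenceCoding

/-- `z` can be reached from `s` by `n` steps of the relation `Step`. -/
def Iter (Step : ℕ → ℕ → ℕ → Prop) (s : ℕ) : ℕ → ℕ → Prop
  | 0, z => z = s
  | n + 1, z => ∃ y, Iter Step s n y ∧ Step n y z

theorem Iter.exists_seq {Step : ℕ → ℕ → ℕ → Prop} {s n z : ℕ} (h : Iter Step s n z) :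
    ∃ v : ℕ → ℕ, v 0 = s ∧ v n = z ∧ ∀ i < n, Step i (v i) (v (i + 1)) := by
  induction n generalizing z with
  | zero => exact ⟨fun _ => s, rfl, Eq.symm h, by simp⟩
  | succ n ih =>
    obtain ⟨y, hy, hs⟩ := h
    obtain ⟨v, h0, hn, hv⟩ := ih hy
    refine ⟨fun i => if i ≤ n then v i else z, by simp [h0], by simp, fun i hi => ?_⟩
    rcases Nat.lt_succ_iff_lt_or_eq.1 hi with hi | rfl
    · simpa [hi.le, Nat.succ_le_of_lt hi] using hv i hi
    · simpa [hn] using hs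

/-- `t` is a positive record for the approximation of `p` from below by the sequence `x`. -/
def IsRecord (x : ℕ → ℝ) (p : ℝ) (t : ℕ) : Prop :=
  0 < t ∧ x t ≤ p ∧ ∀ m < t, ¬ (x t ≤ x m ∧ x m ≤ p)

/-- `v ≤ d` is the index of the best approximation from below among `y 0, …, y d` of `y n`, where
`n` is the index of the best approximation of `c` from below among `x 0, …, x t`. -/
def IsValue (x y : ℕ → ℝ) (c : ℝ) (d t v : ℕ) : Prop :=
  v ≤ d ∧ ∃ n, n ≤ t ∧ x n ≤ c ∧ (∀ m ≤ t, x m ≤ c → x m ≤ x n) ∧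
    y v ≤ y n ∧ ∀ m ≤ d, y m ≤ y n → y m ≤ y v

theorem IsValue.unique {x y : ℕ → ℝ} (hx : x.Injective) (hy : y.Injective) {c : ℝ}
    {d t v v' : ℕ} (h : IsValue x y c d t v) (h' : IsValue x y c d t v') : v = v' := by
  obtain ⟨hv, n, hn, hc, hmax, hyn, hymax⟩ := h
  obtain ⟨hv', n', hn', hc', hmax', hyn', hymax'⟩ := h'
  have : n = n' := hx (le_antisymm (hmax' n hn hc) (hmax n' hn' hc'))
  subst this
  exact hy (le_antisymm (hymax' v hv hyn) (hymax v' hv' hyn'))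

theorem exists_gap (x : ℕ → ℝ) {a b : ℝ} (hab : a < b) (S : ℕ) :
    ∃ q, a < q ∧ q ≤ b ∧ ∀ m ≤ S, ¬ (a < x m ∧ x m < q) := by
  induction S with
  | zero =>
    by_cases h : a < x 0
    · exact ⟨min b (x 0), lt_min hab h, min_le_left _ _, by simp⟩
    · exact ⟨b, hab, le_rfl, by simp [h]⟩
  | succ S ih =>
    obtain ⟨q, haq, hqb, hq⟩ := ih
    by_cases h : a < x (S + 1)
    · refine ⟨min q (x (S + 1)), lt_min haq h, (min_le_left _ _).trans hqb, fun m hm => ?_⟩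
      rcases Nat.le_succ_iff.1 hm with hm | rfl
      · exact fun h => hq m hm ⟨h.1, h.2.trans_le (min_le_left _ _)⟩
      · exact fun h => absurd (h.2.trans_le (min_le_right _ _)) (lt_irrefl _)
    · refine ⟨q, haq, hqb, fun m hm => ?_⟩
      rcases Nat.le_succ_iff.1 hm with hm | rfl
      · exact hq m hm
      · exact fun h' => h h'.1

/-- Two sequences in `[0, 1)` which are injective and jointly dense. -/
structure JointlyDense (x y : ℕ → ℝ) : Prop where
  zero : x 0 = 0
  injx : x.Injective
  injy : y.Injective
  nnx : ∀ n, 0 ≤ x n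
  ltx : ∀ n, x n < 1
  nny : ∀ n, 0 ≤ y n
  lty : ∀ n, y n < 1
  dense : ∀ {l r l' r' : ℝ}, 0 ≤ l → l < r → r ≤ 1 → 0 ≤ l' → l' < r' → r' ≤ 1 →
    ∃ n, x n ∈ Set.Ioo l r ∧ y n ∈ Set.Ioo l' r'

section
variable {x y : ℕ → ℝ}

theorem JointlyDense.exists_isValue (H : JointlyDense x y) {c₀ c₁ : ℝ} (h0 : 0 ≤ c₀) (h : c₀ < c₁) (h1 : c₁ ≤ 1)
    {w d : ℕ} (hw : w ≤ d) :
    ∃ n, ∀ t ≥ n, ∃ c₀' c₁', c₀ ≤ c₀' ∧ c₀' < c₁' ∧ c₁' ≤ c₁ ∧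
      ∀ c, c₀' < c → c < c₁' → IsValue x y c d t w := by
  obtain ⟨r, hr, hr1, hgap⟩ := exists_gap y (H.lty w) d
  obtain ⟨n, hn, hn'⟩ := H.dense h0 h h1 (H.nny w) hr hr1
  refine ⟨n, fun t ht => ?_⟩
  obtain ⟨q, hq, hq1, hgapx⟩ := exists_gap x hn.2 t
  refine ⟨x n, q, hn.1.le, hq, hq1, fun c hc hc' => ⟨hw, n, ht, hc.le, fun m hm hmc => ?_,
    hn'.1.le, fun m hm hmn => ?_⟩⟩
  · by_contra hlt
    exact hgapx m hm ⟨not_le.1 hlt, hmc.trans_lt hc'⟩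
  · by_contra hlt
    exact hgap m hm ⟨not_le.1 hlt, hmn.trans_lt hn'.2⟩

theorem JointlyDense.exists_code (H : JointlyDense x y) (v : ℕ → ℕ) (d N : ℕ) (hN : N ≤ d) (hd : ∀ i ≤ N, v i ≤ d)
    (k : ℕ) (hk : k ≤ N + 1) :
    ∃ (M : ℕ) (p₁ c₀ c₁ b₀ b₁ : ℝ), x M < p₁ ∧ p₁ ≤ 1 ∧ 0 ≤ c₀ ∧ c₀ < c₁ ∧ c₁ ≤ 1 ∧
      0 ≤ b₀ ∧ b₀ < b₁ ∧ b₁ ≤ 1 ∧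
      ∀ p c b, x M < p → p < p₁ → c₀ < c → c < c₁ → b₀ < b → b < b₁ →
        (∀ j, k = j + 1 → IsRecord x p M ∧ IsValue x y c d M j ∧ IsValue x y b d M (v j)) ∧
        ∀ t, t ≤ M → IsRecord x p t → ∃ i < k,
          IsValue x y c d t i ∧ IsValue x y b d t (v i) ∧
          ∀ j, i = j + 1 → ∃ t' < t, IsRecord x p t' ∧
            IsValue x y c d t' j ∧ IsValue x y b d t' (v j) := by
  induction k with
  | zero =>
    refine ⟨0, 1, 0, 1, 0, 1, by rw [H.zero]; simp, le_rfl, le_rfl, by simp, le_rfl, le_rfl,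
      by simp, le_rfl, fun p c b _ _ _ _ _ _ => ⟨by simp, fun t ht hr => ?_⟩⟩
    exact absurd (Nat.le_zero.1 ht) hr.1.ne'
  | succ k ih =>
    obtain ⟨M, p₁, c₀, c₁, b₀, b₁, hp, hp1, hc0, hc, hc1, hb0, hb, hb1, hall⟩ := ih (by omega)
    obtain ⟨n, hn⟩ := H.exists_isValue hc0 hc hc1 (show k ≤ d by omega)
    obtain ⟨n', hn'⟩ := H.exists_isValue hb0 hb hb1 (hd k (by omega))
    obtain ⟨q, hq, hqp, hgap⟩ := exists_gap x hp (max M (max n n'))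
    have hex : ∃ t, x t ∈ Set.Ioo (x M) q := by
      obtain ⟨t, ht, -⟩ := H.dense (H.nnx M) hq (hqp.trans hp1) le_rfl one_pos le_rfl
      exact ⟨t, ht⟩
    classical
    obtain ⟨t, ht, hmin⟩ : ∃ t, x t ∈ Set.Ioo (x M) q ∧ ∀ m < t, x m ∉ Set.Ioo (x M) q :=
      ⟨Nat.find hex, Nat.find_spec hex, fun m hm => Nat.find_min hex hm⟩
    have htS : max M (max n n') < t := by
      by_contra hle
      exact hgap t (not_lt.1 hle) ht
    have hMt : M < t := (le_max_left _ _).trans_lt htS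
    obtain ⟨e₀, e₁, he0, he, he1, hval⟩ := hn t (by omega)
    obtain ⟨f₀, f₁, hf0, hf, hf1, hval'⟩ := hn' t (by omega)
    refine ⟨t, q, e₀, e₁, f₀, f₁, ht.2, hqp.trans hp1, hc0.trans he0, he, he1.trans hc1,
      hb0.trans hf0, hf, hf1.trans hb1, fun p c b h1 h2 h3 h4 h5 h6 => ?_⟩
    obtain ⟨hA, hB⟩ := hall p c b (ht.1.trans h1) (h2.trans_le hqp) (he0.trans_lt h3)
      (h4.trans_le he1) (hf0.trans_lt h5) (h6.trans_le hf1)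
    have hrec : IsRecord x p t := ⟨by omega, h1.le, fun m hm h =>
      hmin m hm ⟨ht.1.trans_le h.1, h.2.trans_lt h2⟩⟩
    refine ⟨?_, fun t' ht' hr => ?_⟩
    · rintro j hj
      obtain rfl : k = j := by omega
      exact ⟨hrec, hval c h3 h4, hval' b h5 h6⟩
    · rcases le_or_gt t' M with hle | hlt
      · obtain ⟨i, hi, h⟩ := hB t' hle hr
        exact ⟨i, by omega, h⟩
      · rcases ht'.lt_or_eq with hlt' | rfl
        · exfalso
          by_cases hx : x M < x t'
          · exact hmin t' hlt' ⟨hx, hr.2.1.trans_lt h2⟩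
          · exact hr.2.2 M hlt ⟨not_lt.1 hx, (ht.1.trans h1).le⟩
        · refine ⟨k, by omega, hval c h3 h4, hval' b h5 h6, fun j hj => ⟨M, hMt, hA j hj⟩⟩

theorem JointlyDense.iter_iff (H : JointlyDense x y) (Step : ℕ → ℕ → ℕ → Prop) (s N z : ℕ) :
    Iter Step s N z ↔ ∃ (p c b : ℝ) (M d : ℕ),
      (∀ t ≤ M, IsRecord x p t → ∀ g f, IsValue x y c d t g → IsValue x y b d t f →
        (g = 0 ∧ f = s) ∨ ∃ t' < t, IsRecord x p t' ∧ ∃ g' f', IsValue x y c d t' g' ∧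
          IsValue x y b d t' f' ∧ g = g' + 1 ∧ Step g' f' f) ∧
      ∃ t ≤ M, IsRecord x p t ∧ IsValue x y c d t N ∧ IsValue x y b d t z := by
  constructor
  · intro h
    obtain ⟨v, h0, hn, hv⟩ := h.exists_seq
    obtain ⟨d, hNd, hd⟩ : ∃ d, N ≤ d ∧ ∀ i ≤ N, v i ≤ d := by
      refine ⟨N + ∑ i ∈ Finset.range (N + 1), v i, by omega, fun i hi => ?_⟩
      have := Finset.single_le_sum (f := v) (fun _ _ => Nat.zero_le _)
        (Finset.mem_range.2 (show i < N + 1 by omega))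
      omega
    obtain ⟨M, p₁, c₀, c₁, b₀, b₁, hp, hp1, hc0, hc, hc1, hb0, hb, hb1, hall⟩ :=
      H.exists_code v d N hNd hd (N + 1) le_rfl
    obtain ⟨p, hp, hp'⟩ := exists_between hp
    obtain ⟨c, hc, hc'⟩ := exists_between hc
    obtain ⟨b, hb, hb'⟩ := exists_between hb
    obtain ⟨hA, hB⟩ := hall p c b hp hp' hc hc' hb hb'
    refine ⟨p, c, b, M, d, fun t ht hr g f hg hf => ?_, M, le_rfl, ?_⟩
    · obtain ⟨i, hi, hig, hif, hprev⟩ := hB t ht hr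
      obtain rfl := hg.unique H.injx H.injy hig
      obtain rfl := hf.unique H.injx H.injy hif
      rcases g with _ | j
      · exact Or.inl ⟨rfl, h0⟩
      · obtain ⟨t', ht', hr', h1, h2⟩ := hprev j rfl
        exact Or.inr ⟨t', ht', hr', j, v j, h1, h2, rfl, hv j (by omega)⟩
    · simpa [hn] using hA N rfl
  · rintro ⟨p, c, b, M, d, hA, t, htM, hr, hN, hz⟩
    have key : ∀ t ≤ M, IsRecord x p t → ∀ g f, IsValue x y c d t g → IsValue x y b d t f →
        Iter Step s g f := by
      intro t
      induction t using Nat.strong_induction_on with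
      | _ t ih =>
        intro ht hr g f hg hf
        rcases hA t ht hr g f hg hf with ⟨rfl, rfl⟩ | ⟨t', ht', hr', g', f', hg', hf', rfl, hs⟩
        · rfl
        · exact ⟨f', ih t' ht' (by omega) hr' g' f' hg' hf', hs⟩
    exact key t htM hr N z hN hz

end

end SequenceCoding

section Definability

open FirstOrder Language

attribute [local instance] kStruc

/-- The symbol for the order. -/
def symLt (K : Subfield ℝ) : (kLang K).Relations 2 := (() : Unit)

/-- The symbol for the set of integers. -/
def symInt (K : Subfield ℝ) : (kLang K).Relations 1 := (() : Unit)

/-- The symbol for addition. -/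
def symAdd (K : Subfield ℝ) : (kLang K).Functions 2 := (() : Unit)

/-- The symbol for multiplication by `c`. -/
def symScal {K : Subfield ℝ} (c : K) : (kLang K).Functions 1 := c

theorem funMap_symAdd {K : Subfield ℝ} (v : Fin 2 → ℝ) :
    Structure.funMap (symAdd K) v = v 0 + v 1 := rfl

/-- `P` is definable without parameters. -/
def Dfn (K : Subfield ℝ) {ι : Type} (P : (ι → ℝ) → Prop) : Prop :=
  ∃ φ : (kLang K).Formula ι, ∀ v, φ.Realize v ↔ P v

variable {K : Subfield ℝ} {ι κ : Type} {P Q : (ι → ℝ) → Prop}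

theorem Dfn.not (h : Dfn K P) : Dfn K fun v => ¬ P v :=
  let ⟨φ, hφ⟩ := h
  ⟨φ.not, fun v => by rw [Formula.realize_not, hφ]⟩

theorem Dfn.and (h : Dfn K P) (h' : Dfn K Q) : Dfn K fun v => P v ∧ Q v :=
  let ⟨φ, hφ⟩ := h
  let ⟨ψ, hψ⟩ := h'
  ⟨φ ⊓ ψ, fun v => by rw [Formula.realize_inf, hφ, hψ]⟩

theorem Dfn.imp (h : Dfn K P) (h' : Dfn K Q) : Dfn K fun v => P v → Q v :=
  let ⟨φ, hφ⟩ := h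
  let ⟨ψ, hψ⟩ := h'
  ⟨φ.imp ψ, fun v => by rw [Formula.realize_imp, hφ, hψ]⟩

theorem Dfn.or (h : Dfn K P) (h' : Dfn K Q) : Dfn K fun v => P v ∨ Q v := by
  simpa only [or_iff_not_imp_left] using h.not.imp h'

theorem Dfn.relabel (g : κ → ι) {P : (κ → ℝ) → Prop} (h : Dfn K P) :
    Dfn K fun v : ι → ℝ => P fun i => v (g i) :=
  let ⟨φ, hφ⟩ := h
  ⟨Formula.relabel g φ, fun v => by rw [Formula.realize_relabel, hφ]; rfl⟩

theorem Dfn.congr (h : Dfn K P) (e : ∀ v, Q v ↔ P v) : Dfn K Q :=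
  let ⟨φ, hφ⟩ := h
  ⟨φ, fun v => (hφ v).trans (e v).symm⟩

theorem Dfn.ex {Q : (ι → ℝ) → ℝ → Prop}
    (h : Dfn K fun w : Option ι → ℝ => Q (fun i => w (some i)) (w none)) :
    Dfn K fun v => ∃ x, Q v x := by
  have h' := h.relabel (ι := ι ⊕ Unit) (fun o => o.elim (Sum.inr ()) Sum.inl)
  obtain ⟨φ, hφ⟩ := h'
  refine ⟨φ.iExs Unit, fun v => ?_⟩
  rw [Formula.realize_iExs]
  simp only [hφ]
  exact ⟨fun ⟨i, hi⟩ => ⟨i (), hi⟩, fun ⟨x, hx⟩ => ⟨fun _ => x, hx⟩⟩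

theorem Dfn.all {Q : (ι → ℝ) → ℝ → Prop}
    (h : Dfn K fun w : Option ι → ℝ => Q (fun i => w (some i)) (w none)) :
    Dfn K fun v => ∀ x, Q v x :=
  (Dfn.ex (Q := fun v x => ¬ Q v x) h.not).not.congr fun v => by push Not; rfl

/-- `F` is definable without parameters. -/
def DfnFun (K : Subfield ℝ) (F : (ι → ℝ) → ℝ) : Prop :=
  Dfn K fun w : Option ι → ℝ => w none = F fun i => w (some i)

variable {F G : (ι → ℝ) → ℝ}

theorem Dfn.subst {Q : (ι → ℝ) → ℝ → Prop}
    (h : Dfn K fun w : Option ι → ℝ => Q (fun i => w (some i)) (w none)) (hF : DfnFun K F) :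
    Dfn K fun v => Q v (F v) :=
  (Dfn.ex (Q := fun v x => x = F v ∧ Q v x) (hF.and h)).congr fun v => by simp

theorem DfnFun.relabel (g : κ → ι) {F : (κ → ℝ) → ℝ} (h : DfnFun K F) :
    DfnFun K fun v : ι → ℝ => F fun i => v (g i) :=
  (Dfn.relabel (Option.map g) h :)

theorem DfnFun.up (h : DfnFun K F) : DfnFun K fun v : Option ι → ℝ => F fun i => v (some i) :=
  h.relabel some

theorem Dfn.subst₁ {R : ℝ → Prop} (h : Dfn K fun v : Fin 1 → ℝ => R (v 0)) (hF : DfnFun K F) :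
    Dfn K fun v => R (F v) :=
  Dfn.subst (Q := fun _ x => R x) (h.relabel fun _ => none) hF

theorem Dfn.subst₂ {R : ℝ → ℝ → Prop} (h : Dfn K fun v : Fin 2 → ℝ => R (v 0) (v 1))
    (hF : DfnFun K F) (hG : DfnFun K G) : Dfn K fun v => R (F v) (G v) :=
  Dfn.subst (Q := fun v x => R x (G v)) (Dfn.subst (Q := fun v y => R (v none) y)
    (h.relabel ![some none, none]) hG.up) hF

theorem Dfn.subst₃ {R : ℝ → ℝ → ℝ → Prop} {H : (ι → ℝ) → ℝ}
    (h : Dfn K fun v : Fin 3 → ℝ => R (v 0) (v 1) (v 2))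
    (hF : DfnFun K F) (hG : DfnFun K G) (hH : DfnFun K H) : Dfn K fun v => R (F v) (G v) (H v) :=
  Dfn.subst (Q := fun v x => R x (G v) (H v)) (Dfn.subst (Q := fun v y => R (v none) y (H _))
    (Dfn.subst (Q := fun v z => R (v (some none)) (v none) z)
      (h.relabel ![some (some none), some none, none]) hH.up.up) hG.up) hF

theorem dfn_eq_var (i j : ι) : Dfn K fun v => v i = v j :=
  ⟨Term.equal (Term.var i) (Term.var j), fun v => by simp⟩

theorem DfnFun.var (i : ι) : DfnFun K fun v => v i := dfn_eq_var none (some i)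

theorem Dfn.eq (hF : DfnFun K F) (hG : DfnFun K G) : Dfn K fun v => F v = G v :=
  Dfn.subst₂ (R := (· = ·)) (dfn_eq_var 0 1) hF hG

theorem Dfn.lt (hF : DfnFun K F) (hG : DfnFun K G) : Dfn K fun v => F v < G v :=
  Dfn.subst₂ (R := (· < ·)) ⟨(symLt K).formula₂ (Term.var 0) (Term.var 1), fun v => by
      rw [Formula.realize_rel₂]; rfl⟩ hF hG

theorem Dfn.le (hF : DfnFun K F) (hG : DfnFun K G) : Dfn K fun v => F v ≤ G v := by
  simpa only [not_lt] using (Dfn.lt hG hF).not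

theorem Dfn.isInt (hF : DfnFun K F) : Dfn K fun v => ∃ z : ℤ, F v = z :=
  Dfn.subst₁ (R := fun x => ∃ z : ℤ, x = z) ⟨(symInt K).formula₁ (Term.var 0), fun v => by rw [Formula.realize_rel₁]; rfl⟩ hF

theorem DfnFun.add (hF : DfnFun K F) (hG : DfnFun K G) : DfnFun K fun v => F v + G v :=
  Dfn.subst₃ (R := fun x y z => x = y + z) ⟨Term.equal (Term.var 0)
    ((symAdd K).apply₂ (Term.var 1) (Term.var 2)), fun v => by
      rw [Formula.realize_equal, Term.realize_functions_apply₂]; rfl⟩ (.var none) hF.up hG.up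

theorem DfnFun.smul (c : K) (hF : DfnFun K F) : DfnFun K fun v => c * F v :=
  Dfn.subst₂ (R := fun x y => x = c * y) ⟨Term.equal (Term.var 0)
    ((symScal c).apply₁ (Term.var 1)), fun v => by
      rw [Formula.realize_equal, Term.realize_functions_apply₁]; rfl⟩ (.var none) hF.up

theorem DfnFun.zero : DfnFun K fun _ : ι → ℝ => 0 :=
  Dfn.congr (Dfn.eq (DfnFun.add (.var none) (.var none)) (.var none)) fun v => by
    constructor
    · intro h; simp [h]
    · intro h; linarith

theorem DfnFun.one : DfnFun K fun _ : ι → ℝ => 1 := by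
  have h1 : ∀ {ι : Type} (i : ι), Dfn K fun v : ι → ℝ => (∃ z : ℤ, v i = z) ∧ 0 < v i :=
    fun i => (Dfn.isInt (.var i)).and (Dfn.lt .zero (.var i))
  refine Dfn.congr ((h1 none).and (Dfn.all
    (Q := fun v y => ((∃ z : ℤ, y = z) ∧ 0 < y) → v none ≤ y)
    ((h1 none).imp (Dfn.le (.var _) (.var _))))) fun v => ?_
  constructor
  · rintro h
    rw [h]
    refine ⟨⟨⟨1, by simp⟩, one_pos⟩, ?_⟩
    rintro _ ⟨⟨z, rfl⟩, hz⟩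
    have : 0 < z := by exact_mod_cast hz
    show (1 : ℝ) ≤ z
    exact_mod_cast (show 1 ≤ z by omega)
  · rintro ⟨⟨⟨z, hz⟩, h0⟩, h⟩
    refine le_antisymm (h 1 ⟨⟨1, by simp⟩, one_pos⟩) ?_
    rw [hz] at h0 ⊢
    have : 0 < z := by exact_mod_cast h0
    show (1 : ℝ) ≤ z
    exact_mod_cast (show 1 ≤ z by omega)

theorem DfnFun.fract (hF : DfnFun K F) : DfnFun K fun v => Int.fract (F v) := by
  refine Dfn.congr (((Dfn.le .zero (.var none)).and (Dfn.lt (.var none) .one)).and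
    (Dfn.ex (Q := fun w k => (∃ z : ℤ, k = z) ∧ F (fun i => w (some i)) = w none + k)
    ((Dfn.isInt (.var none)).and (Dfn.eq hF.up.up (.add (.var _) (.var _)))))) fun v => ?_
  rw [eq_comm, Int.fract_eq_iff, and_assoc]
  refine and_congr_right fun _ => and_congr_right fun _ => ⟨fun ⟨z, hz⟩ => ⟨z, ⟨z, rfl⟩, ?_⟩,
    fun ⟨_, ⟨z, rfl⟩, hz⟩ => ⟨z, ?_⟩⟩ <;> linarith

/-- `G` is definable without parameters. -/
def DfnNat (K : Subfield ℝ) (G : (ι → ℝ) → ℕ) : Prop := DfnFun K fun v => (G v : ℝ)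

theorem DfnNat.floor (hF : DfnFun K F) : DfnNat K fun v => ⌊F v⌋₊ := by
  refine Dfn.congr ((Dfn.isInt (.var none)).and (((Dfn.le .zero (.var none)).and
    ((Dfn.le (.var none) hF.up).and (Dfn.lt hF.up (.add (.var none) .one)))).or
      ((Dfn.lt hF.up .zero).and (Dfn.eq (.var none) .zero)))) fun v => ?_
  show v none = (⌊F fun i => v (some i)⌋₊ : ℝ) ↔ _
  generalize F (fun i => v (some i)) = a
  constructor
  · intro h
    refine ⟨⟨⌊a⌋₊, by simp [h]⟩, ?_⟩
    rw [h]
    rcases lt_or_ge a 0 with ha | ha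
    · right; exact ⟨ha, by simp [Nat.floor_of_nonpos ha.le]⟩
    · left; exact ⟨by positivity, Nat.floor_le ha, Nat.lt_floor_add_one a⟩
  · rintro ⟨⟨z, hz⟩, ⟨h0, h1, h2⟩ | ⟨h1, h2⟩⟩
    · rw [hz] at h0 h1 h2 ⊢
      lift z to ℕ using (by exact_mod_cast h0)
      have : ⌊a⌋₊ = z := by
        rw [Nat.floor_eq_iff (le_trans h0 h1)]
        exact ⟨by exact_mod_cast h1, by exact_mod_cast h2⟩
      rw [this]; simp
    · rw [h2, Nat.floor_of_nonpos h1.le]; simp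

variable {A B C : (ι → ℝ) → ℕ}

theorem DfnNat.up (h : DfnNat K A) : DfnNat K fun v : Option ι → ℝ => A fun i => v (some i) :=
  DfnFun.up h

theorem DfnNat.var (i : ι) : DfnNat K fun v : ι → ℝ => ⌊v i⌋₊ := DfnNat.floor (DfnFun.var i)

theorem DfnNat.add (hA : DfnNat K A) (hB : DfnNat K B) : DfnNat K fun v => A v + B v := by
  simpa only [DfnNat, Nat.cast_add] using DfnFun.add hA hB

theorem DfnNat.const (n : ℕ) : DfnNat K fun _ : ι → ℝ => n := by
  induction n with
  | zero => simpa only [DfnNat, Nat.cast_zero] using DfnFun.zero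
  | succ n ih =>
    refine DfnNat.add ih ?_
    simpa only [DfnNat, Nat.cast_one] using DfnFun.one

theorem Dfn.natEq (hA : DfnNat K A) (hB : DfnNat K B) : Dfn K fun v => A v = B v := by
  simpa only [Nat.cast_inj] using Dfn.eq hA hB

theorem Dfn.natLt (hA : DfnNat K A) (hB : DfnNat K B) : Dfn K fun v => A v < B v := by
  simpa only [Nat.cast_lt] using Dfn.lt hA hB

theorem Dfn.natLe (hA : DfnNat K A) (hB : DfnNat K B) : Dfn K fun v => A v ≤ B v := by
  simpa only [Nat.cast_le] using Dfn.le hA hB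

theorem Dfn.exNat {Q : (ι → ℝ) → ℕ → Prop}
    (h : Dfn K fun w : Option ι → ℝ => Q (fun i => w (some i)) ⌊w none⌋₊) :
    Dfn K fun v => ∃ n, Q v n :=
  (Dfn.ex (Q := fun v x => Q v ⌊x⌋₊) h).congr fun v =>
    ⟨fun ⟨n, hn⟩ => ⟨n, by simpa using hn⟩, fun ⟨x, hx⟩ => ⟨_, hx⟩⟩

theorem Dfn.allNat {Q : (ι → ℝ) → ℕ → Prop}
    (h : Dfn K fun w : Option ι → ℝ => Q (fun i => w (some i)) ⌊w none⌋₊) :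
    Dfn K fun v => ∀ n, Q v n :=
  (Dfn.exNat (Q := fun v x => ¬ Q v x) h.not).not.congr fun v => by push Not; rfl

/-- A definable relation on the natural numbers. -/
def DfnRel (K : Subfield ℝ) (R : ℕ → ℕ → Prop) : Prop :=
  Dfn K fun v : Fin 2 → ℝ => R ⌊v 0⌋₊ ⌊v 1⌋₊

theorem DfnRel.app {R : ℕ → ℕ → Prop} (h : DfnRel K R) (hA : DfnNat K A) (hB : DfnNat K B) :
    Dfn K fun v => R (A v) (B v) := by
  simpa using Dfn.subst₂ (R := fun x y => R ⌊x⌋₊ ⌊y⌋₊) h hA hB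

theorem Dfn.isRecord {x : ℕ → ℝ} (hx : ∀ {κ : Type} {A : (κ → ℝ) → ℕ},
      DfnNat K A → DfnFun K fun v => x (A v))
    (hF : DfnFun K F) (hA : DfnNat K A) : Dfn K fun v => IsRecord x (F v) (A v) :=
  (Dfn.natLt (.const 0) hA).and <| (Dfn.le (hx hA) hF).and <|
    Dfn.allNat (Q := fun v m => m < A v → ¬ (x (A v) ≤ x m ∧ x m ≤ F v)) <|
      (Dfn.natLt (.var _) hA.up).imp
        ((Dfn.le (hx hA.up) (hx (.var _))).and (Dfn.le (hx (.var _)) hF.up)).not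

theorem Dfn.isValue {x y : ℕ → ℝ} (hx : ∀ {κ : Type} {A : (κ → ℝ) → ℕ},
      DfnNat K A → DfnFun K fun v => x (A v)) (hy : ∀ {κ : Type} {A : (κ → ℝ) → ℕ},
      DfnNat K A → DfnFun K fun v => y (A v))
    (hF : DfnFun K F) (hA : DfnNat K A) (hB : DfnNat K B) (hC : DfnNat K C) :
    Dfn K fun v => IsValue x y (F v) (A v) (B v) (C v) :=
  (Dfn.natLe hC hA).and <|
    Dfn.exNat (Q := fun v n => n ≤ B v ∧ x n ≤ F v ∧ (∀ m ≤ B v, x m ≤ F v → x m ≤ x n) ∧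
      y (C v) ≤ y n ∧ ∀ m ≤ A v, y m ≤ y n → y m ≤ y (C v)) <|
    (Dfn.natLe (.var _) hB.up).and <| (Dfn.le (hx (.var _)) hF.up).and <|
    (Dfn.allNat (Q := fun v m => m ≤ B (fun i => v (some i)) → x m ≤ F (fun i => v (some i)) →
        x m ≤ x ⌊v none⌋₊) <|
      (Dfn.natLe (.var _) hB.up.up).imp <| (Dfn.le (hx (.var _)) hF.up.up).imp <|
        Dfn.le (hx (.var _)) (hx (.var _))).and <|
    (Dfn.le (hy hC.up) (hy (.var _))).and <|
    Dfn.allNat (Q := fun v m => m ≤ A (fun i => v (some i)) → y m ≤ y ⌊v none⌋₊ →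
        y m ≤ y (C (fun i => v (some i)))) <|
      (Dfn.natLe (.var _) hA.up.up).imp <| (Dfn.le (hy (.var _)) (hy (.var _))).imp <|
        Dfn.le (hy (.var _)) (hy hC.up.up)

/-- The field contains two elements which are rationally independent modulo the integers. -/
def HasIndep (K : Subfield ℝ) : Prop :=
  ∃ a b : K, ∀ i j k : ℤ, (i : ℝ) * a + j * b = k → i = 0 ∧ j = 0

theorem jointlyDense_fract {a b : ℝ} (h : ∀ i j k : ℤ, (i : ℝ) * a + j * b = k → i = 0 ∧ j = 0) :
    JointlyDense (fun n => Int.fract (a * n)) (fun n => Int.fract (b * n)) where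
  zero := by simp
  injx m n hmn := by
    obtain ⟨z, hz⟩ := Int.fract_eq_fract.1 hmn
    have := (h (m - n) 0 z (by push_cast; linarith)).1
    omega
  injy m n hmn := by
    obtain ⟨z, hz⟩ := Int.fract_eq_fract.1 hmn
    have := (h 0 (m - n) z (by push_cast; linarith)).2
    omega
  nnx _ := Int.fract_nonneg _
  nny _ := Int.fract_nonneg _
  ltx _ := Int.fract_lt_one _
  lty _ := Int.fract_lt_one _
  dense := exists_fract_mem_Ioo h

theorem Dfn.iter (hK : HasIndep K) {Step : (ι → ℝ) → ℕ → ℕ → ℕ → Prop}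
    (h : Dfn K fun w : Option (Option (Option ι)) → ℝ => Step (fun i => w (some (some (some i))))
      ⌊w (some (some none))⌋₊ ⌊w (some none)⌋₊ ⌊w none⌋₊)
    (hA : DfnNat K A) (hB : DfnNat K B) (hC : DfnNat K C) :
    Dfn K fun v => Iter (Step v) (A v) (B v) (C v) := by
  obtain ⟨a, b, hab⟩ := hK
  have H := jointlyDense_fract hab
  simp only [H.iter_iff]
  have hx : ∀ (c : K) {κ : Type} {A : (κ → ℝ) → ℕ},
      DfnNat K A → DfnFun K fun v => Int.fract ((c : ℝ) * (A v : ℝ)) :=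
    fun c _ _ hA => .fract (.smul c hA)
  have hr : ∀ {κ : Type} {F : (κ → ℝ) → ℝ} {A : (κ → ℝ) → ℕ}, DfnFun K F → DfnNat K A →
      Dfn K fun v => IsRecord (fun n => Int.fract ((a : ℝ) * (n : ℝ))) (F v) (A v) :=
    fun hF hA => Dfn.isRecord (x := fun n => Int.fract ((a : ℝ) * (n : ℝ))) (hx a) hF hA
  have hv : ∀ {κ : Type} {F : (κ → ℝ) → ℝ} {A B C : (κ → ℝ) → ℕ}, DfnFun K F → DfnNat K A →
      DfnNat K B → DfnNat K C → Dfn K fun v => IsValue (fun n => Int.fract ((a : ℝ) * (n : ℝ)))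
        (fun n => Int.fract ((b : ℝ) * (n : ℝ))) (F v) (A v) (B v) (C v) :=
    fun hF hA => Dfn.isValue (x := fun n => Int.fract ((a : ℝ) * (n : ℝ)))
      (y := fun n => Int.fract ((b : ℝ) * (n : ℝ))) (hx a) (hx b) hF hA
  refine Dfn.ex (Dfn.ex (Dfn.ex (Dfn.exNat (Dfn.exNat (Dfn.and ?_ ?_)))))
  · refine Dfn.allNat (Dfn.imp (.natLe (.var _) (.var _)) (Dfn.imp (hr (.var _) (.var _))
      (Dfn.allNat (Dfn.allNat (Dfn.imp (hv (.var _) (.var _) (.var _) (.var _))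
        (Dfn.imp (hv (.var _) (.var _) (.var _) (.var _)) (Dfn.or (Dfn.and (.natEq (.var _) (.const 0))
        (.natEq (.var _) hA.up.up.up.up.up.up.up.up)) (Dfn.exNat (Dfn.and (.natLt (.var _) (.var _))
        (Dfn.and (hr (.var _) (.var _)) (Dfn.exNat (Dfn.exNat (Dfn.and
        (hv (.var _) (.var _) (.var _) (.var _)) (Dfn.and (hv (.var _) (.var _) (.var _) (.var _))
        (Dfn.and (.natEq (.var _) (.add (.var _) (.const 1))) ?_)))))))))))))))
    exact h.relabel fun o => match o with
      | none => some (some (some none))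
      | some none => none
      | some (some none) => some none
      | some (some (some i)) =>
        some (some (some (some (some (some (some (some (some (some (some i))))))))))
  · exact Dfn.exNat (Dfn.and (.natLe (.var _) (.var _)) (Dfn.and (hr (.var _) (.var _)) (Dfn.and
      (hv (.var _) (.var _) (.var _) hB.up.up.up.up.up.up)
      (hv (.var _) (.var _) (.var _) hC.up.up.up.up.up.up))))

end Definability

section DefinableArithmetic

open FirstOrder Language

attribute [local instance] kStruc

variable {K : Subfield ℝ} {ι : Type} {A B C : (ι → ℝ) → ℕ}

theorem iter_eq_iff (s : ℕ) (g : ℕ → ℕ → ℕ) (n z : ℕ) :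
    Iter (fun i f f' => f' = g i f) s n z ↔ z = Nat.rec s g n := by
  induction n generalizing z with
  | zero => rfl
  | succ n ih => simp [Iter, ih]

theorem DfnNat.mul (hK : HasIndep K) (hA : DfnNat K A) (hB : DfnNat K B) :
    DfnNat K fun v => A v * B v := by
  have h : Dfn K fun w : Option ι → ℝ => (∃ z : ℤ, w none = z) ∧ 0 ≤ w none ∧
      Iter (fun _ f f' => f' = f + A (fun i => w (some i))) 0 (B fun i => w (some i))
        ⌊w none⌋₊ :=
    .and (.isInt (.var _)) <| .and (.le .zero (.var _)) <|
      .iter hK (.natEq (.var _) (.add (.var _) hA.up.up.up.up)) (.const 0) hB.up (.var _)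
  refine h.congr fun w => ?_
  have hmul : ∀ a b : ℕ, (Nat.rec 0 (fun _ f => f + a) b : ℕ) = a * b := by
    intro a b
    induction b with
    | zero => rfl
    | succ b ih => simp only [ih]; rfl
  rw [iter_eq_iff, hmul]
  show w none = (((A fun i => w (some i)) * (B fun i => w (some i)) : ℕ) : ℝ) ↔ _
  generalize (A fun i => w (some i)) * (B fun i => w (some i)) = p
  constructor
  · intro h
    rw [h]
    exact ⟨⟨p, by simp⟩, by positivity, by simp⟩
  · rintro ⟨⟨z, hz⟩, h0, h⟩
    rw [hz] at h0 h ⊢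
    lift z to ℕ using (by exact_mod_cast h0)
    rw [← h]; simp

theorem DfnNat.pair (hK : HasIndep K) (hA : DfnNat K A) (hB : DfnNat K B) :
    DfnNat K fun v => Nat.pair (A v) (B v) := by
  refine ((((Dfn.natLt hA.up hB.up)).and (Dfn.eq (.var none)
    (((hB.mul hK hB).add hA).up))).or ((Dfn.natLt hA.up hB.up).not.and (Dfn.eq (.var none)
    ((((hA.mul hK hA).add hA).add hB).up)))).congr fun w => ?_
  dsimp only [Nat.pair]
  split_ifs with h <;> simp [h]

set_option maxHeartbeats 2000000 in
theorem dfnRel_of_partrec (hK : HasIndep K) {f : ℕ →. ℕ} (hf : Nat.Partrec f) :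
    DfnRel K fun m n => n ∈ f m := by
  induction hf with
  | zero => exact (Dfn.natEq (.var 1) (.const 0)).congr fun v => by simp [pure, PFun.pure]
  | succ => exact (Dfn.natEq (.var 1) (.add (.var 0) (.const 1))).congr fun v => by simp
  | left =>
    refine (Dfn.exNat (Q := fun v b => ⌊v 0⌋₊ = Nat.pair ⌊v 1⌋₊ b)
      (.natEq (.var _) (.pair hK (.var _) (.var _)))).congr fun v => ?_
    simp only [PFun.coe_val, Part.mem_some_iff]
    exact ⟨fun h => ⟨_, by rw [h, Nat.pair_unpair]⟩, fun ⟨b, hb⟩ => by rw [hb, Nat.unpair_pair]⟩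
  | right =>
    refine (Dfn.exNat (Q := fun v b => ⌊v 0⌋₊ = Nat.pair b ⌊v 1⌋₊)
      (.natEq (.var _) (.pair hK (.var _) (.var _)))).congr fun v => ?_
    simp only [PFun.coe_val, Part.mem_some_iff]
    exact ⟨fun h => ⟨_, by rw [h, Nat.pair_unpair]⟩, fun ⟨b, hb⟩ => by rw [hb, Nat.unpair_pair]⟩
  | @pair f g _ _ hf hg =>
    have h : Dfn K fun v : Option (Option (Fin 2)) → ℝ => ⌊v (some none)⌋₊ ∈ f ⌊v (some (some 0))⌋₊ ∧
        ⌊v none⌋₊ ∈ g ⌊v (some (some 0))⌋₊ ∧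
        ⌊v (some (some 1))⌋₊ = Nat.pair ⌊v (some none)⌋₊ ⌊v none⌋₊ :=
      .and (hf.app (.var _) (.var _)) (.and (hg.app (.var _) (.var _))
        (.natEq (.var _) (.pair hK (.var _) (.var _))))
    refine (Dfn.exNat (Q := fun v a => ∃ b, a ∈ f ⌊v 0⌋₊ ∧ b ∈ g ⌊v 0⌋₊ ∧ ⌊v 1⌋₊ = Nat.pair a b)
      (.exNat h)).congr fun v => ?_
    simp [Seq.seq, eq_comm]
  | @comp f g _ _ hf hg =>
    refine (Dfn.exNat (Q := fun v a => a ∈ g ⌊v 0⌋₊ ∧ ⌊v 1⌋₊ ∈ f a)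
      (.and (hg.app (.var _) (.var _)) (hf.app (.var _) (.var _)))).congr fun v => ?_
    exact Part.mem_bind_iff
  | @prec f g _ _ hf hg =>
    refine (Dfn.exNat (Q := fun v a => ∃ k s, ⌊v 0⌋₊ = Nat.pair a k ∧ s ∈ f a ∧
      Iter (fun y i i' => i' ∈ g (Nat.pair a (Nat.pair y i))) s k ⌊v 1⌋₊)
      (.exNat (.exNat (.and (.natEq (.var _) (.pair hK (.var _) (.var _)))
        (.and (hf.app (.var _) (.var _)) (.iter hK
        (hg.app (.pair hK (.var _) (.pair hK (.var _) (.var _))) (.var _))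
        (.var _) (.var _) (.var _))))))).congr fun v => ?_
    have key : ∀ a k z : ℕ, z ∈ (Nat.rec (f a) (fun y IH => do
        let i ← IH
        g (Nat.pair a (Nat.pair y i))) k : Part ℕ) ↔
        ∃ s, s ∈ f a ∧ Iter (fun y i i' => i' ∈ g (Nat.pair a (Nat.pair y i))) s k z := by
      intro a k
      induction k with
      | zero => simp [Iter]
      | succ k ih =>
        intro z
        refine Part.mem_bind_iff.trans ?_
        simp only [ih, Iter]
        constructor
        · rintro ⟨y, ⟨s, hs, h⟩, hy⟩; exact ⟨s, hs, y, h, hy⟩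
        · rintro ⟨s, hs, y, h, hy⟩; exact ⟨y, ⟨s, hs, h⟩, hy⟩
    refine (key _ _ _).trans ?_
    constructor
    · rintro ⟨s, hs⟩
      exact ⟨_, _, s, by rw [Nat.pair_unpair], hs⟩
    · rintro ⟨a, k, s, h, hs⟩
      rw [h, Nat.unpair_pair]
      exact ⟨s, hs⟩
  | @rfind f _ hf =>
    refine Dfn.congr (Dfn.and (hf.app (.pair hK (.var 0) (.var 1)) (.const 0))
      (Dfn.allNat (Q := fun v m => m < ⌊v 1⌋₊ → ∃ k, k ≠ 0 ∧ k ∈ f (Nat.pair ⌊v 0⌋₊ m))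
      (.imp (.natLt (.var _) (.var _)) (.exNat (.and (.not (.natEq (.var _) (.const 0)))
        (hf.app (.pair hK (.var _) (.var _)) (.var _))))))) fun v => ?_
    refine Nat.mem_rfind.trans ?_
    simp only [Part.map_eq_map, Part.mem_map_iff, decide_eq_true_eq, decide_eq_false_iff_not]
    refine and_congr ⟨?_, fun h => ⟨0, h, rfl⟩⟩ (forall_congr' fun m => forall_congr' fun _ =>
      exists_congr fun k => and_comm)
    rintro ⟨_, h, rfl⟩
    exact h

/-- The code of a program, offset by one, halts on input zero. -/
def HaltsPred (x : ℕ) : Prop :=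
  ∃ m, x = m + 1 ∧ ((Denumerable.ofNat Nat.Partrec.Code m).eval 0).Dom

theorem dfn_haltsPred (hK : HasIndep K) :
    Dfn K fun v : Fin 1 → ℝ => HaltsPred ⌊v 0⌋₊ := by
  have h : Nat.Partrec fun m => (Denumerable.ofNat Nat.Partrec.Code m).eval 0 :=
    Partrec.nat_iff.1 (Nat.Partrec.Code.eval_part.comp (Computable.ofNat _) (Computable.const 0))
  refine (Dfn.exNat (Q := fun v m => ∃ z, ⌊v 0⌋₊ = m + 1 ∧
    z ∈ (Denumerable.ofNat Nat.Partrec.Code m).eval 0) (.exNat (.and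
      (.natEq (.var _) (.add (.var _) (.const 1)))
      ((dfnRel_of_partrec hK h).app (.var _) (.var _))))).congr fun v => ?_
  simp [HaltsPred, Part.dom_iff_mem]

end DefinableArithmetic

section Undecidability

open FirstOrder Language

attribute [local instance] kStruc

variable {K : Subfield ℝ}

/-- The term `(n + 1) u`, where `u` is the first bound variable. -/
def multTerm (K : Subfield ℝ) : ℕ → (kLang K).Term (Empty ⊕ Fin 2)
  | 0 => Term.var (Sum.inr 0)
  | n + 1 => (symAdd K).apply₂ (Term.var (Sum.inr 0)) (multTerm K n)

theorem realize_multTerm (n : ℕ) (v : Empty ⊕ Fin 2 → ℝ) :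
    (multTerm K n).realize v = (n + 1) * v (Sum.inr 0) := by
  induction n with
  | zero => simp [multTerm]
  | succ n ih =>
    rw [multTerm, Term.realize_functions_apply₂, funMap_symAdd]
    simp [ih]; ring

theorem not_theoryDecidable (hK : HasIndep K) : ¬ TheoryDecidable (kLang K) ℝ := by
  rintro ⟨eF, eR, f, hf, hφ⟩
  obtain ⟨χ, hχ⟩ : Dfn K fun v : Fin 2 → ℝ => v 0 = 1 → HaltsPred ⌊v 1⌋₊ :=
    (Dfn.eq (.var _) .one).imp ((dfn_haltsPred hK).relabel fun _ => 1)
  let ψ : (kLang K).BoundedFormula Empty 2 :=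
    BoundedFormula.relabel (n := 2) (Sum.inr : Fin 2 → Empty ⊕ Fin 2) χ
  let φ : ℕ → (kLang K).Sentence := fun n =>
    (((multTerm K n).bdEqual (Term.var (Sum.inr 1))).imp ψ).all.all
  have hreal : ∀ n, (ℝ ⊨ φ n) ↔ ((Denumerable.ofNat Nat.Partrec.Code n).eval 0).Dom := by
    intro n
    have h : (ℝ ⊨ φ n) ↔ ∀ u x : ℝ, (n + 1) * u = x → (u = 1 → HaltsPred ⌊x⌋₊) := by
      rw [Sentence.Realize, Formula.Realize]
      simp only [φ, BoundedFormula.realize_all, BoundedFormula.realize_imp,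
        BoundedFormula.realize_bdEqual]
      refine forall_congr' fun u => forall_congr' fun x => ?_
      rw [realize_multTerm]
      refine imp_congr Iff.rfl ?_
      refine (BoundedFormula.realize_relabel (m := 2) (n := 0)).trans ?_
      refine (iff_of_eq (congrArg _ (Subsingleton.elim _ _))).trans ((hχ _).trans ?_)
      exact Iff.rfl
    rw [h]
    constructor
    · intro h
      obtain ⟨m, hm, hd⟩ := h 1 (n + 1) (by ring) rfl
      have : ⌊(n + 1 : ℝ)⌋₊ = n + 1 := by exact_mod_cast Nat.floor_natCast (n + 1)
      obtain rfl : n = m := by omega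
      exact hd
    · rintro hd u x hx rfl
      refine ⟨n, ?_, hd⟩
      rw [← hx, mul_one]
      exact_mod_cast Nat.floor_natCast (n + 1)
  have hcomp : Computable fun n => sentenceEncode eF eR (φ n) := by
    let _ := eF
    let _ := eR
    have hterm : Primrec fun n => Encodable.encode (multTerm K n) := by
      have h1 : ∀ n, Encodable.encode (multTerm K (n + 1)) =
          Nat.succ (Nat.pair (Encodable.encode
            (Sum.inr ⟨2, symAdd K⟩ : (Empty ⊕ Fin 2) ⊕ Σ i, (kLang K).Functions i))
            (Nat.succ (Nat.pair (Encodable.encode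
            (Sum.inl (Sum.inr 0) : (Empty ⊕ Fin 2) ⊕ Σ i, (kLang K).Functions i))
              (Encodable.encode (multTerm K n))))) := by
        intro n
        have h2 : ∀ t : (kLang K).Term (Empty ⊕ Fin 2),
          Encodable.encode t = Encodable.encode t.listEncode := fun t => rfl
        rw [h2, h2]
        simp [multTerm, Functions.apply₂, Term.listEncode, List.finRange_succ]
      refine ((Primrec.nat_rec₁ (Encodable.encode (multTerm K 0))
        (f := fun _ r => Nat.succ (Nat.pair (Encodable.encode
            (Sum.inr ⟨2, symAdd K⟩ : (Empty ⊕ Fin 2) ⊕ Σ i, (kLang K).Functions i))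
            (Nat.succ (Nat.pair (Encodable.encode
            (Sum.inl (Sum.inr 0) : (Empty ⊕ Fin 2) ⊕ Σ i, (kLang K).Functions i)) r)))) ?_)).of_eq
          fun n => ?_
      · exact Primrec.succ.comp (Primrec₂.natPair.comp (Primrec.const _)
          (Primrec.succ.comp (Primrec₂.natPair.comp (Primrec.const _) Primrec.snd)))
      · induction n with
        | zero => rfl
        | succ n ih => rw [h1, ← ih]
    have hlist : ∀ n, sentenceEncode eF eR (φ n) = Nat.succ (Nat.pair
        (Encodable.encode (Sum.inr (Sum.inr 1) : (Σ k, (kLang K).Term (Empty ⊕ Fin k)) ⊕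
          (Σ n, (kLang K).Relations n) ⊕ ℕ)) (Nat.succ (Nat.pair
        (Encodable.encode (Sum.inr (Sum.inr 1) : (Σ k, (kLang K).Term (Empty ⊕ Fin k)) ⊕
          (Σ n, (kLang K).Relations n) ⊕ ℕ)) (Nat.succ (Nat.pair
        (Encodable.encode (Sum.inr (Sum.inr 0) : (Σ k, (kLang K).Term (Empty ⊕ Fin k)) ⊕
          (Σ n, (kLang K).Relations n) ⊕ ℕ)) (Nat.succ (Nat.pair
            (2 * Nat.pair 2 (Encodable.encode (multTerm K n)))
        (Encodable.encode (Sum.inl ⟨2, Term.var (Sum.inr 1)⟩ :: ψ.listEncode))))))))) := by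
      intro n
      simp only [sentenceEncode, φ, BoundedFormula.listEncode, Term.bdEqual, Encodable.encode_list_cons,
        List.cons_append, List.nil_append]
      rfl
    refine Primrec.to_comp (Primrec.of_eq ?_ fun n => (hlist n).symm)
    exact Primrec.succ.comp (Primrec₂.natPair.comp (Primrec.const _)
      (Primrec.succ.comp (Primrec₂.natPair.comp (Primrec.const _)
      (Primrec.succ.comp (Primrec₂.natPair.comp (Primrec.const _)
      (Primrec.succ.comp (Primrec₂.natPair.comp (Primrec.nat_mul.comp (Primrec.const 2)
        (Primrec₂.natPair.comp (Primrec.const 2) hterm)) (Primrec.const _))))))))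
  refine ComputablePred.halting_problem 0 (ComputablePred.computable_iff.2
    ⟨fun c => f (sentenceEncode eF eR (φ (Encodable.encode c))),
      hf.comp (hcomp.comp Computable.encode), ?_⟩)
  ext c
  rw [hφ, hreal, Denumerable.ofNat_encode]

theorem exists_sqrt_of_not_hasIndep (hK : ¬ HasIndep K) :
    (K : Set ℝ) = Set.range ((↑) : ℚ → ℝ) ∨
        ∃ d : ℚ, 0 < d ∧ (¬ ∃ c : ℚ, c ^ 2 = d) ∧
          (K : Set ℝ) = {x : ℝ | ∃ p q : ℚ, x = (p : ℝ) + (q : ℝ) * Real.sqrt d} := by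
  have hQ : ∀ q : ℚ, (q : ℝ) ∈ K := fun q => SubfieldClass.ratCast_mem K q
  by_cases hrat : ∀ x ∈ K, ∃ q : ℚ, (q : ℝ) = x
  · left
    ext x
    exact ⟨fun h => hrat x h, by rintro ⟨q, rfl⟩; exact hQ q⟩
  push Not at hrat
  obtain ⟨a, ha, hirr⟩ := hrat
  have hlin : ∀ b ∈ K, ∃ p q : ℚ, b = p + q * a := by
    by_contra! hb
    obtain ⟨b, hb, hbq⟩ := hb
    refine hK ⟨⟨a, ha⟩, ⟨b, hb⟩, fun i j k h => ?_⟩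
    have h' : (i : ℝ) * a + j * b = k := h
    have hj : j = 0 := by
      by_contra hj
      have hj' : (j : ℝ) ≠ 0 := by exact_mod_cast hj
      refine hbq (k / j) (-i / j) ?_
      push_cast
      field_simp
      linarith
    refine ⟨?_, hj⟩
    by_contra hi
    have hi' : (i : ℝ) ≠ 0 := by exact_mod_cast hi
    refine hirr (k / i) ?_
    rw [hj] at h'
    push_cast
    field_simp
    push_cast at h'
    linarith
  obtain ⟨p, q, hpq⟩ := hlin (a * a) (K.mul_mem ha ha)
  right
  have hsq : (a - q / 2) ^ 2 = ((p + q ^ 2 / 4 : ℚ) : ℝ) := by push_cast; linarith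
  have hne : a - q / 2 ≠ 0 := fun h => hirr (q / 2) (by push_cast; linarith)
  have habs : Real.sqrt ((p + q ^ 2 / 4 : ℚ) : ℝ) = |a - q / 2| := by
    rw [← hsq, Real.sqrt_sq_eq_abs]
  refine ⟨p + q ^ 2 / 4, ?_, ?_, ?_⟩
  · have : (0 : ℝ) < ((p + q ^ 2 / 4 : ℚ) : ℝ) := by rw [← hsq]; positivity
    exact_mod_cast this
  · rintro ⟨c, hc⟩
    have : (a - q / 2) ^ 2 = (c : ℝ) ^ 2 := by rw [hsq, ← hc]; push_cast; rfl
    rcases sq_eq_sq_iff_eq_or_eq_neg.1 this with h | h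
    · exact hirr (c + q / 2) (by push_cast; linarith)
    · exact hirr (-c + q / 2) (by push_cast; linarith)
  · rw [habs]
    ext x
    constructor
    · intro hx
      obtain ⟨r, s, rfl⟩ := hlin x hx
      rcases abs_choice (a - q / 2) with h | h
      · exact ⟨r + s * q / 2, s, by rw [h]; push_cast; ring⟩
      · exact ⟨r + s * q / 2, -s, by rw [h]; push_cast; ring⟩
    · rintro ⟨r, s, rfl⟩
      have h1 : a - q / 2 ∈ K := K.sub_mem ha (by exact_mod_cast hQ (q / 2))
      refine K.add_mem (hQ r) (K.mul_mem (hQ s) ?_)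
      rcases abs_choice (a - q / 2) with h | h <;> rw [h]
      · exact h1
      · exact K.neg_mem h1

end Undecidability

section InfiniteWords

open Filter

/-- Additive Ramsey theorem for colourings of pairs by finitely many colours. -/
theorem exists_monochromatic_seq (c : ℕ → ℕ → ℕ) {N : ℕ} (hc : ∀ i j, i < j → c i j < N) :
    ∃ (g : ℕ → ℕ) (e : ℕ), StrictMono g ∧ ∀ i j, i < j → c (g i) (g j) = e := by
  let U := hyperfilter ℕ
  have hgt : ∀ i : ℕ, ∀ᶠ j in (U : Filter ℕ), i < j := fun i =>
    Nat.hyperfilter_le_atTop (eventually_gt_atTop i)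
  have hd : ∀ i, ∃ d, d < N ∧ ∀ᶠ j in (U : Filter ℕ), c i j = d := by
    intro i
    have := (Ultrafilter.eventually_exists_mem_iff (f := U) (Set.finite_lt_nat N)
      (P := fun d j => c i j = d)).1
      ((hgt i).mono fun j hj => ⟨c i j, hc i j hj, rfl⟩)
    exact this
  choose d hdN hd using hd
  obtain ⟨e, -, he⟩ := (Ultrafilter.eventually_exists_mem_iff (f := U) (Set.finite_lt_nat N)
      (P := fun e i => d i = e)).1 (Eventually.of_forall fun i => ⟨d i, hdN i, rfl⟩)
  obtain ⟨g, hg, hr⟩ := exists_seq_of_forall_finset_exists (fun i => d i = e)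
    (fun i j => i < j ∧ c i j = e) (fun s hs => by
      have h1 : ∀ᶠ j in (U : Filter ℕ), ∀ i ∈ s, i < j ∧ c i j = e := by
        rw [Filter.eventually_all_finset]
        intro i hi
        filter_upwards [hgt i, hd i] with j h1 h2
        exact ⟨h1, h2.trans (hs i hi)⟩
      obtain ⟨j, hj⟩ := (he.and h1).exists
      exact ⟨j, hj.1, hj.2⟩)
  exact ⟨g, e, fun i j hij => (hr i j hij).1, fun i j hij => (hr i j hij).2⟩

/-- The sum of the first `n` values of `f`. -/
def sumR (n : ℕ) (f : ℕ → ℕ) : ℕ := ((List.range n).map f).sum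

theorem sumR_succ (n : ℕ) (f : ℕ → ℕ) : sumR (n + 1) f = sumR n f + f n := by
  simp [sumR, List.range_succ]

theorem sumR_congr {n : ℕ} {f g : ℕ → ℕ} (h : ∀ i < n, f i = g i) : sumR n f = sumR n g := by
  induction n with
  | zero => rfl
  | succ n ih => rw [sumR_succ, sumR_succ, ih fun i hi => h i (by omega), h n (by omega)]

theorem sumR_pos {n : ℕ} {f : ℕ → ℕ} : 0 < sumR n f ↔ ∃ i < n, 0 < f i := by
  induction n with
  | zero => simp [sumR]
  | succ n ih =>
    rw [sumR_succ, Nat.add_pos_iff_pos_or_pos, ih]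
    constructor
    · rintro (⟨i, hi, h⟩ | h)
      exacts [⟨i, by omega, h⟩, ⟨n, by omega, h⟩]
    · rintro ⟨i, hi, h⟩
      rcases Nat.lt_succ_iff_lt_or_eq.1 hi with hi | rfl
      exacts [Or.inl ⟨i, hi, h⟩, Or.inr h]

/-- The number with base `B` digits `f 0, …, f (k - 1)`. -/
def digitsR (B k : ℕ) (f : ℕ → ℕ) : ℕ := sumR k fun i => f i * B ^ i

theorem digitsR_lt {B k : ℕ} {f : ℕ → ℕ} (hf : ∀ i < k, f i < B) : digitsR B k f < B ^ k := by
  induction k with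
  | zero => simp [digitsR, sumR]
  | succ k ih =>
    have h1 := ih fun i hi => hf i (by omega)
    have h2 := hf k (by omega)
    rw [digitsR] at h1 ⊢
    rw [sumR_succ, pow_succ]
    have : (f k + 1) * B ^ k ≤ B * B ^ k := Nat.mul_le_mul_right _ h2
    nlinarith

theorem digitsR_digit {B k : ℕ} {f : ℕ → ℕ} (hf : ∀ i < k, f i < B) {j : ℕ} (hj : j < k) :
    digitsR B k f / B ^ j % B = f j := by
  induction k with
  | zero => omega
  | succ k ih =>
    have hB : 0 < B := (Nat.zero_le _).trans_lt (hf k (by omega))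
    have hlt := digitsR_lt (k := k) fun i hi => hf i (by omega)
    rw [digitsR] at hlt ⊢
    rw [sumR_succ]
    rcases Nat.lt_succ_iff_lt_or_eq.1 hj with hj | rfl
    · rw [show f k * B ^ k = B ^ j * (B * (f k * B ^ (k - 1 - j))) by
        rw [show B ^ k = B ^ j * (B * B ^ (k - 1 - j)) by
          rw [← pow_succ', ← pow_add]; congr 1; omega]
        ring, Nat.add_mul_div_left _ _ (pow_pos hB j), Nat.add_mul_mod_self_left]
      exact ih (fun i hi => hf i (by omega)) hj
    · rw [Nat.add_mul_div_right _ _ (pow_pos hB j), Nat.div_eq_of_lt hlt, zero_add,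
        Nat.mod_eq_of_lt (hf j (by omega))]

/-- The bit mask of the set of `i < N` with `0 < c i`. -/
def mask (N : ℕ) (c : ℕ → ℕ) : ℕ := digitsR 2 N fun i => min 1 (c i)

/-- The `i`-th bit of `A`. -/
def bitR (A i : ℕ) : ℕ := A / 2 ^ i % 2

/-- The indicator of equality. -/
def eqN (a b : ℕ) : ℕ := if a = b then 1 else 0

theorem eqN_pos {a b : ℕ} : 0 < eqN a b ↔ a = b := by
  unfold eqN; split_ifs with h <;> simp [h]

theorem mask_lt (N : ℕ) (c : ℕ → ℕ) : mask N c < 2 ^ N :=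
  digitsR_lt fun i _ => by omega

theorem bitR_mask {N : ℕ} {c : ℕ → ℕ} {i : ℕ} (hi : i < N) :
    0 < bitR (mask N c) i ↔ 0 < c i := by
  rw [bitR, mask, digitsR_digit (fun i _ => by omega) hi]; omega

theorem mask_congr {N : ℕ} {c c' : ℕ → ℕ} (h : ∀ i < N, (0 < c i ↔ 0 < c' i)) :
    mask N c = mask N c' :=
  sumR_congr fun i hi => by
    have := h i hi
    congr 1
    show min 1 (c i) = min 1 (c' i)
    omega

variable {B : ℕ}

/-- The code of the first `k` entries of a letter. -/
def letterCode (k : ℕ) (a : ℕ → Fin B) : ℕ := digitsR B k fun i => a i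

theorem letterCode_lt (k : ℕ) (a : ℕ → Fin B) : letterCode k a < B ^ k :=
  digitsR_lt fun i _ => (a i).2

/-- The factor of `w` on the interval `[a, b)`. -/
def seg {α : Type*} (w : ℕ → α) (a b : ℕ) : List α := (List.range' a (b - a)).map w

section seg
variable {α β γ : Type*}

theorem seg_append (w : ℕ → α) {a b c : ℕ} (hab : a ≤ b) (hbc : b ≤ c) :
    seg w a b ++ seg w b c = seg w a c := by
  rw [seg, seg, seg, ← List.map_append]
  congr 1
  have := List.range'_append_1 (s := a) (m := b - a) (n := c - b)
  rw [show a + (b - a) = b by omega, show b - a + (c - b) = c - a by omega] at this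
  exact this

theorem length_seg (w : ℕ → α) (a b : ℕ) : (seg w a b).length = b - a := by simp [seg]

theorem seg_ne_nil (w : ℕ → α) {a b : ℕ} (h : a < b) : seg w a b ≠ [] := by
  rw [← List.length_pos_iff, length_seg]; omega

theorem map_seg (f : α → β) (w : ℕ → α) (a b : ℕ) :
    (seg w a b).map f = seg (fun t => f (w t)) a b := by
  simp [seg]

theorem zipWith_seg (f : α → β → γ) (w : ℕ → α) (x : ℕ → β) (a b : ℕ) :
    List.zipWith f (seg w a b) (seg x a b) = seg (fun t => f (w t) (x t)) a b := by
  simp [seg, List.zipWith_map, List.zipWith_self]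

theorem exists_seg_eq [Nonempty α] {G : ℕ → ℕ} (hG : StrictMono G) (h0 : G 0 = 0)
    (X : ℕ → List α) (hX : ∀ i, (X i).length = G (i + 1) - G i) :
    ∃ x : ℕ → α, ∀ i, seg x (G i) (G (i + 1)) = X i := by
  have hex : ∀ t, ∃ i, G i ≤ t ∧ t < G (i + 1) := by
    intro t
    induction t with
    | zero => exact ⟨0, h0.le, by have := hG (Nat.lt_succ_self 0); simp only [Nat.succ_eq_add_one] at this; omega⟩
    | succ t ih =>
      obtain ⟨i, h1, h2⟩ := ih
      rcases Nat.lt_or_ge (t + 1) (G (i + 1)) with h | h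
      · exact ⟨i, by omega, h⟩
      · exact ⟨i + 1, h, by have := hG (show i + 1 < i + 1 + 1 by omega); omega⟩
  choose b hb1 hb2 using hex
  have huniq : ∀ i t, G i ≤ t → t < G (i + 1) → b t = i := by
    intro i t h1 h2
    rcases lt_trichotomy (b t) i with h | h | h
    · have := hG.monotone (Nat.succ_le_of_lt h)
      have := hb2 t
      simp only [Nat.succ_eq_add_one] at *
      omega
    · exact h
    · have := hG.monotone (Nat.succ_le_of_lt h)
      have := hb1 t
      simp only [Nat.succ_eq_add_one] at *
      omega
  refine ⟨fun t => (X (b t)).getD (t - G (b t)) (Classical.arbitrary α), fun i => ?_⟩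
  refine List.ext_getElem (by rw [length_seg, hX]) fun j h1 h2 => ?_
  rw [length_seg] at h1
  simp only [seg, List.getElem_map, List.getElem_range', one_mul]
  rw [huniq i (G i + j) (by omega) (by omega), Nat.add_sub_cancel_left,
    List.getD_eq_getElem _ _ h2]
end seg

/-- The semigroup `{0, …, N - 1}` with multiplication `mul`, letter map `h` and set of accepting
linked pairs `P` recognises the language `L` of infinite words. -/
def RecFn (k N : ℕ) (mul : ℕ → ℕ → ℕ) (h : ℕ → ℕ) (P : ℕ → ℕ → ℕ)
    (L : (ℕ → ℕ → Fin B) → Prop) : Prop :=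
  ∃ φ : List (ℕ → Fin B) → ℕ, (∀ u ≠ [], φ u < N) ∧ (∀ a, φ [a] = h (letterCode k a)) ∧
    (∀ u ≠ [], ∀ v ≠ [], φ (u ++ v) = mul (φ u) (φ v)) ∧
    ∀ (w : ℕ → ℕ → Fin B) (g : ℕ → ℕ) (e : ℕ), StrictMono g → 0 < g 0 →
      (∀ i, φ (seg w (g i) (g (i + 1))) = e) → mul e e = e →
      (L w ↔ 0 < P (φ (seg w 0 (g 0))) e)

section ops
variable {k N N₁ N₂ : ℕ} {mul mul₁ mul₂ : ℕ → ℕ → ℕ} {h h₁ h₂ : ℕ → ℕ} {P P₁ P₂ : ℕ → ℕ → ℕ}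
  {L L₁ L₂ : (ℕ → ℕ → Fin B) → Prop}

theorem RecFn.congr_lang (H : RecFn k N mul h P L) {L' : (ℕ → ℕ → Fin B) → Prop}
    (hL : ∀ w, L' w ↔ L w) : RecFn k N mul h P L' := by
  obtain rfl : L' = L := funext fun w => propext (hL w)
  exact H

theorem RecFn.not (H : RecFn k N mul h P L) :
    RecFn k N mul h (fun s e => 1 - P s e) fun w => ¬ L w := by
  obtain ⟨φ, h1, h2, h3, h4⟩ := H
  refine ⟨φ, h1, h2, h3, fun w g e hg hg0 he hee => ?_⟩
  show ¬ L w ↔ 0 < 1 - P (φ (seg w 0 (g 0))) e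
  rw [h4 w g e hg hg0 he hee]
  omega

theorem RecFn.and (H₁ : RecFn k N₁ mul₁ h₁ P₁ L₁) (H₂ : RecFn k N₂ mul₂ h₂ P₂ L₂) :
    RecFn k (N₁ * N₂) (fun x y => mul₁ (x / N₂) (y / N₂) * N₂ + mul₂ (x % N₂) (y % N₂))
      (fun c => h₁ c * N₂ + h₂ c)
      (fun x y => P₁ (x / N₂) (y / N₂) * P₂ (x % N₂) (y % N₂)) fun w => L₁ w ∧ L₂ w := by
  obtain ⟨φ₁, h1, h2, h3, h4⟩ := H₁
  obtain ⟨φ₂, h1', h2', h3', h4'⟩ := H₂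
  have hd : ∀ u ≠ [], (φ₁ u * N₂ + φ₂ u) / N₂ = φ₁ u := fun u hu => by
    have := h1' u hu
    rw [mul_comm, Nat.mul_add_div (by omega), Nat.div_eq_of_lt this, add_zero]
  have hm : ∀ u ≠ [], (φ₁ u * N₂ + φ₂ u) % N₂ = φ₂ u := fun u hu => by
    rw [mul_comm, Nat.mul_add_mod, Nat.mod_eq_of_lt (h1' u hu)]
  refine ⟨fun u => φ₁ u * N₂ + φ₂ u, fun u hu => ?_, fun a => by simp only [h2, h2'], fun u hu v hv => ?_,
    fun w g e hg hg0 he hee => ?_⟩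
  · have := h1 u hu
    have := h1' u hu
    calc φ₁ u * N₂ + φ₂ u < φ₁ u * N₂ + N₂ := by omega
      _ = (φ₁ u + 1) * N₂ := by ring
      _ ≤ N₁ * N₂ := Nat.mul_le_mul_right _ (by omega)
  · simp only [h3 u hu v hv, h3' u hu v hv, hd u hu, hd v hv, hm u hu, hm v hv]
  · have hne : ∀ i, seg w (g i) (g (i + 1)) ≠ [] := fun i => seg_ne_nil _ (hg (Nat.lt_succ_self i))
    have e1 : ∀ i, φ₁ (seg w (g i) (g (i + 1))) = e / N₂ := fun i => by rw [← he i, hd _ (hne i)]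
    have e2 : ∀ i, φ₂ (seg w (g i) (g (i + 1))) = e % N₂ := fun i => by rw [← he i, hm _ (hne i)]
    have hlt : mul₂ (e % N₂) (e % N₂) < N₂ := by
      have := h3' _ (hne 0) _ (hne 1)
      rw [e2, e2] at this
      rw [← this]
      exact h1' _ (by simp [hne 0])
    have i1 : mul₁ (e / N₂) (e / N₂) = e / N₂ := by
      conv_rhs => rw [← hee]
      dsimp only
      rw [mul_comm, Nat.mul_add_div (by omega), Nat.div_eq_of_lt hlt, add_zero]
    have i2 : mul₂ (e % N₂) (e % N₂) = e % N₂ := by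
      conv_rhs => rw [← hee]
      dsimp only
      rw [mul_comm, Nat.mul_add_mod, Nat.mod_eq_of_lt hlt]
    have h0 := seg_ne_nil w hg0
    dsimp only
    rw [h4 w g _ hg hg0 e1 i1, h4' w g _ hg hg0 e2 i2, hd _ h0, hm _ h0, Nat.pos_iff_ne_zero,
      Nat.pos_iff_ne_zero, Nat.pos_iff_ne_zero, mul_ne_zero_iff]

theorem RecFn.reindex {k' : ℕ} {ρ : ℕ → ℕ} (hρ : ∀ i < k, ρ i < k') (H : RecFn k N mul h P L) :
    RecFn k' N mul (fun c => h (digitsR B k fun i => c / B ^ ρ i % B)) P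
      fun w => L fun t i => w t (ρ i) := by
  obtain ⟨φ, h1, h2, h3, h4⟩ := H
  refine ⟨fun u => φ (u.map fun a i => a (ρ i)), fun u hu => h1 _ (by simpa using hu), fun a => ?_,
    fun u hu v hv => ?_, fun w g e hg hg0 he hee => ?_⟩
  · dsimp only
    rw [List.map_singleton, h2]
    congr 1
    exact sumR_congr fun i hi => by
      dsimp only
      rw [letterCode, digitsR_digit (fun i _ => (a i).2) (hρ i hi)]
  · dsimp only
    rw [List.map_append, h3 _ (by simpa using hu) _ (by simpa using hv)]
  · simp only [map_seg] at he ⊢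
    exact h4 _ g e hg hg0 he hee

theorem letterCode_update (k : ℕ) (a : ℕ → Fin B) (y : Fin B) :
    letterCode (k + 1) (Function.update a k y) = letterCode k a + y * B ^ k := by
  rw [letterCode, letterCode, digitsR, digitsR, sumR_succ]
  simp only [Function.update_self]
  congr 1
  exact sumR_congr fun i hi => by rw [Function.update_of_ne (by omega)]

/-- The product of two sets of elements, coded by bit masks. -/
def setMul (N : ℕ) (mul : ℕ → ℕ → ℕ) (A C : ℕ) : ℕ :=
  mask N fun i => sumR N fun a => sumR N fun b => bitR A a * bitR C b * eqN (mul a b) i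

theorem mul_pos_iff_nat {a b : ℕ} : 0 < a * b ↔ 0 < a ∧ 0 < b := by
  simp [Nat.pos_iff_ne_zero]

theorem bitR_setMul {A C s : ℕ} (hs : s < N) : 0 < bitR (setMul N mul A C) s ↔
    ∃ a < N, ∃ b < N, 0 < bitR A a ∧ 0 < bitR C b ∧ mul a b = s := by
  rw [setMul, bitR_mask hs, sumR_pos]
  simp only [sumR_pos, mul_pos_iff_nat, eqN_pos, and_assoc]

theorem RecFn.ex (H : RecFn (k + 1) N mul h P L) :
    RecFn k (2 ^ N) (setMul N mul)
      (fun c => mask N fun i => sumR B fun σ => eqN (h (c + σ * B ^ k)) i)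
      (fun A E => sumR N fun s => sumR N fun e =>
        bitR (setMul N mul A E) s * bitR E e * eqN (mul e e) e * P s e)
      fun w => ∃ x : ℕ → Fin B, L fun t => Function.update (w t) k (x t) := by
  classical
  obtain ⟨φ, h1, h2, h3, h4⟩ := H
  let ext : (ℕ → Fin B) → Fin B → ℕ → Fin B := fun a y => Function.update a k y
  let S : List (ℕ → Fin B) → ℕ → Prop := fun u s =>
    ∃ x : List (Fin B), x.length = u.length ∧ φ (List.zipWith ext u x) = s
  let φ' : List (ℕ → Fin B) → ℕ := fun u => mask N fun s => if S u s then 1 else 0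
  have hne : ∀ (u : List (ℕ → Fin B)) (x : List (Fin B)), u ≠ [] → x.length = u.length →
      List.zipWith ext u x ≠ [] := by
    intro u x hu hx
    rw [← List.length_pos_iff] at hu ⊢
    simp [hx, hu]
  have hmem : ∀ u s, s < N → (0 < bitR (φ' u) s ↔ S u s) := by
    intro u s hs
    rw [bitR_mask hs]
    split_ifs with h <;> simp [h]
  have hS : ∀ u ≠ [], ∀ s, S u s → s < N := by
    rintro u hu s ⟨x, hx, rfl⟩
    exact h1 _ (hne u x hu hx)
  have hmul : ∀ u ≠ [], ∀ v ≠ [], ∀ s, S (u ++ v) s ↔ ∃ a b, S u a ∧ S v b ∧ mul a b = s := by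
    intro u hu v hv s
    constructor
    · rintro ⟨x, hx, rfl⟩
      rw [List.length_append] at hx
      have l1 : (x.take u.length).length = u.length := by simp; omega
      have l2 : (x.drop u.length).length = v.length := by simp; omega
      refine ⟨_, _, ⟨_, l1, rfl⟩, ⟨_, l2, rfl⟩, ?_⟩
      rw [← h3 _ (hne _ _ hu l1) _ (hne _ _ hv l2), ← List.zipWith_append l1.symm,
        List.take_append_drop]
    · rintro ⟨_, _, ⟨x, hx, rfl⟩, ⟨y, hy, rfl⟩, rfl⟩
      refine ⟨x ++ y, by simp [hx, hy], ?_⟩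
      rw [List.zipWith_append hx.symm, h3 _ (hne _ _ hu hx) _ (hne _ _ hv hy)]
  have hφmul : ∀ u ≠ [], ∀ v ≠ [], φ' (u ++ v) = setMul N mul (φ' u) (φ' v) := by
    intro u hu v hv
    refine mask_congr fun i hi => ?_
    rw [← bitR_mask (N := N) (c := fun s => if S (u ++ v) s then 1 else 0) hi,
      ← bitR_mask (N := N) (c := fun i => sumR N fun a => sumR N fun b => bitR (φ' u) a *
        bitR (φ' v) b * eqN (mul a b) i) hi]
    change 0 < bitR (φ' (u ++ v)) i ↔ 0 < bitR (setMul N mul (φ' u) (φ' v)) i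
    rw [hmem _ _ hi, hmul u hu v hv, bitR_setMul hi]
    constructor
    · rintro ⟨a, b, ha, hb, hab⟩
      have ha' := hS u hu a ha
      have hb' := hS v hv b hb
      exact ⟨a, ha', b, hb', (hmem _ _ ha').2 ha, (hmem _ _ hb').2 hb, hab⟩
    · rintro ⟨a, ha', b, hb', ha, hb, hab⟩
      exact ⟨a, b, (hmem _ _ ha').1 ha, (hmem _ _ hb').1 hb, hab⟩
  refine ⟨φ', fun u _ => mask_lt _ _, fun a => mask_congr fun i hi => ?_, hφmul,
    fun w g E hg hg0 he hee => ?_⟩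
  · rw [sumR_pos]
    have : (0 < if S [a] i then 1 else 0) ↔ S [a] i := by split_ifs with h <;> simp [h]
    rw [this]
    simp only [eqN_pos]
    constructor
    · rintro ⟨x, hx, rfl⟩
      obtain ⟨y, rfl⟩ := List.length_eq_one_iff.1 hx
      refine ⟨y, y.2, ?_⟩
      rw [List.zipWith_cons_cons, List.zipWith_nil_left, h2, letterCode_update]
    · rintro ⟨σ, hσ, rfl⟩
      refine ⟨[⟨σ, hσ⟩], rfl, ?_⟩
      rw [List.zipWith_cons_cons, List.zipWith_nil_left, h2, letterCode_update]
  · have hgm : ∀ i, g i < g (i + 1) := fun i => hg (Nat.lt_succ_self i)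
    have hnw : ∀ i, seg w (g i) (g (i + 1)) ≠ [] := fun i => seg_ne_nil _ (hgm i)
    have h0 := seg_ne_nil w hg0
    have hAE : setMul N mul (φ' (seg w 0 (g 0))) E = φ' (seg w 0 (g 1)) := by
      rw [← he 0, ← hφmul _ h0 _ (hnw 0), seg_append w (Nat.zero_le _) (hgm 0).le]
    dsimp only
    rw [hAE, sumR_pos]
    simp only [sumR_pos, mul_pos_iff_nat, eqN_pos, and_assoc]
    constructor
    · rintro ⟨x, hx⟩
      set W : ℕ → ℕ → Fin B := fun t => Function.update (w t) k (x t) with hW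
      have hSW : ∀ i j, S (seg w i j) (φ (seg W i j)) := fun i j =>
        ⟨seg x i j, by simp [length_seg], by rw [zipWith_seg]⟩
      obtain ⟨γ, e, hγ, hγe⟩ := exists_monochromatic_seq (fun i j => φ (seg W (g i) (g j)))
        (N := N) fun i j hij => h1 _ (seg_ne_nil _ (hg hij))
      have hpow : ∀ i d, φ' (seg w (g i) (g (i + 1 + d))) = E := by
        intro i d
        induction d with
        | zero => exact he i
        | succ d ih =>
          rw [← seg_append w (b := g (i + 1 + d)) (hg (by omega)).le (hg (by omega)).le,
            hφmul _ (seg_ne_nil _ (hg (by omega))) _ (seg_ne_nil _ (hg (by omega))), ih]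
          conv_rhs => rw [← hee]
          congr 1
          exact he (i + 1 + d)
      have hE : ∀ i j, i < j → φ' (seg w (g i) (g j)) = E := by
        intro i j hij
        obtain ⟨d, rfl⟩ := Nat.exists_eq_add_of_le hij
        exact hpow i d
      have hγ1 : 0 < γ 1 := (Nat.zero_le _).trans_lt (hγ one_pos)
      have hs1 : φ' (seg w 0 (g (γ 1))) = φ' (seg w 0 (g 1)) := by
        rw [← seg_append w (Nat.zero_le _) (hg hγ1).le, hφmul _ h0 _ (seg_ne_nil _ (hg hγ1)),
          hE _ _ hγ1, hAE]
      have hs0 : seg W 0 (g (γ 1)) ≠ [] := seg_ne_nil _ (hg0.trans (hg hγ1))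
      have hee' : mul e e = e := by
        have h13 := hγe 1 3 (by norm_num)
        rw [← seg_append W (hg (hγ (show 1 < 2 by norm_num))).le
          (hg (hγ (show 2 < 3 by norm_num))).le,
          h3 _ (seg_ne_nil _ (hg (hγ (by norm_num)))) _ (seg_ne_nil _ (hg (hγ (by norm_num)))),
          hγe 1 2 (by norm_num), hγe 2 3 (by norm_num)] at h13
        exact h13
      have heN : e < N := by
        rw [← hγe 1 2 (by norm_num)]
        exact h1 _ (seg_ne_nil _ (hg (hγ (by norm_num))))
      have hg' : StrictMono fun i => g (γ (i + 1)) := fun i j hij => hg (hγ (by omega))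
      have hP := (h4 W (fun i => g (γ (i + 1))) e hg' (hg0.trans (hg hγ1))
        (fun i => hγe _ _ (by omega)) hee').1 hx
      refine ⟨_, h1 _ hs0, e, heN, ?_, ?_, hee', hP⟩
      · rw [← hs1]
        exact (hmem _ _ (h1 _ hs0)).2 (hSW _ _)
      · rw [← hE (γ 1) (γ 2) (hγ (by norm_num))]
        refine (hmem _ _ heN).2 ?_
        rw [← hγe 1 2 (by norm_num)]
        exact hSW _ _
    · rintro ⟨s, hs, e, heN, hsA, heE, hee', hP⟩
      obtain ⟨x₀, hx₀, hx₀s⟩ := (hmem _ _ hs).1 hsA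
      have hX : ∀ i, ∃ x : List (Fin B), x.length = g (i + 2) - g (i + 1) ∧
          φ (List.zipWith ext (seg w (g (i + 1)) (g (i + 2))) x) = e := by
        intro i
        rw [← he (i + 1)] at heE
        obtain ⟨x, hx, hxe⟩ := (hmem _ _ heN).1 heE
        exact ⟨x, by rw [hx, length_seg], hxe⟩
      choose X hX hXe using hX
      have : Nonempty (Fin B) := ⟨w 0 0⟩
      let G : ℕ → ℕ := fun i => if i = 0 then 0 else g i
      have hGs : ∀ i, G (i + 1) = g (i + 1) := fun i => by simp [G]
      have hG : StrictMono G := by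
        refine strictMono_nat_of_lt_succ fun i => ?_
        rw [hGs]
        rcases i with _ | i
        · exact hg0.trans (hgm 0)
        · rw [hGs]
          exact hgm _
      obtain ⟨x, hx⟩ := exists_seg_eq hG (by simp [G])
        (fun i => Nat.casesOn i x₀ X) (fun i => by
          rcases i with _ | i
          · simpa [G, length_seg] using hx₀
          · simpa [hGs] using hX i)
      refine ⟨x, ?_⟩
      refine (h4 (fun t => ext (w t) (x t)) (fun i => g (i + 1)) e
        (fun i j hij => hg (by omega)) (hg0.trans (hgm 0)) (fun i => ?_) hee').2 ?_
      · have := hx (i + 1)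
        rw [hGs, hGs] at this
        rw [← hXe i, ← zipWith_seg, this]
      · have := hx 0
        rw [hGs, show G 0 = 0 from rfl] at this
        rw [← zipWith_seg, this]
        change 0 < P (φ (List.zipWith ext (seg w 0 (g 1)) x₀)) e
        rw [hx₀s]
        exact hP

end ops

end InfiniteWords

section Recognisers

section primrec
variable {α : Type*} [Primcodable α]

theorem primrec_sumR {n : α → ℕ} {f : α → ℕ → ℕ} (hn : Primrec n) (hf : Primrec₂ f) :
    Primrec fun a => sumR (n a) (f a) := by
  have : Primrec fun a => ((List.range (n a)).map (f a)).foldr (fun b s => b + s) 0 :=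
    Primrec.list_foldr (Primrec.list_map (Primrec.list_range.comp hn) hf) (Primrec.const 0)
      (Primrec.nat_add.comp (Primrec.fst.comp Primrec.snd) (Primrec.snd.comp Primrec.snd)).to₂
  exact this.of_eq fun a => rfl

theorem primrec_pow : Primrec₂ fun a b : ℕ => a ^ b :=
  Primrec₂.unpaired'.1 Nat.Primrec.pow

theorem primrec_digitsR {B n : α → ℕ} {f : α → ℕ → ℕ} (hB : Primrec B) (hn : Primrec n)
    (hf : Primrec₂ f) : Primrec fun a => digitsR (B a) (n a) (f a) :=
  primrec_sumR hn (Primrec.nat_mul.comp hf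
    (primrec_pow.comp (hB.comp Primrec.fst) Primrec.snd)).to₂

theorem primrec_mask {n : α → ℕ} {f : α → ℕ → ℕ} (hn : Primrec n) (hf : Primrec₂ f) :
    Primrec fun a => mask (n a) (f a) :=
  primrec_digitsR (Primrec.const 2) hn (Primrec.nat_min.comp (Primrec.const 1) hf).to₂

theorem primrec_bitR : Primrec₂ bitR :=
  Primrec.nat_mod.comp (Primrec.nat_div.comp Primrec.fst
    (primrec_pow.comp (Primrec.const 2) Primrec.snd)) (Primrec.const 2)

theorem primrec_eqN : Primrec₂ eqN :=
  (Primrec.ite (PrimrecRel.comp Primrec.eq Primrec.fst Primrec.snd)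
    (Primrec.const 1) (Primrec.const 0)).to₂

theorem primrec_digit : Primrec fun p : ℕ × ℕ × ℕ => p.1 / p.2.1 ^ p.2.2 % p.2.1 :=
  Primrec.nat_mod.comp (Primrec.nat_div.comp Primrec.fst
    (primrec_pow.comp (Primrec.fst.comp Primrec.snd) (Primrec.snd.comp Primrec.snd)))
    (Primrec.fst.comp Primrec.snd)
end primrec

/-- A coded recogniser: the size of a semigroup, its multiplication table, the table of the letter
map and the table of accepting linked pairs. -/
abbrev Recog := ℕ × List ℕ × List ℕ × List ℕ

namespace Recog

/-- The multiplication of a coded recogniser. -/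
def mul (r : Recog) (i j : ℕ) : ℕ := r.2.1.getD (i * r.1 + j) 0

/-- The letter map of a coded recogniser. -/
def letter (r : Recog) (c : ℕ) : ℕ := r.2.2.1.getD c 0

/-- The acceptance condition of a coded recogniser. -/
def acc (r : Recog) (i j : ℕ) : ℕ := r.2.2.2.getD (i * r.1 + j) 0

/-- The coded recogniser with the given data on an alphabet of `c` letters. -/
def mk (N c : ℕ) (m : ℕ → ℕ → ℕ) (h : ℕ → ℕ) (p : ℕ → ℕ → ℕ) : Recog :=
  (N, (List.range (N * N)).map (fun x => m (x / N) (x % N)), (List.range c).map h,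
    (List.range (N * N)).map (fun x => p (x / N) (x % N)))

theorem getD_table {N i j : ℕ} (m : ℕ → ℕ → ℕ) (hi : i < N) (hj : j < N) :
    ((List.range (N * N)).map (fun x => m (x / N) (x % N))).getD (i * N + j) 0 = m i j := by
  have : i * N + j < N * N := by nlinarith
  rw [List.getD_eq_getElem _ _ (by simpa using this)]
  simp only [List.getElem_map, List.getElem_range]
  rw [mul_comm i N, Nat.mul_add_div (by omega), Nat.div_eq_of_lt hj, Nat.mul_add_mod,
    Nat.mod_eq_of_lt hj, add_zero]

theorem mul_mk {N c i j : ℕ} {m h p} (hi : i < N) (hj : j < N) :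
    (mk N c m h p).mul i j = m i j := getD_table m hi hj

theorem acc_mk {N c i j : ℕ} {m h p} (hi : i < N) (hj : j < N) :
    (mk N c m h p).acc i j = p i j := getD_table p hi hj

theorem letter_mk {N c i : ℕ} {m h p} (hi : i < c) : (mk N c m h p).letter i = h i := by
  rw [letter, mk, List.getD_eq_getElem _ _ (by simpa using hi)]
  simp

/-- The coded recogniser `r` recognises `L`. -/
def Recognizes {B : ℕ} (k : ℕ) (r : Recog) (L : (ℕ → ℕ → Fin B) → Prop) : Prop :=
  RecFn k r.1 r.mul r.letter r.acc L

variable {B k N : ℕ} {m : ℕ → ℕ → ℕ} {h : ℕ → ℕ} {p : ℕ → ℕ → ℕ}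
  {L L₁ L₂ : (ℕ → ℕ → Fin B) → Prop}

theorem recognizes_mk (H : RecFn k N m h p L) : Recognizes k (mk N (B ^ k) m h p) L := by
  obtain ⟨φ, h1, h2, h3, h4⟩ := H
  refine ⟨φ, h1, fun a => by rw [h2, letter_mk (letterCode_lt _ _)], fun u hu v hv => ?_,
    fun w g e hg hg0 he hee => ?_⟩
  · rw [h3 u hu v hv, mul_mk (h1 u hu) (h1 v hv)]
  · have he' : e < N := he 0 ▸ h1 _ (seg_ne_nil _ (hg (Nat.lt_succ_self 0)))
    rw [mul_mk he' he'] at hee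
    rw [acc_mk (h1 _ (seg_ne_nil _ hg0)) he']
    exact h4 w g e hg hg0 he hee

theorem Recognizes.congr {r : Recog} (H : Recognizes k r L) {L' : (ℕ → ℕ → Fin B) → Prop}
    (hL : ∀ w, L' w ↔ L w) : Recognizes k r L' := RecFn.congr_lang H hL

/-- Complement. -/
def notR (B k : ℕ) (r : Recog) : Recog := mk r.1 (B ^ k) r.mul r.letter fun s e => 1 - r.acc s e

/-- Intersection. -/
def andR (B k : ℕ) (r s : Recog) : Recog :=
  mk (r.1 * s.1) (B ^ k)
    (fun x y => r.mul (x / s.1) (y / s.1) * s.1 + s.mul (x % s.1) (y % s.1))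
    (fun c => r.letter c * s.1 + s.letter c)
    (fun x y => r.acc (x / s.1) (y / s.1) * s.acc (x % s.1) (y % s.1))

/-- Projection of the last track. -/
def exR (B k : ℕ) (r : Recog) : Recog :=
  mk (2 ^ r.1) (B ^ k) (setMul r.1 r.mul)
    (fun c => mask r.1 fun i => sumR B fun σ => eqN (r.letter (c + σ * B ^ k)) i)
    (fun A E => sumR r.1 fun s => sumR r.1 fun e =>
      bitR (setMul r.1 r.mul A E) s * bitR E e * eqN (r.mul e e) e * r.acc s e)

/-- Renaming of tracks. -/
def reindexR (B k k' : ℕ) (l : List ℕ) (r : Recog) : Recog :=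
  mk r.1 (B ^ k') r.mul (fun c => r.letter (digitsR B k fun i => c / B ^ (l.getD i 0) % B)) r.acc

theorem Recognizes.not {r : Recog} (H : Recognizes k r L) :
    Recognizes k (notR B k r) fun w => ¬ L w := recognizes_mk (RecFn.not H)

theorem Recognizes.and {r s : Recog} (H₁ : Recognizes k r L₁) (H₂ : Recognizes k s L₂) :
    Recognizes k (andR B k r s) fun w => L₁ w ∧ L₂ w := recognizes_mk (RecFn.and H₁ H₂)

theorem Recognizes.ex {r : Recog} (H : Recognizes (k + 1) r L) :
    Recognizes k (exR B k r)
      fun w => ∃ x : ℕ → Fin B, L fun t => Function.update (w t) k (x t) :=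
  recognizes_mk (RecFn.ex H)

theorem Recognizes.reindex {r : Recog} {k' : ℕ} {l : List ℕ} (H : Recognizes k r L)
    (hl : ∀ i < k, l.getD i 0 < k') :
    Recognizes k' (reindexR B k k' l r) fun w => L fun t i => w t (l.getD i 0) :=
  recognizes_mk (RecFn.reindex hl H)

section primrec
variable {α : Type*} [Primcodable α]

theorem primrec_mul {f : α → Recog} {i j : α → ℕ} (hf : Primrec f) (hi : Primrec i)
    (hj : Primrec j) : Primrec fun a => (f a).mul (i a) (j a) :=
  (Primrec.list_getD 0).comp (Primrec.fst.comp (Primrec.snd.comp hf))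
    (Primrec.nat_add.comp (Primrec.nat_mul.comp hi (Primrec.fst.comp hf)) hj)

theorem primrec_acc {f : α → Recog} {i j : α → ℕ} (hf : Primrec f) (hi : Primrec i)
    (hj : Primrec j) : Primrec fun a => (f a).acc (i a) (j a) :=
  (Primrec.list_getD 0).comp (Primrec.snd.comp (Primrec.snd.comp (Primrec.snd.comp hf)))
    (Primrec.nat_add.comp (Primrec.nat_mul.comp hi (Primrec.fst.comp hf)) hj)

theorem primrec_letter {f : α → Recog} {i : α → ℕ} (hf : Primrec f) (hi : Primrec i) :
    Primrec fun a => (f a).letter (i a) :=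
  (Primrec.list_getD 0).comp (Primrec.fst.comp (Primrec.snd.comp (Primrec.snd.comp hf))) hi

theorem primrec_mk {N c : α → ℕ} {m : α → ℕ → ℕ → ℕ} {h : α → ℕ → ℕ} {p : α → ℕ → ℕ → ℕ}
    (hN : Primrec N) (hc : Primrec c) (hm : Primrec fun x : α × ℕ × ℕ => m x.1 x.2.1 x.2.2)
    (hh : Primrec₂ h) (hp : Primrec fun x : α × ℕ × ℕ => p x.1 x.2.1 x.2.2) :
    Primrec fun a => mk (N a) (c a) (m a) (h a) (p a) := by
  have aux : ∀ {q : α → ℕ → ℕ → ℕ}, (Primrec fun x : α × ℕ × ℕ => q x.1 x.2.1 x.2.2) →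
      Primrec fun a => (List.range (N a * N a)).map fun x => q a (x / N a) (x % N a) :=
    fun {q} hq => Primrec.list_map (Primrec.list_range.comp (Primrec.nat_mul.comp hN hN))
      (hq.comp (Primrec.fst.pair
        ((Primrec.nat_div.comp Primrec.snd (hN.comp Primrec.fst)).pair
          (Primrec.nat_mod.comp Primrec.snd (hN.comp Primrec.fst))))).to₂
  exact hN.pair ((aux hm).pair ((Primrec.list_map (Primrec.list_range.comp hc) hh).pair (aux hp)))

variable {f g : α → Recog} {kf kf' : α → ℕ} {lf : α → List ℕ}

theorem primrec_notR (hk : Primrec kf) (hf : Primrec f) : Primrec fun a => notR B (kf a) (f a) := by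
  have hf' : Primrec fun x : α × ℕ × ℕ => f x.1 := hf.comp Primrec.fst
  have h1 : Primrec fun x : α × ℕ × ℕ => x.2.1 := Primrec.fst.comp Primrec.snd
  have h2 : Primrec fun x : α × ℕ × ℕ => x.2.2 := Primrec.snd.comp Primrec.snd
  exact primrec_mk (Primrec.fst.comp hf) (primrec_pow.comp (Primrec.const B) hk)
    (primrec_mul hf' h1 h2) (primrec_letter (hf.comp Primrec.fst) Primrec.snd).to₂
    (Primrec.nat_sub.comp (Primrec.const 1) (primrec_acc hf' h1 h2))

theorem primrec_reindexR (hk : Primrec kf) (hk' : Primrec kf') (hl : Primrec lf) (hf : Primrec f) :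
    Primrec fun a => reindexR B (kf a) (kf' a) (lf a) (f a) := by
  have hf' : Primrec fun x : α × ℕ × ℕ => f x.1 := hf.comp Primrec.fst
  have h1 : Primrec fun x : α × ℕ × ℕ => x.2.1 := Primrec.fst.comp Primrec.snd
  have h2 : Primrec fun x : α × ℕ × ℕ => x.2.2 := Primrec.snd.comp Primrec.snd
  exact primrec_mk (Primrec.fst.comp hf) (primrec_pow.comp (Primrec.const B) hk')
    (primrec_mul hf' h1 h2)
    (primrec_letter (hf.comp Primrec.fst) (primrec_digitsR (Primrec.const B) (hk.comp Primrec.fst)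
      (primrec_digit.comp ((Primrec.snd.comp Primrec.fst).pair ((Primrec.const B).pair
        ((Primrec.list_getD 0).comp (hl.comp (Primrec.fst.comp Primrec.fst)) Primrec.snd)))).to₂)).to₂
    (primrec_acc hf' h1 h2)

theorem primrec_andR (hk : Primrec kf) (hf : Primrec f) (hg : Primrec g) :
    Primrec fun a => andR B (kf a) (f a) (g a) := by
  have hf' : Primrec fun x : α × ℕ × ℕ => f x.1 := hf.comp Primrec.fst
  have hg' : Primrec fun x : α × ℕ × ℕ => g x.1 := hg.comp Primrec.fst
  have hn : Primrec fun x : α × ℕ × ℕ => (g x.1).1 := Primrec.fst.comp hg'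
  have h1 : Primrec fun x : α × ℕ × ℕ => x.2.1 := Primrec.fst.comp Primrec.snd
  have h2 : Primrec fun x : α × ℕ × ℕ => x.2.2 := Primrec.snd.comp Primrec.snd
  have d1 := Primrec.nat_div.comp h1 hn
  have d2 := Primrec.nat_div.comp h2 hn
  have m1 := Primrec.nat_mod.comp h1 hn
  have m2 := Primrec.nat_mod.comp h2 hn
  exact primrec_mk (Primrec.nat_mul.comp (Primrec.fst.comp hf) (Primrec.fst.comp hg))
    (primrec_pow.comp (Primrec.const B) hk)
    (Primrec.nat_add.comp (Primrec.nat_mul.comp (primrec_mul hf' d1 d2) hn)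
      (primrec_mul hg' m1 m2))
    (Primrec.nat_add.comp (Primrec.nat_mul.comp
      (primrec_letter (hf.comp Primrec.fst) Primrec.snd)
      (Primrec.fst.comp (hg.comp Primrec.fst)))
      (primrec_letter (hg.comp Primrec.fst) Primrec.snd)).to₂
    (Primrec.nat_mul.comp (primrec_acc hf' d1 d2) (primrec_acc hg' m1 m2))

theorem primrec_setMul {A C : α → ℕ} (hf : Primrec f) (hA : Primrec A) (hC : Primrec C) :
    Primrec fun a => setMul (f a).1 (f a).mul (A a) (C a) := by
  have p1 : Primrec fun x : ((α × ℕ) × ℕ) × ℕ => x.1.1.1 :=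
    Primrec.fst.comp (Primrec.fst.comp Primrec.fst)
  have p2 : Primrec fun x : ((α × ℕ) × ℕ) × ℕ => x.1.1.2 :=
    Primrec.snd.comp (Primrec.fst.comp Primrec.fst)
  have p3 : Primrec fun x : ((α × ℕ) × ℕ) × ℕ => x.1.2 := Primrec.snd.comp Primrec.fst
  have p4 : Primrec fun x : ((α × ℕ) × ℕ) × ℕ => x.2 := Primrec.snd
  exact primrec_mask (Primrec.fst.comp hf)
    (primrec_sumR (Primrec.fst.comp (hf.comp Primrec.fst))
      (primrec_sumR (Primrec.fst.comp (hf.comp (Primrec.fst.comp Primrec.fst)))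
        (Primrec.nat_mul.comp (Primrec.nat_mul.comp (primrec_bitR.comp (hA.comp p1) p3)
          (primrec_bitR.comp (hC.comp p1) p4))
          (primrec_eqN.comp (primrec_mul (hf.comp p1) p3 p4) p2)).to₂).to₂).to₂

theorem primrec_exR (hk : Primrec kf) (hf : Primrec f) : Primrec fun a => exR B (kf a) (f a) := by
  have hf' : Primrec fun x : α × ℕ × ℕ => f x.1 := hf.comp Primrec.fst
  have h1 : Primrec fun x : α × ℕ × ℕ => x.2.1 := Primrec.fst.comp Primrec.snd
  have h2 : Primrec fun x : α × ℕ × ℕ => x.2.2 := Primrec.snd.comp Primrec.snd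
  have p0 : Primrec fun x : ((α × ℕ × ℕ) × ℕ) × ℕ => x.1.1 := Primrec.fst.comp Primrec.fst
  have pf : Primrec fun x : ((α × ℕ × ℕ) × ℕ) × ℕ => f x.1.1.1 := hf'.comp p0
  have ps : Primrec fun x : ((α × ℕ × ℕ) × ℕ) × ℕ => x.1.2 := Primrec.snd.comp Primrec.fst
  have pe : Primrec fun x : ((α × ℕ × ℕ) × ℕ) × ℕ => x.2 := Primrec.snd
  have q0 : Primrec fun x : ((α × ℕ) × ℕ) × ℕ => x.1.1 := Primrec.fst.comp Primrec.fst
  have hB := Primrec.const (α := ((α × ℕ) × ℕ) × ℕ) B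
  exact primrec_mk (primrec_pow.comp (Primrec.const 2) (Primrec.fst.comp hf))
    (primrec_pow.comp (Primrec.const B) hk) (primrec_setMul hf' h1 h2)
    (primrec_mask (Primrec.fst.comp (hf.comp Primrec.fst))
      (primrec_sumR (Primrec.const B) (primrec_eqN.comp (primrec_letter (hf.comp
        (Primrec.fst.comp q0)) (Primrec.nat_add.comp (Primrec.snd.comp q0) (Primrec.nat_mul.comp
          Primrec.snd (primrec_pow.comp hB (hk.comp (Primrec.fst.comp q0))))))
        (Primrec.snd.comp Primrec.fst)).to₂).to₂).to₂
    (primrec_sumR (Primrec.fst.comp hf') (primrec_sumR (Primrec.fst.comp (hf'.comp Primrec.fst))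
      (Primrec.nat_mul.comp (Primrec.nat_mul.comp (Primrec.nat_mul.comp
        (primrec_bitR.comp (primrec_setMul pf (h1.comp p0) (h2.comp p0)) ps)
        (primrec_bitR.comp (h2.comp p0) pe)) (primrec_eqN.comp (primrec_mul pf pe pe) pe))
        (primrec_acc pf ps pe)).to₂).to₂)

end primrec

end Recog

end Recognisers

section LocalLanguages

section finite
variable {B k : ℕ} {S : Type} [Fintype S]

theorem letterCode_injOn {a b : ℕ → Fin B} (h : letterCode k a = letterCode k b) {i : ℕ}
    (hi : i < k) : a i = b i := by
  have h1 := digitsR_digit (k := k) (fun i _ => (a i).2) hi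
  have h2 := digitsR_digit (k := k) (fun i _ => (b i).2) hi
  rw [letterCode, letterCode] at h
  exact Fin.ext (by rw [← h1, ← h2, h])

/-- A morphism to a finite semigroup yields a coded recogniser. -/
theorem Recog.exists_of_finite (ψ : List (ℕ → Fin B) → S) (m : S → S → S)
    (hψ : ∀ a b, letterCode k a = letterCode k b → ψ [a] = ψ [b])
    (hmul : ∀ u ≠ [], ∀ v ≠ [], ψ (u ++ v) = m (ψ u) (ψ v)) (P : S → S → Prop)
    {L : (ℕ → ℕ → Fin B) → Prop}
    (hL : ∀ (w : ℕ → ℕ → Fin B) (g : ℕ → ℕ) (e : S), StrictMono g → 0 < g 0 →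
      (∀ i, ψ (seg w (g i) (g (i + 1))) = e) → m e e = e → (L w ↔ P (ψ (seg w 0 (g 0))) e)) :
    ∃ r : Recog, r.Recognizes k L := by
  classical
  let E := Fintype.equivFin S
  let d : ℕ → S := fun i => if h : i < Fintype.card S then E.symm ⟨i, h⟩ else ψ []
  have hd : ∀ s, d (E s) = s := fun s => by simp [d]
  refine ⟨_, Recog.recognizes_mk (N := Fintype.card S) (m := fun i j => E (m (d i) (d j)))
    (h := fun c => if h : ∃ a, letterCode k a = c then E (ψ [h.choose]) else 0)
    (p := fun i j => if P (d i) (d j) then 1 else 0)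
    ⟨fun u => E (ψ u), fun u _ => (E _).2, fun a => ?_, fun u hu v hv => ?_,
      fun w g e hg hg0 he hee => ?_⟩⟩
  · have h : ∃ b : ℕ → Fin B, letterCode k b = letterCode k a := ⟨a, rfl⟩
    dsimp only
    rw [dif_pos h, hψ _ _ h.choose_spec]
  · dsimp only
    rw [hd, hd, hmul u hu v hv]
  · dsimp only at he hee ⊢
    have he' : ∀ i, ψ (seg w (g i) (g (i + 1))) = d e := fun i => by rw [← he i, hd]
    rw [hd, hL w g (d e) hg hg0 he' (by
      conv_rhs => rw [← hee]
      rw [hd])]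
    split_ifs with h <;> simp [h]
end finite

section localLang
variable {B : ℕ}

theorem isChain_seg {α : Type*} {R : α → α → Prop} {w : ℕ → α} {a b : ℕ} :
    List.IsChain R (seg w a b) ↔ ∀ t, a ≤ t → t + 1 < b → R (w t) (w (t + 1)) := by
  rw [List.isChain_iff_getElem]
  simp only [seg, List.getElem_map, List.getElem_range', List.length_map, List.length_range',
    one_mul]
  constructor
  · intro h t h1 h2
    have := h (t - a) (by omega)
    rwa [show a + (t - a) = t by omega, show a + (t - a + 1) = t + 1 by omega] at this
  · intro h i hi
    exact h (a + i) (by omega) (by omega)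

theorem forall_mem_seg {α : Type*} {Z : α → Prop} {w : ℕ → α} {a b : ℕ} :
    (∀ x ∈ seg w a b, Z x) ↔ ∀ t, a ≤ t → t < b → Z (w t) := by
  simp only [seg, List.mem_map, List.mem_range'_1]
  constructor
  · intro h t h1 h2
    exact h _ ⟨t, by omega, rfl⟩
  · rintro h _ ⟨t, ht, rfl⟩
    exact h t ht.1 (by omega)

/-- Languages defined by an initial condition, a local condition and an eventual condition. -/
theorem Recog.exists_local (k : ℕ) (I Z : (Fin k → Fin B) → Prop)
    (T : (Fin k → Fin B) → (Fin k → Fin B) → Prop) :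
    ∃ r : Recog, r.Recognizes k fun w : ℕ → ℕ → Fin B => I (fun i => w 0 i) ∧
      (∀ t, T (fun i => w t i) fun i => w (t + 1) i) ∧ ∃ n, ∀ t, n ≤ t → Z fun i => w t i := by
  classical
  let A := Fin k → Fin B
  let S := Option A × Option A × Prop × Prop
  let ψ₀ : List A → S := fun u => (u.head?, u.getLast?, List.IsChain T u, ∀ x ∈ u, Z x)
  let ρ : (ℕ → Fin B) → A := fun a i => a i
  let m : S → S → S := fun x y =>
    (x.1, y.2.1, x.2.2.1 ∧ y.2.2.1 ∧ ∀ a ∈ x.2.1, ∀ b ∈ y.1, T a b, x.2.2.2 ∧ y.2.2.2)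
  have hm : ∀ u : List A, u ≠ [] → ∀ v : List A, v ≠ [] → ψ₀ (u ++ v) = m (ψ₀ u) (ψ₀ v) := by
    intro u hu v hv
    refine Prod.ext ?_ (Prod.ext ?_ (Prod.ext ?_ ?_))
    · exact List.head?_append_of_ne_nil _ hu
    · exact List.getLast?_append_of_ne_nil _ hv
    · exact propext List.isChain_append
    · exact propext List.forall_mem_append
  refine Recog.exists_of_finite (S := S) (fun u => ψ₀ (u.map ρ)) m (fun a b hab => ?_)
    (fun u hu v hv => ?_)
    (fun s e => (∀ x ∈ s.1, I x) ∧ (m s e).2.2.1 ∧ e.2.2.2) fun w g e hg hg0 he hee => ?_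
  · have : ρ a = ρ b := funext fun i => letterCode_injOn hab i.2
    simp only [List.map_singleton, this]
  · simp only [List.map_append]
    exact hm _ (by simpa using hu) _ (by simpa using hv)
  · simp only [map_seg] at he ⊢
    set W : ℕ → A := fun t => ρ (w t) with hW
    have hall : ∀ i, ψ₀ (seg W 0 (g (i + 1))) = m (ψ₀ (seg W 0 (g 0))) e := by
      intro i
      have hgm : ∀ i, g i < g (i + 1) := fun i => hg (Nat.lt_succ_self i)
      induction i with
      | zero =>
        rw [← seg_append W (Nat.zero_le _) (hgm 0).le, hm _ (seg_ne_nil _ hg0) _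
          (seg_ne_nil _ (hgm 0)), he]
      | succ i ih =>
        rw [← seg_append W (Nat.zero_le _) (hgm (i + 1)).le, hm _ (seg_ne_nil _
          (hg0.trans_le (hg.monotone (Nat.zero_le _)))) _
          (seg_ne_nil _ (hgm _)), he, ih]
        conv_rhs => rw [← hee]
        refine Prod.ext rfl (Prod.ext rfl (Prod.ext (propext ?_) (propext ?_)))
        · simp only [m]
          tauto
        · simp only [m]
          tauto
    have hfirst : (∀ x ∈ (ψ₀ (seg W 0 (g 0))).1, I x) ↔ I (W 0) := by
      have : seg W 0 (g 0) = W 0 :: seg W 1 (g 0) := by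
        rw [← seg_append W (Nat.zero_le 1) hg0]
        simp [seg]
      simp [ψ₀, this]
    have hchain : (m (ψ₀ (seg W 0 (g 0))) e).2.2.1 ↔ ∀ t, T (W t) (W (t + 1)) := by
      constructor
      · intro h t
        rw [← hall (t + 1)] at h
        have := isChain_seg.1 h t (Nat.zero_le _) (by have := hg.le_apply (x := t + 1 + 1); omega)
        exact this
      · intro h
        rw [← hall 0]
        exact isChain_seg.2 fun t _ _ => h t
    have hev : e.2.2.2 ↔ ∃ n, ∀ t, n ≤ t → Z (W t) := by
      constructor
      · intro h
        refine ⟨g 0, fun t ht => ?_⟩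
        have : ∃ i, g i ≤ t ∧ t < g (i + 1) := by
          have hex : ∃ i, t < g i := ⟨t + 1, hg.le_apply⟩
          obtain ⟨i, hi⟩ : ∃ i, Nat.find hex = i + 1 := by
            refine Nat.exists_eq_succ_of_ne_zero fun h0 => ?_
            have := Nat.find_spec hex
            rw [h0] at this
            omega
          refine ⟨i, not_lt.1 (Nat.find_min hex (by omega)), ?_⟩
          have := Nat.find_spec hex
          rwa [hi] at this
        obtain ⟨i, h1, h2⟩ := this
        rw [← he i] at h
        exact forall_mem_seg.1 h t h1 h2
      · rintro ⟨n, hn⟩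
        rw [← he n]
        exact forall_mem_seg.2 fun t h1 _ => hn t (hg.le_apply.trans h1)
    rw [hfirst, hchain, hev]
end localLang

end LocalLanguages

section QuadraticUnits

open Filter Topology

/-- The number `β > 1` is the larger root of `X² - tX + 1`, where `t ≥ 3`. -/
structure QuadUnit (β : ℝ) (t : ℤ) : Prop where
  three_le : 3 ≤ t
  one_lt : 1 < β
  sq_eq : β ^ 2 = t * β - 1

namespace QuadUnit
variable {β : ℝ} {t : ℤ}

theorem pos (H : QuadUnit β t) : 0 < β := one_pos.trans H.one_lt

theorem inv_eq (H : QuadUnit β t) : β⁻¹ = t - β := by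
  have := H.sq_eq
  have := H.pos
  field_simp
  linarith

theorem two_lt (H : QuadUnit β t) : 2 < β := by
  by_contra h
  have h1 : (3 : ℝ) ≤ t := by exact_mod_cast H.three_le
  have h2 := H.one_lt
  have h3 := H.sq_eq
  nlinarith

theorem inv_sq_eq (H : QuadUnit β t) : β⁻¹ ^ 2 = t * β⁻¹ - 1 := by
  have := H.sq_eq
  have := H.pos
  field_simp
  linarith

theorem inv_lt_half (H : QuadUnit β t) : β⁻¹ < 1 / 2 := by
  have := H.two_lt
  rw [inv_lt_comm₀ H.pos (by norm_num)]
  linarith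

theorem lt_t (H : QuadUnit β t) : β < t := by
  have := H.inv_eq
  have := inv_pos.2 H.pos
  linarith
end QuadUnit

/-- The value at `γ` of a linear polynomial. -/
def emb (γ : ℝ) (z : ℤ × ℤ) : ℝ := z.1 + z.2 * γ

/-- Multiplication by a root of `X² - tX + 1`. -/
def mulB (t : ℤ) (z : ℤ × ℤ) : ℤ × ℤ := (-z.2, z.1 + t * z.2)

/-- Both coordinates are bounded by `M`. -/
def InBox (M : ℤ) (z : ℤ × ℤ) : Prop := |z.1| ≤ M ∧ |z.2| ≤ M

section emb
variable {γ : ℝ} {t : ℤ}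

theorem emb_mulB (h : γ ^ 2 = t * γ - 1) (z : ℤ × ℤ) : emb γ (mulB t z) = γ * emb γ z := by
  simp only [emb, mulB]; push_cast; linear_combination -(z.2 : ℝ) * h

theorem emb_add (y z : ℤ × ℤ) : emb γ (y + z) = emb γ y + emb γ z := by
  simp [emb]; ring

theorem emb_sub (y z : ℤ × ℤ) : emb γ (y - z) = emb γ y - emb γ z := by
  simp [emb]; ring

theorem emb_neg (z : ℤ × ℤ) : emb γ (-z) = -emb γ z := by
  simp [emb]; ring

theorem emb_zero : emb γ 0 = 0 := by simp [emb]

theorem abs_emb_le {M : ℤ} {z : ℤ × ℤ} (hz : InBox M z) (hγ : 0 < γ) :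
    |emb γ z| ≤ M * (1 + γ) := by
  have h1 : |(z.1 : ℝ)| ≤ M := by exact_mod_cast hz.1
  have h2 : |(z.2 : ℝ)| ≤ M := by exact_mod_cast hz.2
  calc |emb γ z| ≤ |(z.1 : ℝ)| + |z.2 * γ| := abs_add_le _ _
    _ = |(z.1 : ℝ)| + |(z.2 : ℝ)| * γ := by rw [abs_mul, abs_of_pos hγ]
    _ ≤ M * (1 + γ) := by nlinarith
end emb

section frac
variable {β K : ℝ} {d : ℕ → ℝ}

/-- The number with the given digits after the point in base `β`. -/
noncomputable def fracSum (β : ℝ) (d : ℕ → ℝ) : ℝ := ∑' i, d i * β⁻¹ ^ (i + 1)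

theorem hasSum_geom (hβ : 1 < β) (K : ℝ) :
    HasSum (fun i : ℕ => K * β⁻¹ ^ (i + 1)) (K / (β - 1)) := by
  have h := (hasSum_geometric_of_lt_one (inv_nonneg.2 (by linarith))
    (inv_lt_one_of_one_lt₀ hβ)).mul_left (K * β⁻¹)
  have e1 : K * β⁻¹ * (1 - β⁻¹)⁻¹ = K / (β - 1) := by
    have : β - 1 ≠ 0 := by linarith
    have : β ≠ 0 := by linarith
    field_simp
  rw [e1] at h
  refine h.congr_fun fun i => ?_
  rw [pow_succ]
  ring

theorem norm_frac_le (hβ : 1 < β) (hd : ∀ i, |d i| ≤ K) (i : ℕ) :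
    ‖d i * β⁻¹ ^ (i + 1)‖ ≤ K * β⁻¹ ^ (i + 1) := by
  have : 0 < β⁻¹ ^ (i + 1) := pow_pos (inv_pos.2 (by linarith)) _
  rw [norm_mul, Real.norm_of_nonneg this.le, Real.norm_eq_abs]
  exact mul_le_mul_of_nonneg_right (hd i) this.le

theorem summable_frac (hβ : 1 < β) (hd : ∀ i, |d i| ≤ K) :
    Summable fun i => d i * β⁻¹ ^ (i + 1) :=
  Summable.of_norm_bounded (hasSum_geom hβ K).summable (norm_frac_le hβ hd)

theorem abs_fracSum_le (hβ : 1 < β) (hd : ∀ i, |d i| ≤ K) : |fracSum β d| ≤ K / (β - 1) :=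
  tsum_of_norm_bounded (hasSum_geom hβ K) (norm_frac_le hβ hd)

theorem fracSum_shift (hβ : 1 < β) (hd : ∀ i, |d i| ≤ K) :
    fracSum β (fun i => d (i + 1)) = β * fracSum β d - d 0 := by
  have hβ0 : β ≠ 0 := by linarith
  rw [fracSum, fracSum, (summable_frac hβ hd).tsum_eq_zero_add, mul_add, ← tsum_mul_left]
  have : ∀ i, β * (d (i + 1) * β⁻¹ ^ (i + 1 + 1)) = d (i + 1) * β⁻¹ ^ (i + 1) := by
    intro i
    rw [pow_succ]
    field_simp
  simp only [this]
  rw [zero_add, pow_one, mul_left_comm, mul_inv_cancel₀ hβ0]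
  ring
end frac

/-- A run of the automaton checking that a sum vanishes. -/
def IsRun (t : ℤ) (C D u v : ℕ → ℤ × ℤ) : Prop :=
  v 0 = -u 0 ∧ (∀ i, u i = C i + mulB t (u (i + 1)) ∧ v (i + 1) = mulB t (v i) - D i) ∧
    ∃ n, ∀ i, n ≤ i → u i = 0

/-- The number with integral digits `C` and fractional digits `D`. -/
noncomputable def sumVal (β : ℝ) (C D : ℕ → ℤ × ℤ) : ℝ :=
  ∑' i, emb β (C i) * β ^ i + fracSum β fun i => emb β (D i)

section run
variable {β : ℝ} {t M : ℤ} {C D u v : ℕ → ℤ × ℤ}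

theorem emb_run {γ : ℝ} (hγ : γ ^ 2 = t * γ - 1) (hu : ∀ i, u i = C i + mulB t (u (i + 1)))
    (m : ℕ) :
    emb γ (u 0) = ∑ i ∈ Finset.range m, emb γ (C i) * γ ^ i + γ ^ m * emb γ (u m) := by
  induction m with
  | zero => simp
  | succ m ih =>
    rw [ih, hu m, emb_add, emb_mulB hγ, Finset.sum_range_succ, pow_succ]
    ring

theorem emb_run_eq_tsum {γ : ℝ} (hγ : γ ^ 2 = t * γ - 1)
    (hu : ∀ i, u i = C i + mulB t (u (i + 1))) {n : ℕ} (hn : ∀ i, n ≤ i → u i = 0) :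
    (∀ i, n ≤ i → C i = 0) ∧ emb γ (u 0) = ∑' i, emb γ (C i) * γ ^ i := by
  have hC : ∀ i, n ≤ i → C i = 0 := by
    intro i hi
    have := hu i
    rw [hn i hi, hn (i + 1) (by omega)] at this
    have h0 : mulB t 0 = 0 := by simp [mulB]
    simpa [h0] using this.symm
  refine ⟨hC, ?_⟩
  rw [emb_run hγ hu n, hn n le_rfl, emb_zero, mul_zero, add_zero, tsum_eq_sum]
  intro i hi
  rw [hC i (by simpa using hi), emb_zero, zero_mul]

theorem IsRun.sumVal_eq_zero (H : QuadUnit β t) (h : IsRun t C D u v) (hD : ∀ i, InBox M (D i))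
    {M' : ℤ} (hv : ∀ i, InBox M' (v i)) :
    (∃ n, ∀ i, n ≤ i → C i = 0) ∧ sumVal β C D = 0 := by
  obtain ⟨h0, hs, n, hn⟩ := h
  obtain ⟨hC, hCs⟩ := emb_run_eq_tsum H.sq_eq (fun i => (hs i).1) hn
  refine ⟨⟨n, hC⟩, ?_⟩
  have hβ := H.pos
  have hpart : ∀ m, ∑ i ∈ Finset.range m, emb β (D i) * β⁻¹ ^ (i + 1) =
      emb β (v 0) - β⁻¹ ^ m * emb β (v m) := by
    intro m
    induction m with
    | zero => simp
    | succ m ih =>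
      rw [Finset.sum_range_succ, ih, (hs m).2, emb_sub, emb_mulB H.sq_eq, pow_succ]
      field_simp
      ring
  have hlim : Tendsto (fun m => β⁻¹ ^ m * emb β (v m)) atTop (𝓝 0) := by
    refine squeeze_zero_norm (a := fun m => β⁻¹ ^ m * (M' * (1 + β))) (fun m => ?_) ?_
    · rw [norm_mul, norm_pow, Real.norm_of_nonneg (inv_pos.2 hβ).le, Real.norm_eq_abs]
      exact mul_le_mul_of_nonneg_left (abs_emb_le (hv m) hβ) (pow_nonneg (inv_pos.2 hβ).le _)
    · have := (tendsto_pow_atTop_nhds_zero_of_lt_one (inv_pos.2 hβ).le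
        (inv_lt_one_of_one_lt₀ H.one_lt)).mul_const (M' * (1 + β))
      simpa using this
  have h2 : Tendsto (fun m => ∑ i ∈ Finset.range m, emb β (D i) * β⁻¹ ^ (i + 1)) atTop
      (𝓝 (emb β (v 0))) := by
    simp only [hpart]
    simpa using hlim.const_sub (emb β (v 0))
  have h3 := (summable_frac H.one_lt fun i => abs_emb_le (hD i) hβ).hasSum.tendsto_sum_nat
  rw [sumVal, ← hCs, fracSum, tendsto_nhds_unique h3 h2, h0, emb_neg]
  ring

theorem inBox_of_abs_emb_le (H : QuadUnit β t) {R : ℝ} {M' : ℤ} (hM : 2 * R ≤ M') {z : ℤ × ℤ}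
    (h1 : |emb β z| ≤ R) (h2 : |emb β⁻¹ z| ≤ R) : InBox M' z := by
  have hβ := H.two_lt
  have hβ' := H.inv_lt_half
  have hβ'' := inv_pos.2 H.pos
  have hq : |(z.2 : ℝ)| ≤ 2 * R := by
    have h3 : |emb β z - emb β⁻¹ z| ≤ R + R := (abs_sub _ _).trans (add_le_add h1 h2)
    have h4 : emb β z - emb β⁻¹ z = z.2 * (β - β⁻¹) := by simp only [emb]; ring
    rw [h4, abs_mul, abs_of_pos (show 0 < β - β⁻¹ by linarith)] at h3
    have := abs_nonneg (z.2 : ℝ)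
    nlinarith
  have hp : |(z.1 : ℝ)| ≤ 2 * R := by
    have h4 : (z.1 : ℝ) = emb β⁻¹ z - z.2 * β⁻¹ := by simp only [emb]; ring
    rw [h4]
    refine (abs_sub _ _).trans ?_
    rw [abs_mul, abs_of_pos hβ'']
    have := abs_nonneg (z.2 : ℝ)
    nlinarith
  constructor
  · have := hp.trans hM; exact_mod_cast this
  · have := hq.trans hM; exact_mod_cast this

theorem exists_isRun (H : QuadUnit β t) (hM : 0 ≤ M) (hCM : ∀ i, InBox M (C i))
    (hDM : ∀ i, InBox M (D i)) (hC : ∃ n, ∀ i, n ≤ i → C i = 0) (hs : sumVal β C D = 0)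
    {M' : ℤ} (hM' : 2 * (2 * M * β / (β - 1)) ≤ M') :
    ∃ u v, IsRun t C D u v ∧ (∀ i, InBox M' (u i)) ∧ ∀ i, InBox M' (v i) := by
  obtain ⟨n, hn⟩ := hC
  have hβ := H.pos
  have hβ1 := H.one_lt
  set R : ℝ := 2 * M * β / (β - 1) with hR
  have hM0 : (0 : ℝ) ≤ M := by exact_mod_cast hM
  have hRβ : 2 * M * β = R * (β - 1) := by
    rw [hR, div_mul_cancel₀]; linarith
  have hR0 : 0 ≤ R := div_nonneg (by positivity) (by linarith)
  have hRM : 2 * (M : ℝ) = R * (1 - β⁻¹) := by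
    field_simp
    linarith
  have hb1 : ∀ z, InBox M z → |emb β z| ≤ R * (β - 1) := fun z hz =>
    (abs_emb_le hz hβ).trans (by nlinarith)
  have hb2 : ∀ z, InBox M z → |emb β⁻¹ z| ≤ R * (1 - β⁻¹) := fun z hz =>
    (abs_emb_le hz (inv_pos.2 hβ)).trans (by have := H.inv_lt_half; nlinarith)
  have hi0 := inv_pos.2 hβ
  let U : ℕ → ℤ × ℤ := fun k => Nat.rec 0 (fun k x => C (n - 1 - k) + mulB t x) k
  have hU : ∀ k, U (k + 1) = C (n - 1 - k) + mulB t (U k) := fun k => rfl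
  let u : ℕ → ℤ × ℤ := fun i => U (n - i)
  have hu0 : ∀ i, n ≤ i → u i = 0 := fun i hi => by
    simp only [u, Nat.sub_eq_zero_of_le hi]; rfl
  have hu : ∀ i, u i = C i + mulB t (u (i + 1)) := by
    intro i
    rcases Nat.lt_or_ge i n with h | h
    · simp only [u]
      rw [show n - i = n - (i + 1) + 1 by omega, hU]
      congr 2
      omega
    · rw [hu0 i h, hu0 _ (by omega), hn i h]
      simp [mulB]
      rfl
  have hu' : ∀ i, |emb β⁻¹ (u i)| ≤ R := by
    intro i
    simp only [u]
    generalize n - i = k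
    induction k with
    | zero => change |emb β⁻¹ 0| ≤ R; simpa [emb_zero] using hR0
    | succ k ih =>
      rw [hU, emb_add, emb_mulB H.inv_sq_eq]
      refine (abs_add_le _ _).trans ?_
      rw [abs_mul, abs_of_pos hi0]
      have := hb2 _ (hCM (n - 1 - k))
      nlinarith
  obtain ⟨-, hCs⟩ := emb_run_eq_tsum H.sq_eq hu hu0
  have hDb : ∀ i, |emb β (D i)| ≤ R * (β - 1) := fun i => hb1 _ (hDM i)
  have hfr : ∀ m, |fracSum β fun i => emb β (D (i + m))| ≤ R := by
    intro m
    have := abs_fracSum_le (d := fun i => emb β (D (i + m))) hβ1 fun i => hDb _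
    rwa [mul_div_cancel_right₀ _ (by linarith)] at this
  have hsum : emb β (u 0) = - fracSum β fun i => emb β (D i) := by
    rw [sumVal, ← hCs] at hs
    linarith
  have hur : ∀ i, |emb β (u i)| ≤ R := by
    intro i
    induction i with
    | zero => rw [hsum, abs_neg]; exact hfr 0
    | succ i ih =>
      have h1 : β * emb β (u (i + 1)) = emb β (u i) - emb β (C i) := by
        rw [hu i, emb_add, emb_mulB H.sq_eq]; ring
      have h2 : β * |emb β (u (i + 1))| ≤ R + R * (β - 1) := by
        rw [← abs_of_pos hβ, ← abs_mul, abs_of_pos hβ, h1]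
        exact (abs_sub _ _).trans (add_le_add ih (hb1 _ (hCM i)))
      nlinarith
  let v : ℕ → ℤ × ℤ := fun i => Nat.rec (-u 0) (fun i x => mulB t x - D i) i
  have hv : ∀ i, v (i + 1) = mulB t (v i) - D i := fun i => rfl
  have hvr : ∀ i, emb β (v i) = fracSum β fun j => emb β (D (j + i)) := by
    intro i
    induction i with
    | zero =>
      change emb β (-u 0) = _
      rw [emb_neg, hsum, neg_neg]
      rfl
    | succ i ih =>
      rw [hv, emb_sub, emb_mulB H.sq_eq, ih]
      have := fracSum_shift (d := fun j => emb β (D (j + i))) hβ1 fun j => hDb _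
      simp only [zero_add] at this
      rw [← this]
      congr 1
      ext j
      rw [add_right_comm, add_assoc]
  have hv' : ∀ i, |emb β⁻¹ (v i)| ≤ R := by
    intro i
    induction i with
    | zero =>
      change |emb β⁻¹ (-u 0)| ≤ R
      rw [emb_neg, abs_neg]
      exact hu' 0
    | succ i ih =>
      rw [hv, emb_sub, emb_mulB H.inv_sq_eq]
      refine (abs_sub _ _).trans ?_
      rw [abs_mul, abs_of_pos hi0]
      have := hb2 _ (hDM i)
      nlinarith
  exact ⟨u, v, ⟨rfl, fun i => ⟨hu i, hv i⟩, n, hu0⟩,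
    fun i => inBox_of_abs_emb_le H hM' (hur i) (hu' i),
    fun i => inBox_of_abs_emb_le H hM' (by rw [hvr]; exact hfr i) (hv' i)⟩
end run

end QuadraticUnits

section Expansions

open Filter Topology

section chips
variable {t : ℤ}

theorem exists_chip_firing {T : ℕ} (hT : 3 ≤ T) (m : ℕ) : ∀ f : ℤ →₀ ℕ, f.degree = m →
    ∃ g : ℤ →₀ ℕ, (∀ i, g i < T) ∧ ∀ γ : ℝ, γ ^ 2 = T * γ - 1 →
      g.sum (fun i n => (n : ℝ) * γ ^ i) = f.sum (fun i n => (n : ℝ) * γ ^ i) := by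
  induction m using Nat.strong_induction_on with
  | _ m ih =>
    intro f hf
    by_cases h : ∀ i, f i < T
    · exact ⟨f, h, fun _ _ => rfl⟩
    push Not at h
    obtain ⟨i, hi⟩ := h
    obtain ⟨g, rfl⟩ : ∃ g, f = g + Finsupp.single i T := by
      refine ⟨f - Finsupp.single i T, (tsub_add_cancel_of_le ?_).symm⟩
      rwa [Finsupp.single_le_iff]
    set f' := g + Finsupp.single (i + 1) 1 + Finsupp.single (i - 1) 1 with hf'
    have hdeg : f'.degree < m := by
      rw [← hf, hf']
      simp only [map_add, Finsupp.degree_single]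
      omega
    obtain ⟨g', hg', hγ⟩ := ih _ hdeg f' rfl
    refine ⟨g', hg', fun γ h => ?_⟩
    have hγ0 : γ ≠ 0 := by
      rintro rfl
      norm_num at h
    have hz : ∀ i : ℤ, ((0 : ℕ) : ℝ) * γ ^ i = 0 := by simp
    have ha : ∀ (i : ℤ) (a b : ℕ), ((a + b : ℕ) : ℝ) * γ ^ i = a * γ ^ i + b * γ ^ i := by
      intro i a b; push_cast; ring
    rw [hγ γ h, hf', Finsupp.sum_add_index' hz ha, Finsupp.sum_add_index' hz ha,
      Finsupp.sum_add_index' hz ha, Finsupp.sum_single_index (hz _), Finsupp.sum_single_index (hz _),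
      Finsupp.sum_single_index (hz _), zpow_add_one₀ hγ0, zpow_sub_one₀ hγ0]
    field_simp
    push_cast
    linear_combination γ ^ i * h

/-- Natural numbers have finite expansions which are valid for both roots of `X² - tX + 1`. -/
theorem exists_digits_natCast (ht : 3 ≤ t) (n : ℕ) : ∃ a b : ℕ → ℤ,
    (∀ i, 0 ≤ a i ∧ a i < t) ∧ (∀ i, 0 ≤ b i ∧ b i < t) ∧ (∀ᶠ i in atTop, a i = 0) ∧
    (∀ᶠ i in atTop, b i = 0) ∧ ∀ γ : ℝ, γ ^ 2 = t * γ - 1 →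
      ∑' i, (a i : ℝ) * γ ^ i + ∑' i, (b i : ℝ) * γ⁻¹ ^ (i + 1) = n := by
  obtain ⟨T, rfl⟩ := Int.eq_ofNat_of_zero_le (show 0 ≤ t by omega)
  obtain ⟨g, hg, hγ⟩ := exists_chip_firing (T := T) (by omega) _ (Finsupp.single 0 n) rfl
  have hev : ∀ φ : ℕ → ℤ, φ.Injective → ∀ᶠ i in atTop, g (φ i) = 0 := by
    intro φ hφ
    have : {i | ¬ g (φ i) = 0}.Finite :=
      (g.hasFiniteSupport.preimage hφ.injOn).subset fun i hi => hi
    have := this.eventually_cofinite_notMem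
    rw [Nat.cofinite_eq_atTop] at this
    filter_upwards [this] with i hi
    simpa using hi
  refine ⟨fun i => g i, fun i => g (-(i + 1 : ℤ)), fun i => ⟨by positivity, Int.ofNat_lt.2 (hg _)⟩,
    fun i => ⟨by positivity, Int.ofNat_lt.2 (hg _)⟩, ?_, ?_, fun γ h => ?_⟩
  · filter_upwards [hev (fun i => i) Nat.cast_injective] with i hi
    exact congrArg Nat.cast hi
  · filter_upwards [hev (fun i => -(i + 1 : ℤ)) (fun i j hij => by simpa using hij)] with i hi
    exact congrArg Nat.cast hi
  · have hγ0 : γ ≠ 0 := by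
      rintro rfl
      norm_num at h
    have h1 := hγ γ (by simpa using h)
    rw [Finsupp.sum_single_index (by simp), zpow_zero, mul_one] at h1
    rw [← h1]
    have hs : ∀ i ∉ g.support, ((g i : ℝ) * γ ^ i) = 0 := fun i hi => by
      rw [Finsupp.notMem_support_iff.1 hi]; simp
    have hS : Summable fun i : ℤ => (g i : ℝ) * γ ^ i := summable_of_ne_finset_zero (s := g.support) hs
    have e : ∑' i : ℤ, (g i : ℝ) * γ ^ i = ∑ i ∈ g.support, (g i : ℝ) * γ ^ i := tsum_eq_sum hs
    rw [Finsupp.sum, ← e, tsum_of_nat_of_neg_add_one]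
    · congr 1
      refine tsum_congr fun i => ?_
      rw [zpow_neg, ← inv_zpow]
      norm_cast
    · exact hS.comp_injective Nat.cast_injective
    · exact hS.comp_injective (i := fun n : ℕ => -(n + 1 : ℤ)) fun i j hij => by simpa using hij
end chips

section digits
variable {β : ℝ} {t : ℤ}

theorem exists_digits_fract (H : QuadUnit β t) {x : ℝ} (h0 : 0 ≤ x) (h1 : x < 1) :
    ∃ b : ℕ → ℤ, (∀ i, 0 ≤ b i ∧ b i < t) ∧ fracSum β (fun i => b i) = x := by
  have hβ := H.pos
  let r : ℕ → ℝ := fun n => Nat.rec x (fun _ y => Int.fract (β * y)) n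
  have hr : ∀ n, 0 ≤ r n ∧ r n < 1 := by
    intro n
    cases n with
    | zero => exact ⟨h0, h1⟩
    | succ n => exact ⟨Int.fract_nonneg _, Int.fract_lt_one _⟩
  have hrs : ∀ n, r (n + 1) = β * r n - ⌊β * r n⌋ := fun n => rfl
  have hb : ∀ i, 0 ≤ ⌊β * r i⌋ ∧ ⌊β * r i⌋ < t := by
    intro i
    obtain ⟨h2, h3⟩ := hr i
    refine ⟨Int.floor_nonneg.2 (by positivity), Int.floor_lt.2 ?_⟩
    have := H.lt_t
    nlinarith
  refine ⟨fun i => ⌊β * r i⌋, hb, ?_⟩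
  have hpart : ∀ m, ∑ i ∈ Finset.range m, (⌊β * r i⌋ : ℝ) * β⁻¹ ^ (i + 1) =
      x - β⁻¹ ^ m * r m := by
    intro m
    induction m with
    | zero => simp [r]
    | succ m ih =>
      rw [Finset.sum_range_succ, ih, hrs, pow_succ]
      field_simp
      ring
  have hlim : Tendsto (fun m => β⁻¹ ^ m * r m) atTop (𝓝 0) := by
    refine squeeze_zero (fun m => mul_nonneg (pow_nonneg (inv_pos.2 hβ).le _) (hr m).1)
      (fun m => mul_le_of_le_one_right (pow_nonneg (inv_pos.2 hβ).le _) (hr m).2.le)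
      (tendsto_pow_atTop_nhds_zero_of_lt_one (inv_pos.2 hβ).le (inv_lt_one_of_one_lt₀ H.one_lt))
  have h2 : Tendsto (fun m => ∑ i ∈ Finset.range m, (⌊β * r i⌋ : ℝ) * β⁻¹ ^ (i + 1)) atTop
      (𝓝 x) := by
    simp only [hpart]
    simpa using hlim.const_sub x
  have h3 := (summable_frac (d := fun i => (⌊β * r i⌋ : ℝ)) (K := t) H.one_lt fun i => by
    rw [abs_of_nonneg (by exact_mod_cast (hb i).1)]
    exact_mod_cast (hb i).2.le).hasSum.tendsto_sum_nat
  exact tendsto_nhds_unique h3 h2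

theorem exists_digits_of_nonneg (H : QuadUnit β t) {x : ℝ} (h0 : 0 ≤ x) : ∃ a b : ℕ → ℤ,
    (∀ i, 0 ≤ a i ∧ a i ≤ 2 * t) ∧ (∀ i, 0 ≤ b i ∧ b i ≤ 2 * t) ∧ (∀ᶠ i in atTop, a i = 0) ∧
    ∑' i, (a i : ℝ) * β ^ i + fracSum β (fun i => b i) = x := by
  obtain ⟨a, b, ha, hb, ha0, -, hn⟩ := exists_digits_natCast H.three_le ⌊x⌋₊
  obtain ⟨c, hc, hx⟩ := exists_digits_fract H (x := x - ⌊x⌋₊)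
    (sub_nonneg.2 (Nat.floor_le h0)) (by have := Nat.lt_floor_add_one x; linarith)
  have ht := H.three_le
  refine ⟨a, fun i => b i + c i, fun i => ⟨(ha i).1, by have := (ha i).2; omega⟩,
    fun i => ⟨add_nonneg (hb i).1 (hc i).1,
      by have := (hb i).2; have := (hc i).2; dsimp only; omega⟩, ha0, ?_⟩
  have key : ∀ b : ℕ → ℤ, (∀ i, 0 ≤ b i ∧ b i < t) →
      Summable fun i => (b i : ℝ) * β⁻¹ ^ (i + 1) := fun b hb =>
    summable_frac (K := t) H.one_lt fun i => by
      rw [abs_of_nonneg (by exact_mod_cast (hb i).1)]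
      exact_mod_cast (hb i).2.le
  have h1 := hn β H.sq_eq
  rw [fracSum] at hx ⊢
  push_cast
  simp only [add_mul]
  rw [(key b hb).tsum_add (key c hc), hx]
  linarith

theorem exists_digits (H : QuadUnit β t) (x : ℝ) : ∃ a b : ℕ → ℤ,
    (∀ i, |a i| ≤ 2 * t) ∧ (∀ i, |b i| ≤ 2 * t) ∧ (∀ᶠ i in atTop, a i = 0) ∧
    ∑' i, (a i : ℝ) * β ^ i + fracSum β (fun i => b i) = x := by
  rcases le_total 0 x with h | h
  · obtain ⟨a, b, ha, hb, ha0, hx⟩ := exists_digits_of_nonneg H h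
    exact ⟨a, b, fun i => by rw [abs_of_nonneg (ha i).1]; exact (ha i).2,
      fun i => by rw [abs_of_nonneg (hb i).1]; exact (hb i).2, ha0, hx⟩
  · obtain ⟨a, b, ha, hb, ha0, hx⟩ := exists_digits_of_nonneg H (neg_nonneg.2 h)
    refine ⟨fun i => -a i, fun i => -b i,
      fun i => by rw [abs_neg, abs_of_nonneg (ha i).1]; exact (ha i).2,
      fun i => by rw [abs_neg, abs_of_nonneg (hb i).1]; exact (hb i).2,
      ha0.mono fun i hi => by simp [hi], ?_⟩
    rw [fracSum] at hx ⊢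
    push_cast
    simp only [neg_mul, tsum_neg]
    linarith
end digits

end Expansions

section CodedReals

open Filter Topology

/-- A coding of digit pairs and of automaton states by the letters of a finite alphabet. -/
structure Coding (t M : ℤ) (B : ℕ) where
  /-- The pair consisting of an integral and a fractional digit coded by a letter. -/
  dig : Fin B → ℤ × ℤ
  /-- The pair of states coded by a letter. -/
  st : Fin B → (ℤ × ℤ) × (ℤ × ℤ)
  inBox_dig : ∀ σ, InBox (2 * t) (dig σ)
  exists_dig : ∀ z, InBox (2 * t) z → ∃ σ, dig σ = z
  inBox_st : ∀ σ, InBox M (st σ).2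
  exists_st : ∀ y z, InBox M y → InBox M z → ∃ σ, st σ = (y, z)

theorem finite_inBox (M : ℤ) : Finite {z // InBox M z} :=
  ((Set.finite_Icc (-M) M).prod (Set.finite_Icc (-M) M)).subset fun _ hz =>
    ⟨abs_le.1 hz.1, abs_le.1 hz.2⟩

theorem exists_coding {t M : ℤ} (ht : 0 ≤ t) (hM : 0 ≤ M) : ∃ B, Nonempty (Coding t M B) := by
  have := finite_inBox (2 * t)
  have := finite_inBox M
  let A := {z // InBox (2 * t) z} × {z // InBox M z} × {z // InBox M z}
  have z1 : InBox (2 * t) 0 := ⟨by simpa using ht, by simpa using ht⟩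
  have z2 : InBox M 0 := ⟨by simpa using hM, by simpa using hM⟩
  let e : A ≃ Fin (Nat.card A) := Finite.equivFin A
  exact ⟨Nat.card A, ⟨{
    dig := fun σ => (e.symm σ).1
    st := fun σ => ((e.symm σ).2.1, (e.symm σ).2.2)
    inBox_dig := fun σ => (e.symm σ).1.2
    exists_dig := fun z hz => ⟨e (⟨z, hz⟩, ⟨0, z2⟩, ⟨0, z2⟩), by simp⟩
    inBox_st := fun σ => (e.symm σ).2.2.2
    exists_st := fun y z hy hz => ⟨e (⟨0, z1⟩, ⟨y, hy⟩, ⟨z, hz⟩), by simp⟩ }⟩⟩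

namespace Coding
variable {β : ℝ} {t M : ℤ} {B : ℕ} (c : Coding t M B)

/-- The word `X` codes a real number: its integral part is finite. -/
def Valid (X : ℕ → Fin B) : Prop := ∀ᶠ i in atTop, (c.dig (X i)).1 = 0

/-- The real number coded by a word. -/
noncomputable def val (β : ℝ) (X : ℕ → Fin B) : ℝ :=
  ∑' i, ((c.dig (X i)).1 : ℝ) * β ^ i + fracSum β fun i => (c.dig (X i)).2

theorem exists_word {a b : ℕ → ℤ} (ha : ∀ i, |a i| ≤ 2 * t) (hb : ∀ i, |b i| ≤ 2 * t) :
    ∃ X : ℕ → Fin B, ∀ i, c.dig (X i) = (a i, b i) := by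
  choose X hX using fun i => c.exists_dig (a i, b i) ⟨ha i, hb i⟩
  exact ⟨X, hX⟩

theorem exists_val_eq (H : QuadUnit β t) (x : ℝ) : ∃ X, c.Valid X ∧ c.val β X = x := by
  obtain ⟨a, b, ha, hb, ha0, hx⟩ := exists_digits H x
  obtain ⟨X, hX⟩ := c.exists_word ha hb
  refine ⟨X, ha0.mono fun i hi => by rw [hX, hi], ?_⟩
  simp only [val, hX]
  exact hx

/-- The language of all words satisfying a linear equation given by integral and fractional
coefficient maps. -/
theorem exists_recog_sumVal (c : Coding t M B) (H : QuadUnit β t) (hM : 2 * (2 * (6 * t : ℤ) * β / (β - 1)) ≤ M)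
    {k : ℕ} (C D : (Fin k → Fin B) → ℤ × ℤ) (hC : ∀ a, InBox (6 * t) (C a))
    (hD : ∀ a, InBox (6 * t) (D a)) :
    ∃ r : Recog, r.Recognizes k fun w : ℕ → ℕ → Fin B =>
      (∃ n, ∀ i, n ≤ i → C (fun j => w i j) = 0) ∧
        sumVal β (fun i => C fun j => w i j) (fun i => D fun j => w i j) = 0 := by
  have ht : 0 ≤ 6 * t := by have := H.three_le; omega
  let low : (Fin (k + 1) → Fin B) → Fin k → Fin B := fun a i => a i.castSucc
  let u : (Fin (k + 1) → Fin B) → ℤ × ℤ := fun a => (c.st (a (Fin.last k))).1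
  let v : (Fin (k + 1) → Fin B) → ℤ × ℤ := fun a => (c.st (a (Fin.last k))).2
  obtain ⟨r, hr⟩ := Recog.exists_local (B := B) (k + 1) (fun a => v a = -u a) (fun a => u a = 0)
    (fun a b => u a = C (low a) + mulB t (u b) ∧ v b = mulB t (v a) - D (low a))
  refine ⟨_, hr.ex.congr fun w => ?_⟩
  have hlow : ∀ (x : ℕ → Fin B) i, (low fun j : Fin (k + 1) => Function.update (w i) k (x i) j) =
      fun j : Fin k => w i j := fun x i => funext fun j => by
    simp only [low, Fin.val_castSucc]
    rw [Function.update_of_ne (Nat.ne_of_lt j.2)]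
  have hlast : ∀ (x : ℕ → Fin B) i, Function.update (w i) k (x i) (Fin.last k : ℕ) = x i :=
    fun x i => by simp
  simp only [hlow, u, v, hlast]
  constructor
  · rintro ⟨h1, h2⟩
    obtain ⟨u, v, hrun, hu, hv⟩ := exists_isRun H ht (fun i => hC fun j => w i j)
      (fun i => hD fun j => w i j) h1 h2 hM
    choose x hx using fun i => c.exists_st (u i) (v i) (hu i) (hv i)
    refine ⟨x, ?_⟩
    simp only [hx]
    exact hrun
  · rintro ⟨x, hx⟩
    exact IsRun.sumVal_eq_zero (u := fun i => (c.st (x i)).1) (v := fun i => (c.st (x i)).2) H hx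
      (fun i => hD _) fun i => c.inBox_st _

theorem val_hasSum (H : QuadUnit β t) {X : ℕ → Fin B} (hX : c.Valid X) :
    Summable (fun i => ((c.dig (X i)).1 : ℝ) * β ^ i) ∧
      Summable fun i => ((c.dig (X i)).2 : ℝ) * β⁻¹ ^ (i + 1) := by
  constructor
  · obtain ⟨n, hn⟩ := eventually_atTop.1 hX
    refine summable_of_ne_finset_zero (s := Finset.range n) fun i hi => ?_
    rw [hn i (by simpa using hi)]
    simp
  · exact summable_frac (K := (2 * t : ℤ)) H.one_lt fun i => by
      exact_mod_cast (c.inBox_dig (X i)).2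

/-- The recogniser `r` defines the relation `P` on the real numbers coded by the first `k`
tracks. -/
def Defines (β : ℝ) (k : ℕ) (r : Recog) (P : (ℕ → ℝ) → Prop) : Prop :=
  ∃ L : (ℕ → ℕ → Fin B) → Prop, r.Recognizes k L ∧ ∀ w, (∀ i < k, c.Valid fun t => w t i) →
    (L w ↔ P fun i => c.val β fun t => w t i)

theorem emb_sum {ι : Type*} (s : Finset ι) (f : ι → ℤ × ℤ) :
    emb β (∑ i ∈ s, f i) = ∑ i ∈ s, emb β (f i) := by
  classical
  induction s using Finset.induction_on with
  | empty => simp [emb_zero]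
  | insert a s ha ih => rw [Finset.sum_insert ha, Finset.sum_insert ha, emb_add, ih]

theorem inBox_sum (ht : 0 ≤ 2 * t) {k : ℕ} (hk : k ≤ 3) {m : Fin k → ℤ} (hm : ∀ j, |m j| ≤ 2 * t)
    {γ : Fin k → ℤ × ℤ} (hγ : ∀ j, InBox 1 (γ j)) : InBox (6 * t) (∑ j, m j • γ j) := by
  have key : ∀ δ : Fin k → ℤ, (∀ j, |δ j| ≤ 1) → |∑ j, m j * δ j| ≤ 6 * t := by
    intro δ hδ
    calc |∑ j, m j * δ j| ≤ ∑ j, |m j * δ j| := Finset.abs_sum_le_sum_abs _ _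
      _ ≤ ∑ _j : Fin k, 2 * t := Finset.sum_le_sum fun j _ => by
        rw [abs_mul]
        calc |m j| * |δ j| ≤ 2 * t * 1 := mul_le_mul (hm j) (hδ j) (abs_nonneg _) ht
          _ = 2 * t := mul_one _
      _ = k * (2 * t) := by simp
      _ ≤ 3 * (2 * t) := mul_le_mul_of_nonneg_right (by exact_mod_cast hk) ht
      _ = 6 * t := by ring
  constructor
  · simpa [Prod.fst_sum] using key (fun j => (γ j).1) fun j => (hγ j).1
  · simpa [Prod.snd_sum] using key (fun j => (γ j).2) fun j => (hγ j).2

theorem exists_linear (H : QuadUnit β t) (hM : 2 * (2 * (6 * t : ℤ) * β / (β - 1)) ≤ M)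
    {k : ℕ} (hk : k ≤ 3) {γ : Fin k → ℤ × ℤ} (hγ : ∀ j, InBox 1 (γ j)) :
    ∃ r, c.Defines β k r fun x => ∑ j, emb β (γ j) * x j = 0 := by
  have ht : 0 ≤ 2 * t := by have := H.three_le; omega
  obtain ⟨r, hr⟩ := c.exists_recog_sumVal H hM (fun a => ∑ j, (c.dig (a j)).1 • γ j)
    (fun a => ∑ j, (c.dig (a j)).2 • γ j) (fun a => inBox_sum ht hk (fun j => (c.inBox_dig _).1) hγ)
    (fun a => inBox_sum ht hk (fun j => (c.inBox_dig _).2) hγ)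
  refine ⟨r, _, hr, fun w hw => ?_⟩
  have h0 : ∃ n, ∀ i, n ≤ i → ∑ j : Fin k, (c.dig (w i j)).1 • γ j = 0 := by
    refine eventually_atTop.1 ?_
    filter_upwards [eventually_all.2 fun j : Fin k => hw j j.2] with i hi
    exact Finset.sum_eq_zero fun j _ => by rw [hi j, zero_smul]
  have hsmul : ∀ (m : ℤ) (z : ℤ × ℤ), emb β (m • z) = m * emb β z := by
    intro m z
    simp [emb]
    ring
  have key : sumVal β (fun i => ∑ j : Fin k, (c.dig (w i j)).1 • γ j)
      (fun i => ∑ j : Fin k, (c.dig (w i j)).2 • γ j) =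
      ∑ j : Fin k, emb β (γ j) * c.val β fun t => w t j := by
    simp only [sumVal, fracSum, val, emb_sum, hsmul, Finset.sum_mul, mul_add,
      Finset.sum_add_distrib]
    rw [Summable.tsum_finsetSum, Summable.tsum_finsetSum]
    · congr 1
      · refine Finset.sum_congr rfl fun j _ => ?_
        rw [← tsum_mul_left]
        exact tsum_congr fun i => by ring
      · refine Finset.sum_congr rfl fun j _ => ?_
        rw [← tsum_mul_left]
        exact tsum_congr fun i => by ring
    · intro j _
      exact ((c.val_hasSum H (hw j j.2)).2.mul_left (emb β (γ j))).congr fun i => by ring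
    · intro j _
      exact ((c.val_hasSum H (hw j j.2)).1.mul_left (emb β (γ j))).congr fun i => by ring
  exact ⟨fun h => key.symm.trans h.2, fun h => ⟨h0, key.trans h⟩⟩

end Coding

end CodedReals

section IntegerExpansions

open Filter Topology

section conj
variable {β : ℝ} {t : ℤ} {a b : ℕ → ℤ}

/-- The number with integral digits `a` and fractional digits `b` in base `γ`. -/
noncomputable def baseVal (a b : ℕ → ℤ) (γ : ℝ) : ℝ :=
  ∑' i, (a i : ℝ) * γ ^ i + ∑' i, (b i : ℝ) * γ⁻¹ ^ (i + 1)

theorem baseVal_eq_sum {n : ℕ} (ha : ∀ i, n ≤ i → a i = 0) (hb : ∀ i, n ≤ i → b i = 0) (γ : ℝ) :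
    baseVal a b γ =
      ∑ i ∈ Finset.range n, ((a i : ℝ) * γ ^ i + (b i : ℝ) * γ⁻¹ ^ (i + 1)) := by
  rw [baseVal, tsum_eq_sum (s := Finset.range n), tsum_eq_sum (s := Finset.range n),
    Finset.sum_add_distrib]
  · intro i hi
    rw [hb i (by simpa using hi)]
    simp
  · intro i hi
    rw [ha i (by simpa using hi)]
    simp

theorem sumVal_conj (hβ : β ≠ 0) {n : ℕ} (ha : ∀ i, n ≤ i → a i = 0) (hb : ∀ i, n ≤ i → b i = 0) :
    sumVal β (fun i => (a i, -b i)) (fun i => (b i, -a i)) = baseVal a b β - baseVal a b β⁻¹ := by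
  rw [baseVal_eq_sum ha hb, baseVal_eq_sum ha hb, sumVal, fracSum,
    tsum_eq_sum (s := Finset.range n), tsum_eq_sum (s := Finset.range n),
    ← Finset.sum_add_distrib, ← Finset.sum_sub_distrib]
  · refine Finset.sum_congr rfl fun i _ => ?_
    simp only [emb, inv_inv]
    push_cast
    rw [pow_succ β⁻¹, pow_succ β]
    field_simp
    ring
  · intro i hi
    rw [ha i (by simpa using hi), hb i (by simpa using hi)]
    simp [emb]
  · intro i hi
    rw [ha i (by simpa using hi), hb i (by simpa using hi)]
    simp [emb]

theorem exists_emb_pow (t : ℤ) (i : ℕ) :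
    ∃ z, ∀ γ : ℝ, γ ^ 2 = t * γ - 1 → γ ^ i = emb γ z := by
  induction i with
  | zero => exact ⟨(1, 0), fun γ _ => by simp [emb]⟩
  | succ i ih =>
    obtain ⟨z, hz⟩ := ih
    exact ⟨mulB t z, fun γ hγ => by rw [pow_succ', hz γ hγ, emb_mulB hγ]⟩

theorem exists_emb_baseVal (t : ℤ) {n : ℕ} (ha : ∀ i, n ≤ i → a i = 0)
    (hb : ∀ i, n ≤ i → b i = 0) :
    ∃ z, ∀ γ : ℝ, γ ^ 2 = t * γ - 1 → baseVal a b γ = emb γ z := by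
  choose p hp using exists_emb_pow t
  refine ⟨∑ i ∈ Finset.range n,
    (a i • p i + b i • ((p (i + 1)).1 + t * (p (i + 1)).2, -(p (i + 1)).2)), fun γ hγ => ?_⟩
  have h0 : γ ≠ 0 := by
    rintro rfl
    norm_num at hγ
  have h1 : γ⁻¹ = t - γ := by
    field_simp
    linarith
  have h2 : γ⁻¹ ^ 2 = t * γ⁻¹ - 1 := by
    rw [h1]
    linear_combination hγ
  rw [baseVal_eq_sum ha hb, Coding.emb_sum]
  refine Finset.sum_congr rfl fun i _ => ?_
  rw [hp i γ hγ, hp (i + 1) _ h2]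
  simp only [emb, h1, Prod.fst_add, Prod.snd_add, Prod.smul_fst, Prod.smul_snd, smul_eq_mul]
  push_cast
  ring

end conj

namespace Coding
variable {β : ℝ} {t M : ℤ} {B : ℕ} (c : Coding t M B) {k : ℕ} {r s : Recog}
  {P Q : (ℕ → ℝ) → Prop}

/-- The word `X` is an expansion with finitely many digits of an integer. -/
def IsIntWord (β : ℝ) (X : ℕ → Fin B) : Prop :=
  (∃ n, ∀ i, n ≤ i → ((c.dig (X i)).1, -(c.dig (X i)).2) = 0) ∧
    sumVal β (fun i => ((c.dig (X i)).1, -(c.dig (X i)).2))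
      (fun i => ((c.dig (X i)).2, -(c.dig (X i)).1)) = 0

theorem IsIntWord.exists_val_eq {c : Coding t M B} (H : QuadUnit β t) {X : ℕ → Fin B}
    (h : c.IsIntWord β X) : ∃ z : ℤ, c.val β X = z := by
  obtain ⟨⟨n, hn⟩, hs⟩ := h
  have ha : ∀ i, n ≤ i → (c.dig (X i)).1 = 0 := fun i hi => (Prod.ext_iff.1 (hn i hi)).1
  have hb : ∀ i, n ≤ i → (c.dig (X i)).2 = 0 := fun i hi => neg_eq_zero.1 (Prod.ext_iff.1 (hn i hi)).2
  rw [sumVal_conj (a := fun i => (c.dig (X i)).1) (b := fun i => (c.dig (X i)).2)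
    H.pos.ne' ha hb] at hs
  obtain ⟨z, hz⟩ := exists_emb_baseVal (a := fun i => (c.dig (X i)).1)
    (b := fun i => (c.dig (X i)).2) t ha hb
  have hval : c.val β X = emb β z := hz β H.sq_eq
  rw [hz β H.sq_eq, hz _ H.inv_sq_eq] at hs
  simp only [emb] at hs hval
  have h1 : (z.2 : ℝ) * (β - β⁻¹) = 0 := by linear_combination hs
  have h2 : β - β⁻¹ ≠ 0 := by
    have := H.two_lt
    have := H.inv_lt_half
    linarith
  refine ⟨z.1, ?_⟩
  rw [hval, (mul_eq_zero.1 h1).resolve_right h2]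
  simp

theorem exists_isIntWord (H : QuadUnit β t) (z : ℤ) :
    ∃ X, c.Valid X ∧ c.IsIntWord β X ∧ c.val β X = z := by
  have ht := H.three_le
  suffices h : ∃ a b : ℕ → ℤ, (∀ i, |a i| ≤ 2 * t) ∧ (∀ i, |b i| ≤ 2 * t) ∧
      (∀ᶠ i in atTop, a i = 0 ∧ b i = 0) ∧ ∀ γ : ℝ, γ ^ 2 = t * γ - 1 → baseVal a b γ = z by
    obtain ⟨a, b, ha, hb, h0, hv⟩ := h
    obtain ⟨X, hX⟩ := c.exists_word ha hb
    obtain ⟨n, hn⟩ := eventually_atTop.1 h0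
    have e1 : (fun i => ((c.dig (X i)).1, -(c.dig (X i)).2)) = fun i => (a i, -b i) := by
      funext i; rw [hX]
    have e2 : (fun i => ((c.dig (X i)).2, -(c.dig (X i)).1)) = fun i => (b i, -a i) := by
      funext i; rw [hX]
    refine ⟨X, h0.mono fun i hi => by rw [hX, hi.1], ⟨⟨n, fun i hi => ?_⟩, ?_⟩, ?_⟩
    · rw [hX, (hn i hi).1, (hn i hi).2]
      rfl
    · rw [e1, e2, sumVal_conj H.pos.ne' (fun i hi => (hn i hi).1) (fun i hi => (hn i hi).2),
        hv _ H.sq_eq, hv _ H.inv_sq_eq, sub_self]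
    · rw [← hv _ H.sq_eq]
      simp only [val, hX]
      rfl
  obtain ⟨n, rfl | rfl⟩ := z.eq_nat_or_neg
  · obtain ⟨a, b, ha, hb, ha0, hb0, h⟩ := exists_digits_natCast H.three_le n
    refine ⟨a, b, fun i => ?_, fun i => ?_, ha0.and hb0, h⟩
    · rw [abs_of_nonneg (ha i).1]
      linarith [(ha i).2]
    · rw [abs_of_nonneg (hb i).1]
      linarith [(hb i).2]
  · obtain ⟨a, b, ha, hb, ha0, hb0, h⟩ := exists_digits_natCast H.three_le n
    refine ⟨fun i => -a i, fun i => -b i, fun i => ?_, fun i => ?_, ?_, fun γ hγ => ?_⟩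
    · rw [abs_neg, abs_of_nonneg (ha i).1]
      linarith [(ha i).2]
    · rw [abs_neg, abs_of_nonneg (hb i).1]
      linarith [(hb i).2]
    · filter_upwards [ha0, hb0] with i h1 h2
      simp [h1, h2]
    · push_cast
      rw [← h γ hγ]
      simp only [baseVal, Int.cast_neg, neg_mul, tsum_neg]
      ring

variable {c}

theorem Defines.congr (h : c.Defines β k r P) (hP : ∀ x, Q x ↔ P x) : c.Defines β k r Q := by
  obtain ⟨L, hL, hw⟩ := h
  exact ⟨L, hL, fun w h => (hw w h).trans (hP _).symm⟩

theorem Defines.not (h : c.Defines β k r P) : c.Defines β k (Recog.notR B k r) fun x => ¬P x := by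
  obtain ⟨L, hL, hw⟩ := h
  exact ⟨_, hL.not, fun w h => not_congr (hw w h)⟩

theorem Defines.and (h₁ : c.Defines β k r P) (h₂ : c.Defines β k s Q) :
    c.Defines β k (Recog.andR B k r s) fun x => P x ∧ Q x := by
  obtain ⟨L, hL, hw⟩ := h₁
  obtain ⟨L', hL', hw'⟩ := h₂
  exact ⟨_, hL.and hL', fun w h => and_congr (hw w h) (hw' w h)⟩

theorem Defines.reindex (h : c.Defines β k r P) {k' : ℕ} {l : List ℕ}
    (hl : ∀ i < k, l.getD i 0 < k') :
    c.Defines β k' (Recog.reindexR B k k' l r) fun x => P fun i => x (l.getD i 0) := by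
  obtain ⟨L, hL, hw⟩ := h
  exact ⟨_, hL.reindex hl, fun w h => hw _ fun i hi => h _ (hl i hi)⟩

theorem update_track {α : Type*} (w : ℕ → ℕ → α) (X : ℕ → α) (k i : ℕ) :
    (fun t => Function.update (w t) k (X t) i) = Function.update (fun i t => w t i) k X i := by
  funext t
  by_cases h : i = k
  · subst h; simp
  · simp [Function.update_of_ne h]

/-- A version of projection on the level of words. -/
theorem exists_defines_ex {Z : (ℕ → Fin B) → Prop}
    (hr : r.Recognizes 1 fun w => Z fun t => w t 0) (hZ : ∀ X, Z X → c.Valid X)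
    (hs : c.Defines β (k + 1) s P) :
    c.Defines β k (Recog.exR B k (Recog.andR B (k + 1) s (Recog.reindexR B 1 (k + 1) [k] r)))
      fun x => ∃ X, Z X ∧ P (Function.update x k (c.val β X)) := by
  obtain ⟨L, hL, hw⟩ := hs
  refine ⟨_, (hL.and (hr.reindex (l := [k]) (k' := k + 1) ?_)).ex, fun w h => ?_⟩
  · intro i hi
    obtain rfl : i = 0 := by omega
    simp
  · refine exists_congr fun X => ?_
    have e : (fun t => Function.update (w t) k (X t) k) = X := by funext t; simp
    simp only [List.getD_cons_zero, e]
    rw [and_comm]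
    refine and_congr_right fun hX => ?_
    rw [hw]
    · refine iff_of_eq (congrArg P (funext fun i => ?_))
      rw [update_track]
      by_cases hi : i = k
      · subst hi; simp
      · simp [Function.update_of_ne hi]
    · intro i hi
      rw [update_track]
      by_cases hik : i = k
      · subst hik
        simpa using hZ X hX
      · rw [Function.update_of_ne hik]
        exact h i (by omega)

end Coding

end IntegerExpansions

section BasicRelations

open Filter Topology

/-- Recognisers for the basic relations on coded real numbers. -/
structure Kit {t M : ℤ} {B : ℕ} (c : Coding t M B) (β : ℝ) where
  /-- The valid words. -/
  valid : Recog
  /-- The graph of addition. -/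
  add : Recog
  /-- Equality. -/
  eq : Recog
  /-- The graph of multiplication by `β`. -/
  mul : Recog
  /-- The integers. -/
  int : Recog
  /-- The strict order. -/
  lt : Recog
  valid_spec : valid.Recognizes 1 fun w : ℕ → ℕ → Fin B => c.Valid fun t => w t 0
  add_spec : c.Defines β 3 add fun x => x 0 + x 1 = x 2
  eq_spec : c.Defines β 2 eq fun x => x 0 = x 1
  mul_spec : c.Defines β 2 mul fun x => β * x 0 = x 1
  int_spec : c.Defines β 1 int fun x => ∃ z : ℤ, x 0 = z
  lt_spec : c.Defines β 2 lt fun x => x 0 < x 1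

namespace Coding
variable {β : ℝ} {t M : ℤ} {B : ℕ} (c : Coding t M B)

theorem exists_recog_local (A : ℤ × ℤ → Prop) : ∃ r : Recog, r.Recognizes 1
    fun w : ℕ → ℕ → Fin B => (∀ i, A (c.dig (w i 0))) ∧ c.Valid fun i => w i 0 := by
  obtain ⟨r, hr⟩ := Recog.exists_local (B := B) 1 (fun _ => True)
    (fun a => (c.dig (a 0)).1 = 0) (fun a _ => A (c.dig (a 0)))
  refine ⟨r, hr.congr fun w => ?_⟩
  simp [Valid, eventually_atTop]

theorem val_nonneg (hβ : 0 < β) {X : ℕ → Fin B}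
    (h : ∀ i, 0 ≤ (c.dig (X i)).1 ∧ 0 ≤ (c.dig (X i)).2) : 0 ≤ c.val β X := by
  have h1 : ∀ i, (0 : ℝ) ≤ (c.dig (X i)).1 := fun i => by exact_mod_cast (h i).1
  have h2 : ∀ i, (0 : ℝ) ≤ (c.dig (X i)).2 := fun i => by exact_mod_cast (h i).2
  exact add_nonneg (tsum_nonneg fun i => mul_nonneg (h1 i) (by positivity))
    (tsum_nonneg fun i => mul_nonneg (h2 i) (by positivity))

theorem exists_val_eq_of_nonneg (H : QuadUnit β t) {x : ℝ} (hx : 0 ≤ x) :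
    ∃ X, ((∀ i, 0 ≤ (c.dig (X i)).1 ∧ 0 ≤ (c.dig (X i)).2) ∧ c.Valid X) ∧ c.val β X = x := by
  obtain ⟨a, b, ha, hb, ha0, hx⟩ := exists_digits_of_nonneg H hx
  obtain ⟨X, hX⟩ := c.exists_word
    (fun i => by rw [abs_of_nonneg (ha i).1]; exact (ha i).2)
    (fun i => by rw [abs_of_nonneg (hb i).1]; exact (hb i).2)
  refine ⟨X, ⟨fun i => ?_, ha0.mono fun i hi => by rw [hX, hi]⟩, ?_⟩
  · rw [hX]
    exact ⟨(ha i).1, (hb i).1⟩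
  · simp only [val, hX]
    exact hx

theorem exists_recog_int (H : QuadUnit β t) (hM : 2 * (2 * (6 * t : ℤ) * β / (β - 1)) ≤ M) :
    ∃ r : Recog, r.Recognizes 1 fun w : ℕ → ℕ → Fin B => c.IsIntWord β fun i => w i 0 := by
  have ht := H.three_le
  have hd : ∀ σ, |(c.dig σ).1| ≤ 6 * t ∧ |(c.dig σ).2| ≤ 6 * t := fun σ =>
    ⟨(c.inBox_dig σ).1.trans (by omega), (c.inBox_dig σ).2.trans (by omega)⟩
  obtain ⟨r, hr⟩ := c.exists_recog_sumVal H hM (k := 1)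
    (fun a => ((c.dig (a 0)).1, -(c.dig (a 0)).2)) (fun a => ((c.dig (a 0)).2, -(c.dig (a 0)).1))
    (fun a => ⟨(hd _).1, by simpa using (hd _).2⟩) (fun a => ⟨(hd _).2, by simpa using (hd _).1⟩)
  exact ⟨r, hr.congr fun w => Iff.rfl⟩

end Coding

theorem exists_kit {β : ℝ} {t : ℤ} (H : QuadUnit β t) :
    ∃ (M : ℤ) (B : ℕ) (c : Coding t M B), Nonempty (Kit c β) := by
  have ht := H.three_le
  obtain ⟨M, hM⟩ := exists_int_ge (max 0 (2 * (2 * (6 * t : ℤ) * β / (β - 1))))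
  have hM0 : 0 ≤ M := by exact_mod_cast (le_max_left _ _).trans hM
  replace hM := (le_max_right _ _).trans hM
  obtain ⟨B, ⟨c⟩⟩ := exists_coding (t := t) (M := M) (by omega) hM0
  refine ⟨M, B, c, ?_⟩
  obtain ⟨valid, hvalid⟩ := c.exists_recog_local fun _ => True
  obtain ⟨nn, hnn⟩ := c.exists_recog_local fun z => 0 ≤ z.1 ∧ 0 ≤ z.2
  obtain ⟨add, hadd⟩ := c.exists_linear H hM (k := 3) le_rfl (γ := ![(1, 0), (1, 0), (-1, 0)])
    (by intro j; fin_cases j <;> simp [InBox])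
  obtain ⟨eq, heq⟩ := c.exists_linear H hM (k := 2) (by norm_num) (γ := ![(1, 0), (-1, 0)])
    (by intro j; fin_cases j <;> simp [InBox])
  obtain ⟨mul, hmul⟩ := c.exists_linear H hM (k := 2) (by norm_num) (γ := ![(0, 1), (-1, 0)])
    (by intro j; fin_cases j <;> simp [InBox])
  obtain ⟨iw, hiw⟩ := c.exists_recog_int H hM
  have hadd' : c.Defines β 3 add fun x => x 0 + x 1 = x 2 := hadd.congr fun x => by
    rw [Fin.sum_univ_three]
    simp [emb, add_neg_eq_zero]
  have heq' : c.Defines β 2 eq fun x => x 0 = x 1 := heq.congr fun x => by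
    rw [Fin.sum_univ_two]
    simp [emb, add_neg_eq_zero]
  have hmul' : c.Defines β 2 mul fun x => β * x 0 = x 1 := hmul.congr fun x => by
    rw [Fin.sum_univ_two]
    simp [emb, add_neg_eq_zero]
  have hZ := Coding.exists_defines_ex (k := 1) hiw (fun X hX => by
    obtain ⟨n, hn⟩ := hX.1
    exact eventually_atTop.2 ⟨n, fun i hi => (Prod.ext_iff.1 (hn i hi)).1⟩) heq'
  have hle := Coding.exists_defines_ex (k := 2)
    (Z := fun X => (∀ i, 0 ≤ (c.dig (X i)).1 ∧ 0 ≤ (c.dig (X i)).2) ∧ c.Valid X) hnn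
    (fun X hX => hX.2) (hadd'.reindex (k' := 3) (l := [0, 2, 1])
    (by intro i hi; interval_cases i <;> simp))
  have hlt := (hle.reindex (k' := 2) (l := [1, 0])
    (by intro i hi; interval_cases i <;> simp)).not
  refine ⟨{
    valid := valid
    add := add
    eq := eq
    mul := mul
    int := _
    lt := _
    valid_spec := hvalid.congr fun w => by simp
    add_spec := hadd'
    eq_spec := heq'
    mul_spec := hmul'
    int_spec := hZ.congr fun x => ?_
    lt_spec := hlt.congr fun x => ?_ }⟩
  · constructor
    · rintro ⟨z, hz⟩
      obtain ⟨X, -, hX, hv⟩ := c.exists_isIntWord H z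
      exact ⟨X, hX, by simp [hz, hv]⟩
    · rintro ⟨X, hX, hv⟩
      obtain ⟨z, hz⟩ := hX.exists_val_eq H
      exact ⟨z, by simpa [hz] using hv⟩
  · rw [← not_le, not_iff_not]
    constructor
    · intro h
      obtain ⟨X, hX, hv⟩ := c.exists_val_eq_of_nonneg H (sub_nonneg.2 h)
      exact ⟨X, hX, by simp [hv]⟩
    · rintro ⟨X, hX, hv⟩
      have := c.val_nonneg H.pos hX.1
      simp at hv
      linarith

end BasicRelations

section Scalars

namespace Kit
variable {β : ℝ} {t M : ℤ} {B : ℕ} {c : Coding t M B} (T : Kit c β)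
  {k m : ℕ} {r s : Recog} {P Q : (ℕ → ℝ) → Prop}

/-- Existential quantification over the real number on the last track. -/
def ex (k : ℕ) (r : Recog) : Recog :=
  Recog.exR B k (Recog.andR B (k + 1) r (Recog.reindexR B 1 (k + 1) [k] T.valid))

theorem defines_ex (H : QuadUnit β t) (h : c.Defines β (k + 1) r P) :
    c.Defines β k (T.ex k r) fun x => ∃ y, P (Function.update x k y) := by
  refine (Coding.exists_defines_ex T.valid_spec (fun _ => id) h).congr fun x => ?_
  constructor
  · rintro ⟨y, hy⟩
    obtain ⟨X, hX, rfl⟩ := c.exists_val_eq H y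
    exact ⟨X, hX, hy⟩
  · rintro ⟨X, -, hX⟩
    exact ⟨_, hX⟩

/-- Substitution: track `m` of `s` is the function of the first `k` tracks whose graph is
recognised by `r`. -/
def bind (k m : ℕ) (r s : Recog) : Recog :=
  T.ex m (Recog.andR B (m + 1) (Recog.reindexR B (k + 1) (m + 1) (List.range k ++ [m]) r) s)

theorem getD_range_append (k m i : ℕ) :
    (List.range k ++ [m]).getD i 0 = if i < k then i else if i = k then m else 0 := by
  split_ifs with h h'
  · rw [List.getD_append _ _ _ _ (by simpa using h), List.getD_eq_getElem _ _ (by simpa using h)]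
    simp
  · subst h'
    rw [List.getD_append_right _ _ _ _ (by simp)]
    simp
  · exact List.getD_eq_default _ _ (by simp; omega)

theorem defines_bind (H : QuadUnit β t) (hkm : k ≤ m) {τ : (ℕ → ℝ) → ℝ}
    (hτ : ∀ x y : ℕ → ℝ, (∀ i < k, x i = y i) → τ x = τ y)
    (hr : c.Defines β (k + 1) r fun x => x k = τ x) (hs : c.Defines β (m + 1) s P) :
    c.Defines β m (T.bind k m r s) fun x => P (Function.update x m (τ x)) := by
  have hl : ∀ i < k + 1, (List.range k ++ [m]).getD i 0 < m + 1 := fun i _ => by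
    rw [getD_range_append]
    split_ifs <;> omega
  refine (T.defines_ex H ((hr.reindex hl).and hs)).congr fun x => ?_
  have e : ∀ y, τ (fun i => Function.update x m y ((List.range k ++ [m]).getD i 0)) = τ x := by
    refine fun y => hτ _ _ fun i hi => ?_
    rw [getD_range_append, if_pos hi, Function.update_of_ne (by omega)]
  simp only [e]
  simp only [getD_range_append, lt_irrefl, if_true, if_false, Function.update_self,
    exists_eq_left]

/-- The recogniser `r` defines the graph of multiplication by `a`. -/
def Codes (c : Coding t M B) (β : ℝ) (r : Recog) (a : ℝ) : Prop :=
  c.Defines β 2 r fun x => x 1 = a * x 0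

/-- Subtraction of scalars. -/
def scSub (r s : Recog) : Recog :=
  T.bind 1 2 r (T.bind 1 3 s (Recog.reindexR B 3 4 [2, 1, 3] T.add))

/-- Composition of scalars. -/
def scMul (r s : Recog) : Recog := T.bind 1 2 r (Recog.reindexR B 2 3 [2, 1] s)

/-- Inversion of scalars. -/
def scInv (B : ℕ) (r : Recog) : Recog := Recog.reindexR B 2 2 [1, 0] r

theorem codes_scSub (H : QuadUnit β t) {a b : ℝ} (hr : Codes c β r a) (hs : Codes c β s b) :
    Codes c β (T.scSub r s) (b - a) := by
  have h := T.defines_bind H (k := 1) (m := 3) (by norm_num)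
    (τ := fun x => b * x 0) (fun x y h => by simp [h 0]) hs
    (T.add_spec.reindex (k' := 4) (l := [2, 1, 3]) (by intro i hi; interval_cases i <;> simp))
  refine (T.defines_bind H (k := 1) (m := 2) (by norm_num)
    (τ := fun x => a * x 0) (fun x y h => by simp [h 0]) hr h).congr fun x => ?_
  simp [Function.update]
  constructor <;> intro h <;> linarith

theorem codes_scMul (H : QuadUnit β t) {a b : ℝ} (hr : Codes c β r a) (hs : Codes c β s b) :
    Codes c β (T.scMul r s) (b * a) := by
  refine (T.defines_bind H (k := 1) (m := 2) (by norm_num)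
    (τ := fun x => a * x 0) (fun x y h => by simp [h 0]) hr
    (hs.reindex (k' := 3) (l := [2, 1]) (by intro i hi; interval_cases i <;> simp))).congr
    fun x => ?_
  simp [Function.update, mul_assoc]

theorem codes_scInv {a : ℝ} (ha : a ≠ 0) (hr : Codes c β r a) :
    Codes c β (scInv B r) a⁻¹ := by
  refine (hr.reindex (k' := 2) (l := [1, 0])
    (by intro i hi; interval_cases i <;> simp)).congr fun x => ?_
  simp only [List.getD_cons_zero, List.getD_cons_succ]
  rw [eq_inv_mul_iff_mul_eq₀ ha, eq_comm]

/-- Natural numbers as scalars. -/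
def scNat (n : ℕ) : Recog :=
  Nat.rec (Recog.reindexR B 3 2 [1, 1, 1] T.add)
    (fun _ r => T.bind 1 2 r (Recog.reindexR B 3 3 [2, 0, 1] T.add)) n

theorem codes_scNat (H : QuadUnit β t) (n : ℕ) : Codes c β (T.scNat n) n := by
  induction n with
  | zero =>
    refine (T.add_spec.reindex (k' := 2) (l := [1, 1, 1])
      (by intro i hi; interval_cases i <;> simp)).congr fun x => ?_
    simp
  | succ n ih =>
    refine (T.defines_bind H (k := 1) (m := 2) (by norm_num)
      (τ := fun x => n * x 0) (fun x y h => by simp [h 0]) ih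
      (T.add_spec.reindex (k' := 3) (l := [2, 0, 1])
        (by intro i hi; interval_cases i <;> simp))).congr fun x => ?_
    simp [Function.update, add_mul, eq_comm]

/-- The scalar with the given code. -/
noncomputable def scVal (β : ℝ) (q : ℕ × ℕ × ℕ × ℕ × ℕ) : ℝ :=
  ((q.2.1 - q.1 : ℝ) + (q.2.2.2.1 - q.2.2.1) * β) / (q.2.2.2.2 + 1)

/-- The recogniser for the scalar with the given code. -/
def sc (q : ℕ × ℕ × ℕ × ℕ × ℕ) : Recog :=
  T.scMul
    (T.scSub (T.scMul T.mul (T.scSub (T.scNat q.2.2.2.1) (T.scNat q.2.2.1)))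
      (T.scSub (T.scNat q.1) (T.scNat q.2.1)))
    (scInv B (T.scNat (q.2.2.2.2 + 1)))

theorem codes_sc (H : QuadUnit β t) (q : ℕ × ℕ × ℕ × ℕ × ℕ) :
    Codes c β (T.sc q) (scVal β q) := by
  have hmul : Codes c β T.mul β := T.mul_spec.congr fun x => eq_comm
  have h0 : ((q.2.2.2.2 + 1 : ℕ) : ℝ) ≠ 0 := by positivity
  have e : scVal β q = ((q.2.2.2.2 + 1 : ℕ) : ℝ)⁻¹ *
      (q.2.1 - q.1 - (q.2.2.1 - q.2.2.2.1) * β) := by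
    rw [scVal]
    push_cast
    ring
  rw [e]
  exact T.codes_scMul H
    (T.codes_scSub H (T.codes_scMul H hmul
      (T.codes_scSub H (T.codes_scNat H q.2.2.2.1) (T.codes_scNat H q.2.2.1)))
      (T.codes_scSub H (T.codes_scNat H q.1) (T.codes_scNat H q.2.1)))
    (codes_scInv h0 (T.codes_scNat H (q.2.2.2.2 + 1)))

theorem exists_scVal_eq (β : ℝ) (p q : ℚ) : ∃ n, scVal β n = p + q * β := by
  have hZ : ∀ z : ℤ, ∃ a b : ℕ, z = (b : ℤ) - a := fun z =>
    ⟨(-z).toNat, z.toNat, by omega⟩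
  obtain ⟨a, b, hab⟩ := hZ (p.num * q.den)
  obtain ⟨a', b', hab'⟩ := hZ (q.num * p.den)
  have hp := p.den_pos
  have hq := q.den_pos
  have hd : 0 < p.den * q.den := Nat.mul_pos hp hq
  refine ⟨(a, b, a', b', p.den * q.den - 1), ?_⟩
  have e1 : ((p.den * q.den - 1 : ℕ) : ℝ) + 1 = p.den * q.den := by
    rw [Nat.cast_sub (Nat.one_le_of_lt hd)]
    push_cast
    ring
  have e2 : (b : ℝ) - a = p.num * q.den := by exact_mod_cast hab.symm
  have e3 : (b' : ℝ) - a' = q.num * p.den := by exact_mod_cast hab'.symm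
  have hp' : (p.den : ℝ) ≠ 0 := by exact_mod_cast hp.ne'
  have hq' : (q.den : ℝ) ≠ 0 := by exact_mod_cast hq.ne'
  simp only [scVal, e1, e2, e3]
  rw [Rat.cast_def p, Rat.cast_def q]
  field_simp

section primrec
variable {α : Type*} [Primcodable α] {f g : α → Recog} {kf mf : α → ℕ}

theorem primrec_ex (hk : Primrec kf) (hf : Primrec f) : Primrec fun a => T.ex (kf a) (f a) := by
  have hk' := Primrec.succ.comp hk
  exact Recog.primrec_exR hk (Recog.primrec_andR hk' hf (Recog.primrec_reindexR (Primrec.const 1)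
    hk' (Primrec.list_cons.comp hk (Primrec.const [])) (Primrec.const _)))

theorem primrec_bind (hk : Primrec kf) (hm : Primrec mf) (hf : Primrec f) (hg : Primrec g) :
    Primrec fun a => T.bind (kf a) (mf a) (f a) (g a) := by
  have hm' := Primrec.succ.comp hm
  exact T.primrec_ex hm (Recog.primrec_andR hm' (Recog.primrec_reindexR (Primrec.succ.comp hk) hm'
    (Primrec.list_append.comp (Primrec.list_range.comp hk)
      (Primrec.list_cons.comp hm (Primrec.const []))) hf) hg)

theorem primrec_scSub (hf : Primrec f) (hg : Primrec g) :
    Primrec fun a => T.scSub (f a) (g a) :=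
  T.primrec_bind (Primrec.const 1) (Primrec.const 2) hf
    (T.primrec_bind (Primrec.const 1) (Primrec.const 3) hg (Primrec.const _))

theorem primrec_scInv (hf : Primrec f) : Primrec fun a => scInv B (f a) :=
  Recog.primrec_reindexR (Primrec.const 2) (Primrec.const 2) (Primrec.const _) hf

theorem primrec_scMul (hf : Primrec f) (hg : Primrec g) :
    Primrec fun a => T.scMul (f a) (g a) :=
  T.primrec_bind (Primrec.const 1) (Primrec.const 2) hf
    (Recog.primrec_reindexR (Primrec.const 2) (Primrec.const 3) (Primrec.const _) hg)

theorem primrec_scNat : Primrec T.scNat :=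
  Primrec.nat_rec₁ _ (T.primrec_bind (Primrec.const 1) (Primrec.const 2) Primrec.snd
    (Primrec.const _)).to₂

theorem primrec_sc : Primrec T.sc := by
  have h2 : Primrec fun q : ℕ × ℕ × ℕ × ℕ × ℕ => q.2 := Primrec.snd
  have h3 := Primrec.snd.comp h2
  have h4 := Primrec.snd.comp h3
  exact T.primrec_scMul
    (T.primrec_scSub (T.primrec_scMul (Primrec.const _) (T.primrec_scSub
      (T.primrec_scNat.comp (Primrec.fst.comp h4)) (T.primrec_scNat.comp (Primrec.fst.comp h3))))
      (T.primrec_scSub (T.primrec_scNat.comp Primrec.fst)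
        (T.primrec_scNat.comp (Primrec.fst.comp h2))))
    (primrec_scInv (T.primrec_scNat.comp (Primrec.succ.comp (Primrec.snd.comp h4))))

end primrec

end Kit

end Scalars

section TermsAndFormulas

namespace Kit
variable {β : ℝ} {t M : ℤ} {B : ℕ} {c : Coding t M B} (T : Kit c β)
  {k m : ℕ} {r s : Recog} {P Q : (ℕ → ℝ) → Prop} {σ τ : (ℕ → ℝ) → ℝ}

/-- The recogniser `r` defines the graph of the function `τ` of the first `k` tracks. -/
def Graph (c : Coding t M B) (β : ℝ) (k : ℕ) (r : Recog) (τ : (ℕ → ℝ) → ℝ) : Prop :=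
  (∀ x y : ℕ → ℝ, (∀ i < k, x i = y i) → τ x = τ y) ∧ c.Defines β (k + 1) r fun x => x k = τ x

theorem Graph.update (h : Graph c β k r τ) (hm : k ≤ m) (x : ℕ → ℝ) (y : ℝ) :
    τ (Function.update x m y) = τ x :=
  h.1 _ _ fun i hi => Function.update_of_ne (by omega) _ _

theorem Graph.bind (H : QuadUnit β t) (h : Graph c β k r τ) (hm : k ≤ m)
    (hs : c.Defines β (m + 1) s P) :
    c.Defines β m (T.bind k m r s) fun x => P (Function.update x m (τ x)) :=
  T.defines_bind H hm h.1 h.2 hs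

/-- The term consisting of a variable. -/
def termVar (k i : ℕ) : Recog := Recog.reindexR B 2 (k + 1) [k, i] T.eq

/-- Multiplication of a term by a scalar. -/
def termScal (k n : ℕ) (r : Recog) : Recog :=
  T.bind k (k + 1) r (Recog.reindexR B 2 (k + 2) [k + 1, k] (T.sc (Denumerable.ofNat _ n)))

/-- Addition of terms. -/
def termAdd (k : ℕ) (r s : Recog) : Recog :=
  T.bind k (k + 1) r (T.bind k (k + 2) s (Recog.reindexR B 3 (k + 3) [k + 1, k + 2, k] T.add))

/-- Equality of terms. -/
def fmlEq (k : ℕ) (r s : Recog) : Recog := T.bind k k r s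

/-- Inequality of terms. -/
def fmlLt (k : ℕ) (r s : Recog) : Recog :=
  T.bind k k r (T.bind k (k + 1) s (Recog.reindexR B 2 (k + 2) [k, k + 1] T.lt))

/-- Integrality of a term. -/
def fmlInt (k : ℕ) (r : Recog) : Recog := T.bind k k r (Recog.reindexR B 1 (k + 1) [k] T.int)

/-- Implication. -/
def fmlImp (B k : ℕ) (r s : Recog) : Recog :=
  Recog.notR B k (Recog.andR B k r (Recog.notR B k s))

/-- Universal quantification. -/
def fmlAll (k : ℕ) (r : Recog) : Recog :=
  Recog.notR B k (T.ex k (Recog.notR B (k + 1) r))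

/-- Falsity. -/
def fmlBot (k : ℕ) : Recog := T.ex k (Recog.reindexR B 2 (k + 1) [k, k] T.lt)

theorem graph_termVar {i : ℕ} (hi : i < k) : Graph c β k (T.termVar k i) fun x => x i :=
  ⟨fun _ _ h => h i hi, T.eq_spec.reindex (k' := k + 1) (l := [k, i])
    (by intro j hj; interval_cases j <;> simp; omega)⟩

theorem graph_termScal (H : QuadUnit β t) (n : ℕ) (h : Graph c β k r τ) :
    Graph c β k (T.termScal k n r) fun x => scVal β (Denumerable.ofNat _ n) * τ x := by
  refine ⟨fun x y hxy => by simp only [h.1 x y hxy], ?_⟩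
  refine (h.bind T H k.le_succ ((T.codes_sc H _).reindex (k' := k + 2) (l := [k + 1, k])
    (by intro j hj; interval_cases j <;> simp))).congr fun x => ?_
  simp [Function.update]

theorem graph_termAdd (H : QuadUnit β t) (h : Graph c β k r σ) (h' : Graph c β k s τ) :
    Graph c β k (T.termAdd k r s) fun x => σ x + τ x := by
  refine ⟨fun x y hxy => by simp only [h.1 x y hxy, h'.1 x y hxy], ?_⟩
  refine (h.bind T H k.le_succ (h'.bind T H (m := k + 2) (by omega)
    (T.add_spec.reindex (k' := k + 3) (l := [k + 1, k + 2, k])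
    (by intro j hj; interval_cases j <;> simp)))).congr fun x => ?_
  rw [h'.update k.le_succ]
  simp [Function.update, eq_comm]

theorem defines_fmlEq (H : QuadUnit β t) (h : Graph c β k r σ) (h' : Graph c β k s τ) :
    c.Defines β k (T.fmlEq k r s) fun x => σ x = τ x :=
  (h.bind T H le_rfl h'.2).congr fun x => by simp [h'.update le_rfl]

theorem defines_fmlLt (H : QuadUnit β t) (h : Graph c β k r σ) (h' : Graph c β k s τ) :
    c.Defines β k (T.fmlLt k r s) fun x => σ x < τ x := by
  refine (h.bind T H le_rfl (h'.bind T H k.le_succ (T.lt_spec.reindex (k' := k + 2)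
    (l := [k, k + 1]) (by intro j hj; interval_cases j <;> simp)))).congr fun x => ?_
  rw [h'.update le_rfl]
  simp [Function.update]

theorem defines_fmlInt (H : QuadUnit β t) (h : Graph c β k r σ) :
    c.Defines β k (T.fmlInt k r) fun x => ∃ z : ℤ, σ x = z :=
  (h.bind T H le_rfl (T.int_spec.reindex (k' := k + 1) (l := [k])
    (by intro j hj; interval_cases j; simp))).congr fun x => by simp

theorem defines_fmlImp (h : c.Defines β k r P) (h' : c.Defines β k s Q) :
    c.Defines β k (fmlImp B k r s) fun x => P x → Q x :=
  (h.and h'.not).not.congr fun x => by tauto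

theorem defines_fmlAll (H : QuadUnit β t) (h : c.Defines β (k + 1) r P) :
    c.Defines β k (T.fmlAll k r) fun x => ∀ y, P (Function.update x k y) :=
  (T.defines_ex H h.not).not.congr fun x => by push Not; rfl

theorem defines_fmlBot (H : QuadUnit β t) : c.Defines β k (T.fmlBot k) fun _ => False :=
  (T.defines_ex H (T.lt_spec.reindex (k' := k + 1) (l := [k, k])
    (by intro j hj; interval_cases j <;> simp))).congr fun x => by simp

section primrec
variable {α : Type*} [Primcodable α] {f g : α → Recog} {kf mf : α → ℕ}

theorem primrec_termVar (hk : Primrec kf) (hm : Primrec mf) :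
    Primrec fun a => T.termVar (kf a) (mf a) :=
  Recog.primrec_reindexR (Primrec.const 2) (Primrec.succ.comp hk)
    (Primrec.list_cons.comp hk (Primrec.list_cons.comp hm (Primrec.const []))) (Primrec.const _)

theorem primrec_termScal (hk : Primrec kf) (hm : Primrec mf) (hf : Primrec f) :
    Primrec fun a => T.termScal (kf a) (mf a) (f a) := by
  have hk1 := Primrec.succ.comp hk
  exact T.primrec_bind hk hk1 hf (Recog.primrec_reindexR (Primrec.const 2)
    (Primrec.succ.comp hk1)
    (Primrec.list_cons.comp hk1 (Primrec.list_cons.comp hk (Primrec.const [])))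
    (T.primrec_sc.comp ((Primrec.ofNat _).comp hm)))

theorem primrec_termAdd (hk : Primrec kf) (hf : Primrec f) (hg : Primrec g) :
    Primrec fun a => T.termAdd (kf a) (f a) (g a) := by
  have hk1 := Primrec.succ.comp hk
  have hk2 := Primrec.succ.comp hk1
  exact T.primrec_bind hk hk1 hf (T.primrec_bind hk hk2 hg (Recog.primrec_reindexR
    (Primrec.const 3) (Primrec.succ.comp hk2) (Primrec.list_cons.comp hk1
      (Primrec.list_cons.comp hk2 (Primrec.list_cons.comp hk (Primrec.const []))))
    (Primrec.const _)))

theorem primrec_fmlLt (hk : Primrec kf) (hf : Primrec f) (hg : Primrec g) :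
    Primrec fun a => T.fmlLt (kf a) (f a) (g a) := by
  have hk1 := Primrec.succ.comp hk
  exact T.primrec_bind hk hk hf (T.primrec_bind hk hk1 hg (Recog.primrec_reindexR
    (Primrec.const 2) (Primrec.succ.comp hk1)
    (Primrec.list_cons.comp hk (Primrec.list_cons.comp hk1 (Primrec.const [])))
    (Primrec.const _)))

theorem primrec_fmlInt (hk : Primrec kf) (hf : Primrec f) :
    Primrec fun a => T.fmlInt (kf a) (f a) :=
  T.primrec_bind hk hk hf (Recog.primrec_reindexR (Primrec.const 1) (Primrec.succ.comp hk)
    (Primrec.list_cons.comp hk (Primrec.const [])) (Primrec.const _))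

theorem primrec_fmlImp (hk : Primrec kf) (hf : Primrec f) (hg : Primrec g) :
    Primrec fun a => fmlImp B (kf a) (f a) (g a) :=
  Recog.primrec_notR hk (Recog.primrec_andR hk hf (Recog.primrec_notR hk hg))

theorem primrec_fmlAll (hk : Primrec kf) (hf : Primrec f) :
    Primrec fun a => T.fmlAll (kf a) (f a) :=
  Recog.primrec_notR hk (T.primrec_ex hk (Recog.primrec_notR (Primrec.succ.comp hk) hf))

theorem primrec_fmlBot (hk : Primrec kf) : Primrec fun a => T.fmlBot (kf a) :=
  T.primrec_ex hk (Recog.primrec_reindexR (Primrec.const 2) (Primrec.succ.comp hk)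
    (Primrec.list_cons.comp hk (Primrec.list_cons.comp hk (Primrec.const []))) (Primrec.const _))

end primrec

/-- The effect of a symbol of a term at level `k` on a stack of recognisers. -/
def termStep (k a : ℕ) (l : List Recog) : List Recog :=
  if a % 2 = 0 then T.termVar k (a / 4) :: l
  else if (a / 2).unpair.1 = 1 then T.termScal k (a / 2).unpair.2 (l.getD 0 default) :: l.tail
  else T.termAdd k (l.getD 0 default) (l.getD 1 default) :: l.tail.tail

/-- The recogniser for the graph of a coded term at level `k`. -/
def term (k n : ℕ) : Recog :=
  ((Denumerable.ofNat (List ℕ) n).foldr (T.termStep k) []).getD 0 default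

/-- The code of a list is that of the list of codes. -/
theorem encode_map_encode {α : Type*} [Encodable α] (l : List α) :
    Encodable.encode (l.map Encodable.encode) = Encodable.encode l := by
  induction l with
  | nil => rfl
  | cons a l ih => rw [List.map_cons, Encodable.encode_list_cons, Encodable.encode_list_cons, ih,
      Encodable.encode_nat]

theorem ofNat_encode_list {α : Type*} [Encodable α] (l : List α) :
    Denumerable.ofNat (List ℕ) (Encodable.encode l) = l.map Encodable.encode := by
  rw [← encode_map_encode, Denumerable.ofNat_encode]

theorem primrec_term : Primrec₂ T.term := by
  have hl : Primrec fun x : (ℕ × ℕ) × ℕ × List Recog => x.2.2 := Primrec.snd.comp Primrec.snd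
  have ha : Primrec fun x : (ℕ × ℕ) × ℕ × List Recog => x.2.1 := Primrec.fst.comp Primrec.snd
  have hk : Primrec fun x : (ℕ × ℕ) × ℕ × List Recog => x.1.1 := Primrec.fst.comp Primrec.fst
  have hu := Primrec.unpair.comp (Primrec.nat_div.comp ha (Primrec.const 2))
  have h0 := (Primrec.list_getD (default : Recog)).comp hl (Primrec.const 0)
  have h1 := (Primrec.list_getD (default : Recog)).comp hl (Primrec.const 1)
  have ht := Primrec.list_tail.comp hl
  have step : Primrec fun x : (ℕ × ℕ) × ℕ × List Recog => T.termStep x.1.1 x.2.1 x.2.2 :=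
    Primrec.ite (Primrec.eq.comp (Primrec.nat_mod.comp ha (Primrec.const 2)) (Primrec.const 0))
      (Primrec.list_cons.comp
        (T.primrec_termVar hk (Primrec.nat_div.comp ha (Primrec.const 4))) hl)
      (Primrec.ite (Primrec.eq.comp (Primrec.fst.comp hu) (Primrec.const 1))
        (Primrec.list_cons.comp (T.primrec_termScal hk (Primrec.snd.comp hu) h0) ht)
        (Primrec.list_cons.comp (T.primrec_termAdd hk h0 h1) (Primrec.list_tail.comp ht)))
  exact (Primrec.list_getD (default : Recog)).comp
    (Primrec.list_foldr ((Primrec.ofNat _).comp Primrec.snd) (Primrec.const []) step.to₂)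
    (Primrec.const 0)

end Kit

end TermsAndFormulas

section TermEvaluation

open FirstOrder Language

attribute [local instance] kStruc

namespace Kit
variable {β : ℝ} {t M : ℤ} {B : ℕ} {c : Coding t M B} (T : Kit c β) {K : Subfield ℝ}

section semantics
variable [eF : ∀ n, Encodable ((kLang K).Functions n)]

theorem encode_funSym {k n : ℕ} (f : (kLang K).Functions n) :
    Encodable.encode (Sum.inr ⟨n, f⟩ : (Empty ⊕ Fin k) ⊕ (Σ n, (kLang K).Functions n)) =
      2 * Nat.pair n (Encodable.encode f) + 1 := by
  rw [Encodable.encode_inr, Encodable.encode_sigma_val, Encodable.encode_nat]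

theorem foldr_termStep (H : QuadUnit β t)
    (hF : ∀ a : K, scVal β (Denumerable.ofNat _ (Encodable.encode (symScal a))) = a)
    {k : ℕ} (e : (kLang K).Term (Empty ⊕ Fin k)) :
    ∃ r, Graph c β k r (fun x => e.realize (Sum.elim default fun i : Fin k => x i)) ∧
      ∀ l, (e.listEncode.map Encodable.encode ++ l).foldr (T.termStep k) [] =
        r :: l.foldr (T.termStep k) [] := by
  induction e with
  | var i =>
    rcases i with i | i
    · exact i.elim
    · refine ⟨_, T.graph_termVar i.2, fun l => ?_⟩
      have h1 : 2 * (2 * (i : ℕ) + 1) / 4 = i := by omega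
      simp only [Term.listEncode, List.map_cons, List.map_nil, Encodable.encode_inl,
        Encodable.encode_inr, List.cons_append, List.nil_append, List.foldr_cons, termStep]
      rw [if_pos (by omega)]
      exact congrArg (fun j => T.termVar k j :: _) h1
  | @func n f ts ih =>
    match n, f, ts, ih with
    | 0, f, _, _ => exact (show Empty from f).elim
    | 1, f, ts, ih =>
      obtain ⟨r, hr, hl⟩ := ih 0
      have hg := T.graph_termScal H (Encodable.encode f) hr
      have ha : scVal β (Denumerable.ofNat _ (Encodable.encode f)) = (show K from f) := hF f
      rw [ha] at hg
      refine ⟨_, hg, fun l => ?_⟩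
      have h : (Term.func f ts).listEncode.map Encodable.encode ++ l =
          (2 * Nat.pair 1 (Encodable.encode f) + 1) ::
            ((ts 0).listEncode.map Encodable.encode ++ l) := by
        rw [Term.listEncode, List.map_cons, encode_funSym]
        simp [List.finRange_succ]
      have h1 : (2 * Nat.pair 1 (Encodable.encode f) + 1) / 2 =
        Nat.pair 1 (Encodable.encode f) := by omega
      rw [h, List.foldr_cons, hl, termStep, if_neg (by omega), h1, Nat.unpair_pair]
      rfl
    | 2, f, ts, ih =>
      obtain ⟨r, hr, hl⟩ := ih 0
      obtain ⟨s, hs, hl'⟩ := ih 1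
      refine ⟨_, T.graph_termAdd H hr hs, fun l => ?_⟩
      have h : (Term.func f ts).listEncode.map Encodable.encode ++ l =
          (2 * Nat.pair 2 (Encodable.encode f) + 1) :: ((ts 0).listEncode.map Encodable.encode ++
            ((ts 1).listEncode.map Encodable.encode ++ l)) := by
        rw [Term.listEncode, List.map_cons, encode_funSym]
        simp [List.finRange_succ]
      have h1 : (2 * Nat.pair 2 (Encodable.encode f) + 1) / 2 =
        Nat.pair 2 (Encodable.encode f) := by omega
      rw [h, List.foldr_cons, hl, hl', termStep, if_neg (by omega), h1, Nat.unpair_pair]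
      rfl
    | n + 3, f, _, _ => exact (show Empty from f).elim

end semantics

end Kit

end TermEvaluation

section FormulaEvaluation

open FirstOrder Language

/-- An entry of the stack of the evaluation machine: its kind (`1` for formulas, `0` for terms), its
level and its recogniser. -/
abbrev StackEntry := ℕ × ℕ × Recog

namespace Kit
variable {β : ℝ} {t M : ℤ} {B : ℕ} {c : Coding t M B} (T : Kit c β) {K : Subfield ℝ}

/-- Take a formula, or else an equation of two terms, from a stack. -/
def popFml (l : List StackEntry) : StackEntry × List StackEntry :=
  if (l.getD 0 default).1 = 1 then (l.getD 0 default, l.tail)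
  else ((1, (l.getD 0 default).2.1,
    T.fmlEq (l.getD 0 default).2.1 (l.getD 0 default).2.2 (l.getD 1 default).2.2), l.tail.tail)

/-- The effect of a relation symbol on a stack. -/
def relStep (a : ℕ) (l : List StackEntry) : List StackEntry :=
  if (a / 4).unpair.1 = 1 then
    (1, (l.getD 0 default).2.1, T.fmlInt (l.getD 0 default).2.1 (l.getD 0 default).2.2) :: l.tail
  else (1, (l.getD 0 default).2.1, T.fmlLt (l.getD 0 default).2.1 (l.getD 0 default).2.2
    (l.getD 1 default).2.2) :: l.tail.tail

/-- The effect of an implication on a stack. -/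
def impStep (l : List StackEntry) : List StackEntry :=
  (1, (T.popFml l).1.2.1, fmlImp B (T.popFml l).1.2.1 (T.popFml l).1.2.2
    (T.popFml (T.popFml l).2).1.2.2) :: (T.popFml (T.popFml l).2).2

/-- The effect of a universal quantifier on a stack. -/
def allStep (l : List StackEntry) : List StackEntry :=
  (1, (T.popFml l).1.2.1 - 1, T.fmlAll ((T.popFml l).1.2.1 - 1) (T.popFml l).1.2.2) ::
    (T.popFml l).2

/-- The effect of a symbol of a formula on the current and the previous stack. -/
def fmlStep (a : ℕ) (l : List StackEntry × List StackEntry) :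
    List StackEntry × List StackEntry :=
  (if a % 2 = 0 then
    (0, (a / 2).unpair.1, T.term (a / 2).unpair.1 (a / 2).unpair.2) :: l.1
  else if a % 4 = 1 then T.relStep a l.2
  else if a / 4 = 0 then T.impStep l.1
  else if a / 4 = 1 then T.allStep l.1
  else (1, a / 4 - 2, T.fmlBot (a / 4 - 2)) :: l.1, l.1)

/-- The stack after reading a list of symbols. -/
def run (l : List ℕ) : List StackEntry × List StackEntry := l.foldr T.fmlStep ([], [])

/-- The recogniser of a coded sentence. -/
def fml (n : ℕ) : Recog := (T.popFml (T.run (Denumerable.ofNat (List ℕ) n)).1).1.2.2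

section primrec
variable {α : Type*} [Primcodable α] {f : α → List StackEntry} {af : α → ℕ}

theorem primrec_popFml (hf : Primrec f) : Primrec fun a => T.popFml (f a) := by
  have h0 := (Primrec.list_getD (default : StackEntry)).comp hf (Primrec.const 0)
  have h1 := (Primrec.list_getD (default : StackEntry)).comp hf (Primrec.const 1)
  have ht := Primrec.list_tail.comp hf
  have hk := Primrec.fst.comp (Primrec.snd.comp h0)
  exact Primrec.ite (Primrec.eq.comp (Primrec.fst.comp h0) (Primrec.const 1)) (h0.pair ht)
    (((Primrec.const 1).pair (hk.pair (T.primrec_bind hk hk (Primrec.snd.comp (Primrec.snd.comp h0))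
      (Primrec.snd.comp (Primrec.snd.comp h1))))).pair (Primrec.list_tail.comp ht))

theorem primrec_relStep (ha : Primrec af) (hf : Primrec f) :
    Primrec fun a => T.relStep (af a) (f a) := by
  have h0 := (Primrec.list_getD (default : StackEntry)).comp hf (Primrec.const 0)
  have h1 := (Primrec.list_getD (default : StackEntry)).comp hf (Primrec.const 1)
  have ht := Primrec.list_tail.comp hf
  have hk := Primrec.fst.comp (Primrec.snd.comp h0)
  have hr := Primrec.snd.comp (Primrec.snd.comp h0)
  exact Primrec.ite (Primrec.eq.comp (Primrec.fst.comp (Primrec.unpair.comp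
      (Primrec.nat_div.comp ha (Primrec.const 4)))) (Primrec.const 1))
    (Primrec.list_cons.comp ((Primrec.const 1).pair (hk.pair (T.primrec_fmlInt hk hr))) ht)
    (Primrec.list_cons.comp ((Primrec.const 1).pair (hk.pair (T.primrec_fmlLt hk hr
      (Primrec.snd.comp (Primrec.snd.comp h1))))) (Primrec.list_tail.comp ht))

theorem primrec_impStep (hf : Primrec f) : Primrec fun a => T.impStep (f a) := by
  have h0 := T.primrec_popFml hf
  have h1 := T.primrec_popFml (Primrec.snd.comp h0)
  have e0 := Primrec.snd.comp (Primrec.fst.comp h0)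
  have e1 := Primrec.snd.comp (Primrec.fst.comp h1)
  exact Primrec.list_cons.comp ((Primrec.const 1).pair ((Primrec.fst.comp e0).pair
    (primrec_fmlImp (Primrec.fst.comp e0) (Primrec.snd.comp e0) (Primrec.snd.comp e1))))
    (Primrec.snd.comp h1)

theorem primrec_allStep (hf : Primrec f) : Primrec fun a => T.allStep (f a) := by
  have h0 := T.primrec_popFml hf
  have e0 := Primrec.snd.comp (Primrec.fst.comp h0)
  have hk := Primrec.nat_sub.comp (Primrec.fst.comp e0) (Primrec.const 1)
  exact Primrec.list_cons.comp ((Primrec.const 1).pair (hk.pair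
    (T.primrec_fmlAll hk (Primrec.snd.comp e0)))) (Primrec.snd.comp h0)

theorem primrec_fmlStep : Primrec₂ T.fmlStep := by
  have ha : Primrec fun x : ℕ × List StackEntry × List StackEntry => x.1 := Primrec.fst
  have h1 : Primrec fun x : ℕ × List StackEntry × List StackEntry => x.2.1 :=
    Primrec.fst.comp Primrec.snd
  have h2 : Primrec fun x : ℕ × List StackEntry × List StackEntry => x.2.2 :=
    Primrec.snd.comp Primrec.snd
  have hu := Primrec.unpair.comp (Primrec.nat_div.comp ha (Primrec.const 2))
  have h4 := Primrec.nat_div.comp ha (Primrec.const 4)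
  have h42 := Primrec.nat_sub.comp h4 (Primrec.const 2)
  have eq : ∀ {g : ℕ × List StackEntry × List StackEntry → ℕ} (n : ℕ), Primrec g →
      PrimrecPred fun x => g x = n := fun n hg => Primrec.eq.comp hg (Primrec.const n)
  exact (Primrec.ite (eq 0 (Primrec.nat_mod.comp ha (Primrec.const 2)))
    (Primrec.list_cons.comp ((Primrec.const 0).pair ((Primrec.fst.comp hu).pair
      (T.primrec_term.comp (Primrec.fst.comp hu) (Primrec.snd.comp hu)))) h1)
    (Primrec.ite (eq 1 (Primrec.nat_mod.comp ha (Primrec.const 4))) (T.primrec_relStep ha h2)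
    (Primrec.ite (eq 0 h4) (T.primrec_impStep h1)
    (Primrec.ite (eq 1 h4) (T.primrec_allStep h1)
    (Primrec.list_cons.comp ((Primrec.const 1).pair (h42.pair (T.primrec_fmlBot h42))) h1))))).pair
    h1

theorem primrec_fml : Primrec T.fml :=
  Primrec.snd.comp (Primrec.snd.comp (Primrec.fst.comp (T.primrec_popFml (Primrec.fst.comp
    (Primrec.list_foldr (Primrec.ofNat _) (Primrec.const ([], []))
      (T.primrec_fmlStep.comp (Primrec.fst.comp Primrec.snd)
        (Primrec.snd.comp Primrec.snd)).to₂)))))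

end primrec

section
attribute [local instance] kStruc
variable [eF : ∀ n, Encodable ((kLang K).Functions n)]
  [eR : ∀ n, Encodable ((kLang K).Relations n)]

/-- The symbols in the lists encoding formulas. -/
abbrev FmlSym (K : Subfield ℝ) : Type _ :=
  (Σ k, (kLang K).Term (Empty ⊕ Fin k)) ⊕ ((Σ n, (kLang K).Relations n) ⊕ ℕ)

theorem encode_termSym {k : ℕ} (e : (kLang K).Term (Empty ⊕ Fin k)) :
    Encodable.encode (Sum.inl ⟨k, e⟩ : FmlSym K) = 2 * Nat.pair k (Encodable.encode e) := by
  rw [Encodable.encode_inl, Encodable.encode_sigma_val, Encodable.encode_nat]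

theorem encode_relSym {n : ℕ} (R : (kLang K).Relations n) :
    Encodable.encode (Sum.inr (Sum.inl ⟨n, R⟩) : FmlSym K) =
      4 * Nat.pair n (Encodable.encode R) + 1 := by
  rw [Encodable.encode_inr, Encodable.encode_inl, Encodable.encode_sigma_val, Encodable.encode_nat]
  omega

theorem encode_natSym (n : ℕ) :
    Encodable.encode (Sum.inr (Sum.inr n) : FmlSym K) = 4 * n + 3 := by
  rw [Encodable.encode_inr, Encodable.encode_inr, Encodable.encode_nat]
  omega

theorem run_term (H : QuadUnit β t)
    (hF : ∀ a : K, scVal β (Denumerable.ofNat _ (Encodable.encode (symScal a))) = a)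
    {k : ℕ} (e : (kLang K).Term (Empty ⊕ Fin k)) :
    ∃ r, Graph c β k r (fun x => e.realize (Sum.elim default fun i : Fin k => x i)) ∧
      ∀ l, (T.run (Encodable.encode (Sum.inl ⟨k, e⟩ : FmlSym K) :: l)).1 =
        (0, k, r) :: (T.run l).1 := by
  obtain ⟨r, hr, hl⟩ := T.foldr_termStep H hF e
  refine ⟨r, hr, fun l => ?_⟩
  have h1 : T.term k (Encodable.encode e) = r := by
    have h2 : Encodable.encode e = Encodable.encode e.listEncode := rfl
    rw [term, h2, ofNat_encode_list]
    have := hl []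
    rw [List.append_nil] at this
    rw [this]
    rfl
  have h3 : 2 * Nat.pair k (Encodable.encode e) / 2 = Nat.pair k (Encodable.encode e) := by omega
  rw [run, List.foldr_cons, encode_termSym, fmlStep, if_pos (by omega), h3, Nat.unpair_pair, h1]
  rfl

theorem popFml_run (H : QuadUnit β t)
    (hF : ∀ a : K, scVal β (Denumerable.ofNat _ (Encodable.encode (symScal a))) = a)
    {n : ℕ} (φ : (kLang K).BoundedFormula Empty n) :
    ∃ r, c.Defines β n r (fun x => φ.Realize default fun i => x i) ∧
      ∀ l, T.popFml (T.run (φ.listEncode.map Encodable.encode ++ l)).1 =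
        ((1, n, r), (T.run l).1) := by
  induction φ with
  | @falsum n =>
    refine ⟨_, T.defines_fmlBot H, fun l => ?_⟩
    have h1 : (4 * (n + 2) + 3) / 4 = n + 2 := by omega
    rw [BoundedFormula.listEncode, List.map_cons, encode_natSym, List.map_nil, List.cons_append,
      List.nil_append, run, List.foldr_cons, fmlStep, if_neg (by omega), if_neg (by omega), h1,
      if_neg (by omega), if_neg (by omega)]
    rfl
  | @equal n e₁ e₂ =>
    obtain ⟨r, hr, hr'⟩ := T.run_term H hF e₁
    obtain ⟨s, hs, hs'⟩ := T.run_term H hF e₂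
    refine ⟨_, T.defines_fmlEq H hr hs, fun l => ?_⟩
    rw [BoundedFormula.listEncode, List.map_cons, List.map_cons, List.map_nil, List.cons_append,
      List.cons_append, List.nil_append, hr', hs']
    rfl
  | @rel n m R ts =>
    have h1 : ∀ l, (T.run ((BoundedFormula.rel R ts).listEncode.map Encodable.encode ++ l)).1 =
        T.relStep (4 * Nat.pair m (Encodable.encode R) + 1)
          (T.run (((List.finRange m).map fun i =>
            Encodable.encode (Sum.inl ⟨n, ts i⟩ : FmlSym K)) ++ l)).1 := by
      intro l
      rw [BoundedFormula.listEncode, List.map_append, List.map_cons, List.map_cons, List.map_nil,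
        encode_relSym, List.map_map, List.append_assoc, List.cons_append, run, List.foldr_cons,
        fmlStep, if_neg (by omega), if_pos (by omega)]
      rfl
    have h2 : (4 * Nat.pair m (Encodable.encode R) + 1) / 4 = Nat.pair m (Encodable.encode R) := by
      omega
    simp only [h1]
    clear h1
    match m, R, ts, h2 with
    | 0, R, _, _ => exact (show Empty from R).elim
    | 1, R, ts, h2 =>
      obtain ⟨r, hr, hr'⟩ := T.run_term H hF (ts 0)
      refine ⟨_, T.defines_fmlInt H hr, fun l => ?_⟩
      rw [relStep, h2, Nat.unpair_pair, if_pos rfl]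
      simp only [List.finRange_succ, List.finRange_zero, List.map_nil, List.map_cons,
        List.cons_append, List.nil_append, hr']
      rfl
    | 2, R, ts, h2 =>
      obtain ⟨r, hr, hr'⟩ := T.run_term H hF (ts 0)
      obtain ⟨s, hs, hs'⟩ := T.run_term H hF (ts 1)
      refine ⟨_, T.defines_fmlLt H hr hs, fun l => ?_⟩
      rw [relStep, h2, Nat.unpair_pair, if_neg (by norm_num)]
      simp only [List.finRange_succ, List.finRange_zero, List.map_nil, List.map_cons,
        List.cons_append, List.nil_append, hr', hs', Fin.succ_zero_eq_one]
      rfl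
    | m + 3, R, _, _ => exact (show Empty from R).elim
  | @imp n φ ψ ih₁ ih₂ =>
    obtain ⟨r, hr, hr'⟩ := ih₁
    obtain ⟨s, hs, hs'⟩ := ih₂
    refine ⟨_, defines_fmlImp hr hs, fun l => ?_⟩
    rw [BoundedFormula.listEncode, List.map_append, List.map_cons, List.append_assoc,
      List.cons_append, encode_natSym, run, List.foldr_cons, ← run, fmlStep, if_neg (by omega),
      if_neg (by omega), if_pos (by omega), impStep, hr', hs']
    rfl
  | @all n φ ih =>
    obtain ⟨r, hr, hr'⟩ := ih
    refine ⟨_, (T.defines_fmlAll H hr).congr fun x => ?_, fun l => ?_⟩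
    · rw [BoundedFormula.realize_all]
      refine forall_congr' fun y => iff_of_eq (congrArg _ (funext fun i => ?_))
      refine Fin.lastCases ?_ (fun i => ?_) i
      · simp
      · simp [Function.update_of_ne (Nat.ne_of_lt i.2)]
    · rw [BoundedFormula.listEncode, List.map_cons, List.cons_append, encode_natSym, run,
        List.foldr_cons, ← run, fmlStep, if_neg (by omega), if_neg (by omega), if_neg (by omega),
        if_pos (by omega), allStep, hr']
      rfl

theorem defines_fml (H : QuadUnit β t)
    (hF : ∀ a : K, scVal β (Denumerable.ofNat _ (Encodable.encode (symScal a))) = a)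
    (φ : (kLang K).Sentence) :
    c.Defines β 0 (T.fml (sentenceEncode eF eR φ)) fun _ => ℝ ⊨ φ := by
  obtain ⟨r, hr, h⟩ := T.popFml_run H hF φ
  have h1 : T.fml (sentenceEncode eF eR φ) = r := by
    rw [fml, sentenceEncode, ofNat_encode_list]
    have := h []
    rw [List.append_nil] at this
    rw [this]
  rw [h1]
  refine hr.congr fun x => ?_
  rw [Sentence.Realize, Formula.Realize]
  have h2 : ∀ (v v' : Empty → ℝ) (u u' : Fin 0 → ℝ),
      BoundedFormula.Realize φ v u ↔ BoundedFormula.Realize φ v' u' := fun v v' u u' => by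
    rw [Subsingleton.elim v v', Subsingleton.elim u u']
  exact h2 _ _ _ _

end

end Kit

end FormulaEvaluation

section Decidability

open FirstOrder Language

namespace Recog

/-- The image of the word of length `n + 1` over an alphabet with one letter. -/
def unaryPow (r : Recog) (n : ℕ) : ℕ :=
  Nat.rec (r.letter 0) (fun _ x => r.mul x (r.letter 0)) n

/-- This number is positive when a recogniser without tracks accepts. -/
def truth (r : Recog) : ℕ :=
  sumR r.1 fun n => eqN (r.mul (r.unaryPow n) (r.unaryPow n)) (r.unaryPow n) *
    r.acc (r.unaryPow n) (r.unaryPow n)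

theorem primrec_truth : Primrec truth := by
  have hpow : Primrec₂ unaryPow :=
    Primrec.nat_rec (primrec_letter Primrec.id (Primrec.const 0))
      (primrec_mul Primrec.fst (Primrec.snd.comp Primrec.snd)
        (primrec_letter Primrec.fst (Primrec.const 0))).to₂
  exact primrec_sumR Primrec.fst (Primrec.nat_mul.comp
    (primrec_eqN.comp (primrec_mul Primrec.fst hpow hpow) hpow)
    (primrec_acc Primrec.fst hpow hpow)).to₂

theorem unaryPow_add_eq {r : Recog} {i j : ℕ} (h : r.unaryPow i = r.unaryPow j) (k : ℕ) :
    r.unaryPow (i + k) = r.unaryPow (j + k) := by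
  induction k with
  | zero => exact h
  | succ k ih => exact congrArg (fun x => r.mul x (r.letter 0)) ih

theorem exists_unaryPow_eq {r : Recog} (h : ∀ n, r.unaryPow n < r.1) (n : ℕ) :
    ∃ m < r.1, r.unaryPow m = r.unaryPow n := by
  obtain ⟨i, hi, j, hj, hij, e⟩ := Finset.exists_ne_map_eq_of_card_lt_of_maps_to
    (s := Finset.range (r.1 + 1)) (t := Finset.range r.1) (f := r.unaryPow) (by simp)
    fun n _ => by simpa using h n
  wlog hlt : i < j generalizing i j
  · exact this j hj i hi hij.symm e.symm (by omega)
  rw [Finset.mem_range] at hi hj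
  induction n using Nat.strong_induction_on with
  | _ n ih =>
    rcases Nat.lt_or_ge n j with hn | hn
    · exact ⟨n, by omega, rfl⟩
    · obtain ⟨m, hm, hm'⟩ := ih (n - j + i) (by omega)
      refine ⟨m, hm, hm'.trans ?_⟩
      have := unaryPow_add_eq e (n - j)
      rwa [show j + (n - j) = n by omega, Nat.add_comm] at this

theorem Recognizes.truth_pos {B : ℕ} {r : Recog} {L : (ℕ → ℕ → Fin B) → Prop}
    (H : r.Recognizes 0 L) (a : ℕ → Fin B) : 0 < r.truth ↔ L fun _ => a := by
  obtain ⟨φ, h1, h2, h3, h4⟩ := H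
  have hpow : ∀ n, φ (List.replicate (n + 1) a) = r.unaryPow n := by
    intro n
    induction n with
    | zero => exact h2 a
    | succ n ih =>
      rw [List.replicate_succ' , h3 _ (by simp) _ (by simp), ih]
      exact congrArg _ (h2 a)
  have hseg : ∀ x y, seg (fun _ : ℕ => a) x y = List.replicate (y - x) a := fun x y => by
    simp [seg]
  have key : ∀ n, r.mul (r.unaryPow n) (r.unaryPow n) = r.unaryPow n →
      (L (fun _ => a) ↔ 0 < r.acc (r.unaryPow n) (r.unaryPow n)) := by
    intro n hn
    have := h4 (fun _ => a) (fun i => (n + 1) * (i + 1)) (r.unaryPow n)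
      (fun i j hij => Nat.mul_lt_mul_of_pos_left (by omega) (by omega)) (by positivity)
      (fun i => by
        rw [hseg, ← hpow, ← Nat.mul_sub]
        congr 2
        simp) hn
    rwa [hseg, show (n + 1) * (0 + 1) - 0 = n + 1 by omega, hpow] at this
  rw [truth, sumR_pos]
  constructor
  · rintro ⟨n, -, h⟩
    rw [mul_pos_iff_nat, eqN_pos] at h
    exact (key n h.1).2 h.2
  · intro h
    obtain ⟨g, e, hg, he⟩ := exists_monochromatic_seq
      (fun i j => φ (List.replicate (j - i) a)) (N := r.1) fun i j hij =>
        h1 _ (by simpa using Nat.sub_ne_zero_of_lt hij)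
    have h01 := hg (show 0 < 1 by omega)
    have h12 := hg (show 1 < 2 by omega)
    have hee : r.mul e e = e := by
      have := h3 (List.replicate (g 1 - g 0) a) (by simpa using Nat.sub_ne_zero_of_lt h01)
        (List.replicate (g 2 - g 1) a) (by simpa using Nat.sub_ne_zero_of_lt h12)
      rw [List.replicate_append_replicate, show g 1 - g 0 + (g 2 - g 1) = g 2 - g 0 by omega,
        he 0 1 (by omega), he 1 2 (by omega), he 0 2 (by omega)] at this
      exact this.symm
    obtain ⟨m, hm, hm'⟩ := exists_unaryPow_eq (fun n => hpow n ▸ h1 _ (by simp))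
      (g 1 - g 0 - 1)
    have hem : r.unaryPow m = e := by
      rw [hm', ← hpow, show g 1 - g 0 - 1 + 1 = g 1 - g 0 by omega, he 0 1 (by omega)]
    rw [← hem] at hee
    exact ⟨m, hm, mul_pos_iff_nat.2 ⟨eqN_pos.2 hee, (key m hee).1 h⟩⟩

end Recog

theorem Coding.Defines.truth_pos {β : ℝ} {t M : ℤ} {B : ℕ} {c : Coding t M B} {r : Recog}
    {p : Prop} (H : QuadUnit β t) (h : c.Defines β 0 r fun _ => p) : 0 < r.truth ↔ p := by
  obtain ⟨L, hL, hw⟩ := h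
  obtain ⟨X, -⟩ := c.exists_val_eq H 0
  exact (hL.truth_pos X).trans (hw _ fun i hi => absurd hi (Nat.not_lt_zero i))

section
attribute [local instance] kStruc
variable {K : Subfield ℝ}

theorem theoryDecidable_of_quadUnit {β : ℝ} {t : ℤ} (H : QuadUnit β t)
    (hK : ∀ x ∈ K, ∃ p q : ℚ, x = p + q * β) : TheoryDecidable (kLang K) ℝ := by
  obtain ⟨M, B, c, ⟨T⟩⟩ := exists_kit H
  have hcode : ∀ a : K, ∃ n, Kit.scVal β n = a := fun a => by
    obtain ⟨p, q, h⟩ := hK a a.2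
    rw [h]
    exact Kit.exists_scVal_eq β p q
  choose code hcode using hcode
  have hinj : Function.Injective code := fun a b h => by
    apply Subtype.ext
    rw [← hcode, h, hcode]
  let eF : ∀ n, Encodable ((kLang K).Functions n)
    | 0 => inferInstanceAs (Encodable Empty)
    | 1 => Encodable.ofInj (α := K) code hinj
    | 2 => inferInstanceAs (Encodable Unit)
    | _ + 3 => inferInstanceAs (Encodable Empty)
  let eR : ∀ n, Encodable ((kLang K).Relations n)
    | 0 => inferInstanceAs (Encodable Empty)
    | 1 => inferInstanceAs (Encodable Unit)
    | 2 => inferInstanceAs (Encodable Unit)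
    | _ + 3 => inferInstanceAs (Encodable Empty)
  have hprim : Primrec fun n => decide (0 < (T.fml n).truth) :=
    (PrimrecRel.comp Primrec.nat_lt (Primrec.const 0)
      (Recog.primrec_truth.comp T.primrec_fml)).decide
  refine ⟨eF, eR, _, hprim.to_comp, fun φ => ?_⟩
  have h := T.defines_fml (eF := eF) (eR := eR) H (fun a => by
    rw [show Encodable.encode (symScal a) = Encodable.encode (code a) from rfl,
      Denumerable.ofNat_encode, hcode]) φ
  rw [decide_eq_true_iff]
  exact h.truth_pos H

theorem theoryDecidable_of_eq_range (hK : (K : Set ℝ) = Set.range ((↑) : ℚ → ℝ)) :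
    TheoryDecidable (kLang K) ℝ := by
  have h2 : √(2 : ℝ) ^ 2 = 2 := Real.sq_sqrt (by norm_num)
  have H : QuadUnit (3 + 2 * √2) 6 :=
    ⟨by norm_num, by linarith [Real.sqrt_nonneg 2], by push_cast; nlinarith⟩
  refine theoryDecidable_of_quadUnit H fun x hx => ?_
  obtain ⟨p, rfl⟩ : x ∈ Set.range ((↑) : ℚ → ℝ) := hK ▸ hx
  exact ⟨p, 0, by simp⟩

theorem exists_quadUnit {n : ℤ} (hn : 0 < n) (hsq : ¬IsSquare n) :
    ∃ (t a b : ℤ), b ≠ 0 ∧ QuadUnit (a + b * √(n : ℝ)) t := by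
  obtain ⟨x, y, h, hy⟩ := Pell.exists_of_not_isSquare hn hsq
  have hn' : (0 : ℝ) ≤ n := by exact_mod_cast hn.le
  have hs : √(n : ℝ) ^ 2 = n := Real.sq_sqrt hn'
  have hy1 : 1 ≤ |y| := Int.one_le_abs hy
  have hxy : |x| ^ 2 - n * |y| ^ 2 = 1 := by rw [sq_abs, sq_abs, h]
  have hx : 2 ≤ |x| := by
    have := abs_nonneg x
    by_contra hlt
    nlinarith
  have hxy' : (|x| : ℤ) ^ 2 - n * (|y| : ℤ) ^ 2 = (1 : ℝ) := by exact_mod_cast hxy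
  refine ⟨2 * |x|, |x|, |y|, by omega, by omega, ?_, ?_⟩
  · have h1 : (2 : ℝ) ≤ (|x| : ℤ) := by exact_mod_cast hx
    have h2 : (0 : ℝ) ≤ (|y| : ℤ) := by exact_mod_cast abs_nonneg y
    have := mul_nonneg h2 (Real.sqrt_nonneg n)
    linarith
  · push_cast at *
    linear_combination -hxy' + hs * |(y : ℝ)| ^ 2

theorem theoryDecidable_of_eq_sqrt {d : ℚ} (hd : 0 < d) (hsq : ¬∃ c : ℚ, c ^ 2 = d)
    (hK : (K : Set ℝ) = {x : ℝ | ∃ p q : ℚ, x = (p : ℝ) + (q : ℝ) * Real.sqrt d}) :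
    TheoryDecidable (kLang K) ℝ := by
  have hden : (d.den : ℚ) ≠ 0 := by exact_mod_cast d.den_ne_zero
  have hnum : d * d.den = d.num := Rat.mul_den_eq_num d
  obtain ⟨t, a, b, hb, H⟩ := exists_quadUnit (n := d.num * d.den)
    (mul_pos (Rat.num_pos.2 hd) (by exact_mod_cast d.den_pos)) fun ⟨m, hm⟩ => hsq ⟨m / d.den, by
      have hm' : (d.num : ℚ) * d.den = m * m := by exact_mod_cast hm
      rw [div_pow, div_eq_iff (pow_ne_zero 2 hden), sq, ← hm', ← hnum]
      ring⟩
  have hsqrt : √((d.num * d.den : ℤ) : ℝ) = d.den * √(d : ℝ) := by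
    have h1 : ((d.num * d.den : ℤ) : ℝ) = (d.den : ℝ) ^ 2 * d := by
      have : ((d.num * d.den : ℤ) : ℚ) = (d.den : ℚ) ^ 2 * d := by
        push_cast
        rw [← hnum]
        ring
      exact_mod_cast this
    rw [h1, Real.sqrt_mul (by positivity), Real.sqrt_sq (by positivity)]
  rw [hsqrt] at H
  refine theoryDecidable_of_quadUnit H fun x hx => ?_
  obtain ⟨p, q, rfl⟩ : x ∈ {x : ℝ | ∃ p q : ℚ, x = (p : ℝ) + (q : ℝ) * Real.sqrt d} := hK ▸ hx
  refine ⟨p - q / (b * d.den) * a, q / (b * d.den), ?_⟩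
  have hb' : (b : ℝ) ≠ 0 := by exact_mod_cast hb
  have hden' : (d.den : ℝ) ≠ 0 := by exact_mod_cast d.den_ne_zero
  push_cast
  field_simp
  ring

end

end Decidability

theorem theorem_C (K : Subfield ℝ) :
    (letI := kStruc K; TheoryDecidable (kLang K) ℝ) ↔
      ((K : Set ℝ) = Set.range ((↑) : ℚ → ℝ) ∨
        ∃ d : ℚ, 0 < d ∧ (¬ ∃ c : ℚ, c ^ 2 = d) ∧
          (K : Set ℝ) = {x : ℝ | ∃ p q : ℚ, x = (p : ℝ) + (q : ℝ) * Real.sqrt d}) := by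
  refine ⟨fun h => exists_sqrt_of_not_hasIndep fun hK => not_theoryDecidable hK h, ?_⟩
  rintro (hK | ⟨d, hd, hsq, hK⟩)
  exacts [theoryDecidable_of_eq_range hK, theoryDecidable_of_eq_sqrt hd hsq hK]
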